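/- (Conjecture.) Let k > 1 be an integer. Under the hypotheses (i) k = 2 and n ≥ 3κ, or (ii) 3 ≤ k ≤ 6 and n ≥ 2κ, or (iii) k ≥ 7 and n ≥ κ, the quantity α_{k,n} − n is a strictly decreasing function of the integer n. -/

import Mathlib

open scoped BigOperators

/-- The pmf of the Poisson distribution of order `k` with parameter `lam`:
`f_k(n;λ) = e^{-kλ} Σ_{n₁+2n₂+⋯+k n_k = n} λ^{n₁+⋯+n_k}/(n₁!⋯n_k!)`. -/
noncomputable def poissonOrderKPmf (k : ℕ) (lam : ℝ) (n : ℕ) : ℝ :=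
  Real.exp (-(k * lam)) *
    ∑' v : Fin k → ℕ,
      if (∑ i : Fin k, ((i : ℕ) + 1) * v i) = n then
        lam ^ (∑ i : Fin k, v i) / ((∏ i : Fin k, Nat.factorial (v i) : ℕ) : ℝ)
      else 0

/-- The median of the Poisson distribution of order `k` with parameter `lam`:
the least integer `n` such that `P(X ≤ n) ≥ 1/2`. -/
noncomputable def poissonOrderKMedian (k : ℕ) (lam : ℝ) : ℕ :=
  sInf {n : ℕ | (1 : ℝ) / 2 ≤ ∑ j ∈ Finset.range (n + 1), poissonOrderKPmf k lam j}

/-- The unnormalised probabilities of the Poisson distribution of order `k`. -/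
noncomputable def orderKCoeff (k : ℕ) (lam : ℝ) (n : ℕ) : ℝ :=
  ∑' v : Fin k → ℕ,
      if (∑ i : Fin k, ((i : ℕ) + 1) * v i) = n then
        lam ^ (∑ i : Fin k, v i) / ((∏ i : Fin k, Nat.factorial (v i) : ℕ) : ℝ)
      else 0

lemma poissonOrderKPmf_eq (k : ℕ) (lam : ℝ) (n : ℕ) :
    poissonOrderKPmf k lam n = Real.exp (-(k * lam)) * orderKCoeff k lam n := rfl

lemma hasSum_prod_pi (k : ℕ) : ∀ (g : Fin k → ℕ → ℂ) (s : Fin k → ℂ),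
    (∀ i, HasSum (g i) (s i)) → (∀ i, Summable fun m => ‖g i m‖) →
    HasSum (fun v : Fin k → ℕ => ∏ i, g i (v i)) (∏ i, s i) ∧
      Summable fun v : Fin k → ℕ => ‖∏ i, g i (v i)‖ := by
  induction k with
  | zero =>
    intro g s _ _
    simp only [Finset.univ_eq_empty, Finset.prod_empty]
    refine ⟨?_, ?_⟩
    · exact hasSum_unique (fun _ : Fin 0 → ℕ => (1 : ℂ))
    · exact (hasSum_unique (fun _ : Fin 0 → ℕ => ‖(1 : ℂ)‖)).summable
  | succ k ih =>
    intro g s hs hn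
    obtain ⟨h1, h2⟩ := ih (fun i => g i.succ) (fun i => s i.succ) (fun i => hs _) (fun i => hn _)
    have hsum := summable_mul_of_summable_norm (hn 0) h2
    have hm := (hs 0).mul h1 hsum
    have hnorm := Summable.mul_norm (hn 0) h2
    refine ⟨?_, ?_⟩
    · rw [← (Fin.consEquiv (fun _ : Fin (k + 1) => ℕ)).hasSum_iff, Fin.prod_univ_succ]
      have he : ((fun v : Fin (k + 1) → ℕ => ∏ i, g i (v i)) ∘
          (Fin.consEquiv (fun _ : Fin (k + 1) => ℕ))) =
          fun p : ℕ × (Fin k → ℕ) => g 0 p.1 * ∏ i : Fin k, g i.succ (p.2 i) := by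
        funext p
        simp [Fin.consEquiv, Fin.prod_univ_succ]
      rw [he]
      exact hm
    · rw [← (Fin.consEquiv (fun _ : Fin (k + 1) => ℕ)).summable_iff]
      have he : ((fun v : Fin (k + 1) → ℕ => ‖∏ i, g i (v i)‖) ∘
          (Fin.consEquiv (fun _ : Fin (k + 1) => ℕ))) =
          fun p : ℕ × (Fin k → ℕ) => ‖g 0 p.1 * ∏ i : Fin k, g i.succ (p.2 i)‖ := by
        funext p
        simp [Fin.consEquiv, Fin.prod_univ_succ]
      rw [he]
      exact hnorm

lemma hasSum_orderKCoeff (k : ℕ) (lam : ℝ) (z : ℂ) :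
    HasSum (fun n => (orderKCoeff k lam n : ℂ) * z ^ n)
      (Complex.exp (lam * ∑ i : Fin k, z ^ ((i : ℕ) + 1))) := by
  have h := (hasSum_prod_pi k (fun i m => ((lam : ℂ) * z ^ ((i : ℕ) + 1)) ^ m / (m.factorial : ℂ))
    (fun i => Complex.exp ((lam : ℂ) * z ^ ((i : ℕ) + 1)))
    (fun i => by
      rw [Complex.exp_eq_exp_ℂ]
      exact NormedSpace.expSeries_div_hasSum_exp _)
    (fun i => NormedSpace.norm_expSeries_div_summable _)).1
  rw [← Complex.exp_sum, ← Finset.mul_sum] at h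
  have h' := h.tsum_fiberwise (fun v : Fin k → ℕ => ∑ i : Fin k, ((i : ℕ) + 1) * v i)
  suffices he : (fun n => (orderKCoeff k lam n : ℂ) * z ^ n) = fun n =>
      ∑' v : (fun v : Fin k → ℕ => ∑ i : Fin k, ((i : ℕ) + 1) * v i) ⁻¹' {n},
        ∏ i : Fin k, ((lam : ℂ) * z ^ ((i : ℕ) + 1)) ^ v.1 i / ((v.1 i).factorial : ℂ) by
    rw [he]
    exact h'
  funext n
  rw [orderKCoeff, Complex.ofReal_tsum, ← tsum_mul_right,
    tsum_subtype ((fun v : Fin k → ℕ => ∑ i : Fin k, ((i : ℕ) + 1) * v i) ⁻¹' {n})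
      (fun v => ∏ i : Fin k, ((lam : ℂ) * z ^ ((i : ℕ) + 1)) ^ v i / ((v i).factorial : ℂ))]
  congr 1
  funext v
  by_cases hv : (∑ i : Fin k, ((i : ℕ) + 1) * v i) = n
  · rw [if_pos hv, Set.indicator_of_mem (by simpa using hv), Finset.prod_div_distrib]
    simp only [mul_pow, Finset.prod_mul_distrib, Finset.prod_pow_eq_pow_sum, ← pow_mul, hv]
    push_cast
    ring
  · rw [if_neg hv, Set.indicator_of_notMem (by simpa using hv)]
    simp

lemma orderKCoeff_nonneg (k : ℕ) {lam : ℝ} (h : 0 ≤ lam) (n : ℕ) : 0 ≤ orderKCoeff k lam n := by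
  refine tsum_nonneg fun v => ?_
  split_ifs <;> positivity

lemma poissonOrderKPmf_nonneg (k : ℕ) {lam : ℝ} (h : 0 ≤ lam) (n : ℕ) :
    0 ≤ poissonOrderKPmf k lam n :=
  mul_nonneg (Real.exp_pos _).le (orderKCoeff_nonneg k h n)

lemma finite_weight_eq (k n : ℕ) :
    {v : Fin k → ℕ | (∑ i : Fin k, ((i : ℕ) + 1) * v i) = n}.Finite := by
  refine Set.Finite.subset (Set.finite_Iic (fun _ : Fin k => n)) fun v hv i => ?_
  have h1 : ((i : ℕ) + 1) * v i ≤ ∑ i : Fin k, ((i : ℕ) + 1) * v i :=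
    Finset.single_le_sum (f := fun i : Fin k => ((i : ℕ) + 1) * v i) (fun _ _ => Nat.zero_le _)
      (Finset.mem_univ i)
  simp only [Set.mem_ofPred_eq] at hv
  show v i ≤ n
  nlinarith [Nat.zero_le ((i : ℕ) * v i)]

lemma orderKCoeff_zero (k : ℕ) (lam : ℝ) : orderKCoeff k lam 0 = 1 := by
  rw [orderKCoeff, tsum_eq_single 0]
  · simp
  · intro v hv
    rw [if_neg]
    intro h
    apply hv
    funext i
    have := (Finset.sum_eq_zero_iff.mp h) i (Finset.mem_univ i)
    simpa using this

lemma tsum_coord_mul (k : ℕ) (lam : ℝ) (n : ℕ) (i : Fin k) :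
    (∑' v : Fin k → ℕ, (v i : ℝ) * (if (∑ i : Fin k, ((i : ℕ) + 1) * v i) = n then
        lam ^ (∑ i : Fin k, v i) / ((∏ i : Fin k, Nat.factorial (v i) : ℕ) : ℝ) else 0))
      = if (i : ℕ) + 1 ≤ n then lam * orderKCoeff k lam (n - (i + 1)) else 0 := by
  have hinj : Function.Injective (fun v : Fin k → ℕ => v + Pi.single i 1) :=
    fun v w h => by simpa using h
  rw [← hinj.tsum_eq]
  · have hw : ∀ v : Fin k → ℕ, (∑ j : Fin k, ((j : ℕ) + 1) * (v + Pi.single i 1 : Fin k → ℕ) j)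
        = (∑ j : Fin k, ((j : ℕ) + 1) * v j) + (i + 1) := by
      intro v
      simp [mul_add, Finset.sum_add_distrib, Pi.single_apply]
    have hs : ∀ v : Fin k → ℕ,
        (∑ j : Fin k, (v + Pi.single i 1 : Fin k → ℕ) j) = (∑ j : Fin k, v j) + 1 := by
      intro v
      simp [Finset.sum_add_distrib]
    have hf : ∀ v : Fin k → ℕ, (∏ j : Fin k, Nat.factorial ((v + Pi.single i 1 : Fin k → ℕ) j))
        = (∏ j : Fin k, Nat.factorial (v j)) * (v i + 1) := by
      intro v
      rw [← Finset.mul_prod_erase _ _ (Finset.mem_univ i),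
        ← Finset.mul_prod_erase (a := i) _ (fun j => (v j).factorial) (Finset.mem_univ i)]
      have : ∏ x ∈ Finset.univ.erase i, ((v + Pi.single i 1 : Fin k → ℕ) x).factorial
          = ∏ x ∈ Finset.univ.erase i, (v x).factorial := by
        refine Finset.prod_congr rfl fun j hj => ?_
        simp [Finset.ne_of_mem_erase hj]
      rw [this]
      simp [Nat.factorial_succ]
      ring
    simp only [hw, hs, hf]
    split_ifs with hn
    · rw [orderKCoeff, ← tsum_mul_left]
      congr 1
      funext v
      have : ((∑ j : Fin k, ((j : ℕ) + 1) * v j) + (i + 1) = n) ↔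
          ((∑ j : Fin k, ((j : ℕ) + 1) * v j) = n - (i + 1)) := by omega
      simp only [this]
      split_ifs
      · have hp : ((∏ j : Fin k, Nat.factorial (v j) : ℕ) : ℝ) ≠ 0 := by
          exact_mod_cast Finset.prod_ne_zero_iff.mpr fun j _ => Nat.factorial_ne_zero _
        push_cast at hp ⊢
        have : (v i : ℝ) + 1 ≠ 0 := by positivity
        simp only [Pi.add_apply, Pi.single_eq_same, Nat.cast_add, Nat.cast_one]
        field_simp
        ring
      · simp
    · convert tsum_zero with v
      rw [if_neg (by omega), mul_zero]
  · intro v hv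
    simp only [Function.mem_support, ne_eq, mul_eq_zero, not_or, Nat.cast_eq_zero] at hv
    refine ⟨v - Pi.single i 1, ?_⟩
    funext j
    by_cases hj : j = i
    · subst hj
      have := hv.1
      simp
      omega
    · simp [hj]

/-- The recurrence satisfied by the probabilities of the Poisson distribution of order `k`. -/
lemma orderKCoeff_rec (k : ℕ) (lam : ℝ) (n : ℕ) :
    (n : ℝ) * orderKCoeff k lam n = lam * ∑ i : Fin k,
      if (i : ℕ) + 1 ≤ n then ((i : ℕ) + 1 : ℝ) * orderKCoeff k lam (n - (i + 1)) else 0 := by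
  have hfin : ∀ i : Fin k, Summable fun v : Fin k → ℕ => ((i : ℕ) + 1 : ℝ) * ((v i : ℝ) *
      (if (∑ i : Fin k, ((i : ℕ) + 1) * v i) = n then
        lam ^ (∑ i : Fin k, v i) / ((∏ i : Fin k, Nat.factorial (v i) : ℕ) : ℝ) else 0)) := by
    intro i
    refine summable_of_hasFiniteSupport ((finite_weight_eq k n).subset ?_)
    intro v hv
    by_contra h
    exact hv (by simp only [Set.mem_ofPred_eq] at h; simp [h])
  have h1 : (n : ℝ) * orderKCoeff k lam n = ∑' v : Fin k → ℕ, ∑ i : Fin k,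
      ((i : ℕ) + 1 : ℝ) * ((v i : ℝ) * (if (∑ i : Fin k, ((i : ℕ) + 1) * v i) = n then
        lam ^ (∑ i : Fin k, v i) / ((∏ i : Fin k, Nat.factorial (v i) : ℕ) : ℝ) else 0)) := by
    rw [orderKCoeff, ← tsum_mul_left]
    congr 1
    funext v
    split_ifs with h
    · rw [← h]
      push_cast
      rw [Finset.sum_mul]
      exact Finset.sum_congr rfl fun i _ => by ring
    · simp
  rw [h1, Summable.tsum_finsetSum fun i _ => hfin i, Finset.mul_sum]
  refine Finset.sum_congr rfl fun i _ => ?_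
  rw [tsum_mul_left, tsum_coord_mul]
  split_ifs <;> ring

/-- The coefficients `orderKCoeff`, extended by zero to the integers. -/
noncomputable def orderKCoeffInt (k : ℕ) (lam : ℝ) (m : ℤ) : ℝ :=
  if 0 ≤ m then orderKCoeff k lam m.toNat else 0

lemma orderKCoeffInt_natCast (k : ℕ) (lam : ℝ) (n : ℕ) :
    orderKCoeffInt k lam n = orderKCoeff k lam n := by
  simp [orderKCoeffInt]

lemma orderKCoeffInt_of_neg (k : ℕ) (lam : ℝ) {m : ℤ} (h : m < 0) :
    orderKCoeffInt k lam m = 0 := by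
  simp [orderKCoeffInt, not_le.mpr h]

lemma orderKCoeffInt_nonneg (k : ℕ) {lam : ℝ} (h : 0 ≤ lam) (m : ℤ) :
    0 ≤ orderKCoeffInt k lam m := by
  unfold orderKCoeffInt
  split_ifs
  · exact orderKCoeff_nonneg k h _
  · exact le_rfl

lemma orderKCoeffInt_rec (k : ℕ) (lam : ℝ) (m : ℤ) :
    (m : ℝ) * orderKCoeffInt k lam m =
      lam * ∑ i : Fin k, ((i : ℕ) + 1 : ℝ) * orderKCoeffInt k lam (m - ((i : ℕ) + 1)) := by
  rcases lt_or_ge m 0 with h | h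
  · rw [orderKCoeffInt_of_neg k lam h, mul_zero, Finset.sum_eq_zero, mul_zero]
    intro i _
    rw [orderKCoeffInt_of_neg k lam (by omega), mul_zero]
  · lift m to ℕ using h
    rw [orderKCoeffInt_natCast, Int.cast_natCast, orderKCoeff_rec]
    congr 1
    refine Finset.sum_congr rfl fun i _ => ?_
    split_ifs with hi
    · rw [← orderKCoeffInt_natCast, Nat.cast_sub hi]
      push_cast
      rfl
    · rw [orderKCoeffInt_of_neg k lam (by omega), mul_zero]

lemma hasDerivAt_orderKCoeffInt (k : ℕ) (lam : ℝ) (m : ℤ) :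
    HasDerivAt (fun l => orderKCoeffInt k l m)
      (∑ i : Fin k, orderKCoeffInt k lam (m - ((i : ℕ) + 1))) lam := by
  rcases lt_or_ge m 0 with h | h
  · rw [Finset.sum_eq_zero fun i _ => orderKCoeffInt_of_neg k lam (by omega)]
    simp only [orderKCoeffInt_of_neg k _ h]
    exact hasDerivAt_const _ _
  lift m to ℕ using h
  induction m using Nat.strong_induction_on with
  | _ n ih =>
    rcases Nat.eq_zero_or_pos n with rfl | hn
    · rw [Finset.sum_eq_zero fun i _ => orderKCoeffInt_of_neg k lam (by omega)]
      simp only [orderKCoeffInt_natCast, orderKCoeff_zero]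
      exact hasDerivAt_const _ _
    have hn0 : (n : ℝ) ≠ 0 := by positivity
    have ih' : ∀ i : Fin k, HasDerivAt (fun l => orderKCoeffInt k l ((n : ℤ) - ((i : ℕ) + 1)))
        (∑ j : Fin k, orderKCoeffInt k lam ((n : ℤ) - ((i : ℕ) + 1) - ((j : ℕ) + 1))) lam := by
      intro i
      rcases lt_or_ge ((n : ℤ) - ((i : ℕ) + 1)) 0 with h | h
      · rw [Finset.sum_eq_zero fun j _ => orderKCoeffInt_of_neg k lam (by omega)]
        simp only [orderKCoeffInt_of_neg k _ h]
        exact hasDerivAt_const _ _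
      · obtain ⟨m, hm⟩ := Int.eq_ofNat_of_zero_le h
        have := ih m (by omega)
        rw [hm]
        exact this
    have hfun : (fun l => orderKCoeffInt k l (n : ℤ)) = fun l => (n : ℝ)⁻¹ * (l * ∑ i : Fin k,
        ((i : ℕ) + 1 : ℝ) * orderKCoeffInt k l ((n : ℤ) - ((i : ℕ) + 1))) := by
      funext l
      rw [← orderKCoeffInt_rec, Int.cast_natCast, inv_mul_cancel_left₀ hn0]
    have hd := ((hasDerivAt_id lam).mul (HasDerivAt.fun_sum (u := Finset.univ) fun (i : Fin k) _ =>
      (ih' i).const_mul ((i : ℕ) + 1 : ℝ))).const_mul (n : ℝ)⁻¹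
    rw [hfun]
    refine hd.congr_deriv ?_
    rw [inv_mul_eq_iff_eq_mul₀ hn0, Finset.mul_sum Finset.univ _ (n : ℝ)]
    have key : ∀ i : Fin k, (n : ℝ) * orderKCoeffInt k lam ((n : ℤ) - ((i : ℕ) + 1)) =
        ((i : ℕ) + 1 : ℝ) * orderKCoeffInt k lam ((n : ℤ) - ((i : ℕ) + 1)) +
        lam * ∑ j : Fin k, ((j : ℕ) + 1 : ℝ) *
          orderKCoeffInt k lam ((n : ℤ) - ((j : ℕ) + 1) - ((i : ℕ) + 1)) := by
      intro i
      have h := orderKCoeffInt_rec k lam ((n : ℤ) - ((i : ℕ) + 1))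
      have hs : ∀ j : Fin k, (n : ℤ) - ((j : ℕ) + 1) - ((i : ℕ) + 1)
          = (n : ℤ) - ((i : ℕ) + 1) - ((j : ℕ) + 1) := fun j => by ring
      simp only [hs]
      rw [← h]
      push_cast
      ring
    simp only [key, Finset.sum_add_distrib, id_eq, one_mul]
    congr 1
    rw [← Finset.mul_sum Finset.univ _ lam, Finset.sum_comm]
    simp only [Finset.mul_sum]

/-- The cumulative distribution function decreases in the parameter. -/
lemma sum_poissonOrderKPmf_antitone (k n : ℕ) :
    AntitoneOn (fun lam => ∑ j ∈ Finset.range n, poissonOrderKPmf k lam j) (Set.Ici 0) := by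
  have hd : ∀ lam : ℝ, HasDerivAt (fun lam => ∑ j ∈ Finset.range n, poissonOrderKPmf k lam j)
      (Real.exp (-(k * lam)) * (∑ j ∈ Finset.range n,
        ∑ i : Fin k, (orderKCoeffInt k lam ((j : ℤ) - ((i : ℕ) + 1)) -
          orderKCoeffInt k lam (j : ℤ)))) lam := by
    intro lam
    have he : HasDerivAt (fun l : ℝ => Real.exp (-(k * l)))
        (Real.exp (-(k * lam)) * (-(k * 1))) lam :=
      (((hasDerivAt_id lam).const_mul (k : ℝ)).neg).exp
    have hs := he.mul (HasDerivAt.fun_sum (u := Finset.range n) fun j _ =>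
      hasDerivAt_orderKCoeffInt k lam (j : ℤ))
    have hf : (fun lam => ∑ j ∈ Finset.range n, poissonOrderKPmf k lam j) =
        fun l => Real.exp (-(k * l)) * ∑ j ∈ Finset.range n, orderKCoeffInt k l (j : ℤ) := by
      funext l
      rw [Finset.mul_sum]
      exact Finset.sum_congr rfl fun j _ => by
        rw [orderKCoeffInt_natCast, poissonOrderKPmf_eq]
    rw [hf]
    refine hs.congr_deriv ?_
    simp only [Finset.sum_sub_distrib, Finset.sum_const, Finset.card_univ, Fintype.card_fin,
      nsmul_eq_mul, ← Finset.mul_sum]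
    ring
  refine antitoneOn_of_deriv_nonpos (convex_Ici 0)
    (fun x _ => (hd x).continuousAt.continuousWithinAt)
    (fun x _ => (hd x).differentiableAt.differentiableWithinAt) ?_
  intro lam hl
  rw [interior_Ici, Set.mem_Ioi] at hl
  rw [(hd lam).deriv]
  refine mul_nonpos_of_nonneg_of_nonpos (Real.exp_pos _).le ?_
  rw [Finset.sum_comm]
  refine Finset.sum_nonpos fun i _ => ?_
  rw [Finset.sum_sub_distrib, sub_nonpos]
  rcases le_total n ((i : ℕ) + 1) with h | h
  · rw [Finset.sum_eq_zero]
    · exact Finset.sum_nonneg fun j _ => orderKCoeffInt_nonneg k hl.le _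
    · intro j hj
      rw [Finset.mem_range] at hj
      exact orderKCoeffInt_of_neg k lam (by omega)
  · obtain ⟨m, rfl⟩ := Nat.exists_eq_add_of_le h
    rw [Finset.sum_range_add, Finset.sum_eq_zero, zero_add]
    · have hs : ∀ j : ℕ, (((i : ℕ) + 1 + j : ℕ) : ℤ) - ((i : ℕ) + 1) = (j : ℤ) := by
        intro j
        push_cast
        ring
      simp only [hs]
      exact Finset.sum_le_sum_of_subset_of_nonneg
        (Finset.range_subset_range.mpr (by omega))
        fun j _ _ => orderKCoeffInt_nonneg k hl.le _
    · intro j hj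
      rw [Finset.mem_range] at hj
      exact orderKCoeffInt_of_neg k lam (by omega)

/-- The Dirichlet kernel. -/
noncomputable def dirichletSum (m : ℕ) (t : ℝ) : ℝ :=
  1 + 2 * ∑ j ∈ Finset.range m, Real.cos (((j : ℝ) + 1) * t)

lemma dirichletSum_mul_sin (m : ℕ) (t : ℝ) :
    dirichletSum m t * Real.sin (t / 2) = Real.sin (((m : ℝ) + 1 / 2) * t) := by
  induction m with
  | zero =>
    simp only [dirichletSum, Finset.range_zero, Finset.sum_empty, Nat.cast_zero]
    ring_nf
  | succ m ih =>
    have h : dirichletSum (m + 1) t = dirichletSum m t + 2 * Real.cos (((m : ℝ) + 1) * t) := by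
      simp only [dirichletSum, Finset.sum_range_succ]
      ring
    rw [h, add_mul, ih]
    have e1 : ((m : ℝ) + 1 / 2) * t = ((m : ℝ) + 1) * t - t / 2 := by ring
    have e2 : (((m + 1 : ℕ) : ℝ) + 1 / 2) * t = ((m : ℝ) + 1) * t + t / 2 := by push_cast; ring
    rw [e1, e2, Real.sin_sub, Real.sin_add]
    ring

lemma abs_dirichletSum_le (m : ℕ) (t : ℝ) : |dirichletSum m t| ≤ 2 * m + 1 := by
  unfold dirichletSum
  have h : |∑ j ∈ Finset.range m, Real.cos (((j : ℝ) + 1) * t)| ≤ m := by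
    refine (Finset.abs_sum_le_sum_abs _ _).trans ?_
    refine (Finset.sum_le_sum fun j _ => Real.abs_cos_le_one _).trans ?_
    simp
  rw [abs_le] at h ⊢
  constructor <;> linarith [h.1, h.2]

lemma continuous_dirichletSum (m : ℕ) : Continuous (dirichletSum m) := by
  unfold dirichletSum
  fun_prop

lemma integral_dirichletSum (m : ℕ) : ∫ t in (0 : ℝ)..Real.pi, dirichletSum m t = Real.pi := by
  unfold dirichletSum
  rw [intervalIntegral.integral_add (by simp) (Continuous.intervalIntegrable (by fun_prop) _ _),
    intervalIntegral.integral_const_mul, intervalIntegral.integral_finsetSum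
      fun j _ => Continuous.intervalIntegrable (by fun_prop) _ _, Finset.sum_eq_zero]
  · simp
  · intro j _
    rw [intervalIntegral.integral_comp_mul_left (fun x => Real.cos x) (by positivity)]
    have : Real.sin (((j : ℝ) + 1) * Real.pi) = 0 := by
      exact_mod_cast Real.sin_nat_mul_pi (j + 1)
    simp [this]

lemma hasSum_poissonOrderKPmf (k : ℕ) (lam : ℝ) (z : ℂ) :
    HasSum (fun n => (poissonOrderKPmf k lam n : ℂ) * z ^ n)
      (Complex.exp (-(k * lam)) * Complex.exp (lam * ∑ i : Fin k, z ^ ((i : ℕ) + 1))) := by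
  have h := (hasSum_orderKCoeff k lam z).mul_left (Complex.exp (-(k * lam)))
  refine h.congr_fun fun n => ?_
  rw [poissonOrderKPmf_eq]
  push_cast
  ring

lemma hasSum_poissonOrderKPmf_one (k : ℕ) (lam : ℝ) : HasSum (poissonOrderKPmf k lam) 1 := by
  have h := hasSum_poissonOrderKPmf k lam 1
  simp only [one_pow, mul_one, Finset.sum_const, Finset.card_univ, Fintype.card_fin,
    nsmul_eq_mul, ← Complex.exp_add] at h
  have e : -((k : ℂ) * (lam : ℂ)) + (lam : ℂ) * (k : ℂ) = 0 := by ring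
  rw [e, Complex.exp_zero] at h
  rw [← Complex.ofReal_one] at h
  exact Complex.hasSum_ofReal.mp h

lemma summable_poissonOrderKPmf_mul (k : ℕ) {lam : ℝ} (hl : 0 ≤ lam) (b : ℝ) (hb : 0 ≤ b) :
    Summable fun n : ℕ => poissonOrderKPmf k lam n * (2 * (n : ℝ) + b) := by
  have h := (hasSum_poissonOrderKPmf k lam 2).summable
  have h' : Summable fun n : ℕ => poissonOrderKPmf k lam n * 2 ^ n := by exact_mod_cast h
  refine Summable.of_nonneg_of_le (fun n => ?_) (fun n => ?_) (h'.mul_right (2 + b))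
  · exact mul_nonneg (poissonOrderKPmf_nonneg k hl n) (by positivity)
  · have h1 : (n : ℝ) ≤ 2 ^ n := by exact_mod_cast Nat.lt_two_pow_self.le
    have h2 : (1 : ℝ) ≤ 2 ^ n := one_le_pow₀ (by norm_num)
    rw [mul_assoc]
    refine mul_le_mul_of_nonneg_left ?_ (poissonOrderKPmf_nonneg k hl n)
    nlinarith

lemma hasSum_poissonOrderKPmf_sin (k : ℕ) (lam ν t : ℝ) :
    HasSum (fun n : ℕ => poissonOrderKPmf k lam n * Real.sin (((n : ℝ) - ν) * t))
      (Real.exp (-(lam * ∑ i ∈ Finset.range k, (1 - Real.cos (((i : ℝ) + 1) * t)))) *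
        Real.sin (lam * ∑ i ∈ Finset.range k, Real.sin (((i : ℝ) + 1) * t) - ν * t)) := by
  have h := (hasSum_poissonOrderKPmf k lam (Complex.exp (t * Complex.I))).mul_right
    (Complex.exp (-(ν * t * Complex.I)))
  have h2 := Complex.hasSum_im h
  have e1 : (fun n : ℕ => poissonOrderKPmf k lam n * Real.sin (((n : ℝ) - ν) * t)) =
      fun n : ℕ => ((poissonOrderKPmf k lam n : ℂ) * Complex.exp (t * Complex.I) ^ n *
        Complex.exp (-(ν * t * Complex.I))).im := by
    funext n
    rw [← Complex.exp_nat_mul, mul_assoc, ← Complex.exp_add]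
    have : (n : ℂ) * (t * Complex.I) + -(ν * t * Complex.I) =
        (((n : ℝ) - ν) * t : ℝ) * Complex.I := by
      push_cast
      ring
    rw [this, Complex.im_ofReal_mul, Complex.exp_ofReal_mul_I_im]
  have e2 : Real.exp (-(lam * ∑ i ∈ Finset.range k, (1 - Real.cos (((i : ℝ) + 1) * t)))) *
        Real.sin (lam * ∑ i ∈ Finset.range k, Real.sin (((i : ℝ) + 1) * t) - ν * t) =
      (Complex.exp (-(k * lam)) * Complex.exp (lam * ∑ i : Fin k,
        Complex.exp (t * Complex.I) ^ ((i : ℕ) + 1)) * Complex.exp (-(ν * t * Complex.I))).im := by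
    rw [← Complex.exp_add, ← Complex.exp_add, Complex.exp_im]
    have : (-(k * lam) + lam * ∑ i : Fin k, Complex.exp (t * Complex.I) ^ ((i : ℕ) + 1) +
        -(ν * t * Complex.I) : ℂ) =
      ((-(lam * ∑ i ∈ Finset.range k, (1 - Real.cos (((i : ℝ) + 1) * t))) : ℝ) : ℂ) +
      ((lam * ∑ i ∈ Finset.range k, Real.sin (((i : ℝ) + 1) * t) - ν * t : ℝ) : ℂ)
        * Complex.I := by
      rw [Fin.sum_univ_eq_sum_range (fun i => Complex.exp (t * Complex.I) ^ (i + 1))]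
      have hx : ∀ i : ℕ, Complex.exp (t * Complex.I) ^ (i + 1) =
          (Real.cos (((i : ℝ) + 1) * t) : ℂ) + (Real.sin (((i : ℝ) + 1) * t) : ℂ) * Complex.I := by
        intro i
        rw [← Complex.exp_nat_mul]
        push_cast
        rw [← Complex.exp_mul_I]
        congr 1
        ring
      simp only [hx, Finset.sum_add_distrib, ← Finset.sum_mul, Finset.sum_sub_distrib]
      push_cast
      simp
      ring
    rw [this, Complex.add_re, Complex.add_im, Complex.re_ofReal_mul, Complex.im_ofReal_mul,
      Complex.ofReal_re, Complex.ofReal_im, Complex.I_re, Complex.I_im]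
    simp only [mul_zero, mul_one, add_zero, zero_add]
  rw [e1, e2]
  exact h2

/-- Signed Dirichlet kernels. -/
noncomputable def signedDirichlet (ν n : ℕ) (t : ℝ) : ℝ :=
  if n ≤ ν then -dirichletSum (ν - n) t else dirichletSum (n - ν - 1) t

lemma signedDirichlet_mul_sin (ν n : ℕ) (t : ℝ) :
    signedDirichlet ν n t * Real.sin (t / 2) = Real.sin (((n : ℝ) - (ν + 1 / 2)) * t) := by
  unfold signedDirichlet
  split_ifs with h
  · rw [neg_mul, dirichletSum_mul_sin, Nat.cast_sub h, ← Real.sin_neg]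
    congr 1
    ring
  · rw [dirichletSum_mul_sin, Nat.cast_sub (by omega), Nat.cast_sub (by omega)]
    congr 1
    push_cast
    ring

/-- Gil-Pelaez type inversion formula for the Poisson distribution of order `k`. -/
lemma sum_poissonOrderKPmf_eq_integral (k : ℕ) {lam : ℝ} (hl : 0 ≤ lam) (ν : ℕ) :
    ∫ t in (0 : ℝ)..Real.pi,
      Real.exp (-(lam * ∑ i ∈ Finset.range k, (1 - Real.cos (((i : ℝ) + 1) * t)))) *
        Real.sin (lam * ∑ i ∈ Finset.range k, Real.sin (((i : ℝ) + 1) * t) - (ν + 1 / 2) * t) /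
        Real.sin (t / 2) =
      Real.pi * (1 - 2 * ∑ j ∈ Finset.range (ν + 1), poissonOrderKPmf k lam j) := by
  have hcont : ∀ n, Continuous (signedDirichlet ν n) := by
    intro n
    unfold signedDirichlet
    split_ifs
    · exact (continuous_dirichletSum _).neg
    · exact continuous_dirichletSum _
  have hsum := intervalIntegral.hasSum_integral_of_dominated_convergence
    (μ := MeasureTheory.volume) (a := (0 : ℝ)) (b := Real.pi)
    (F := fun n t => poissonOrderKPmf k lam n * signedDirichlet ν n t)
    (f := fun t => Real.exp (-(lam * ∑ i ∈ Finset.range k, (1 - Real.cos (((i : ℝ) + 1) * t)))) *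
        Real.sin (lam * ∑ i ∈ Finset.range k, Real.sin (((i : ℝ) + 1) * t) - (ν + 1 / 2) * t) /
        Real.sin (t / 2))
    (fun n _ => poissonOrderKPmf k lam n * (2 * (n : ℝ) + (2 * ν + 1)))
    (fun n => (continuous_const.mul (hcont n)).aestronglyMeasurable)
    (fun n => Filter.Eventually.of_forall fun t _ => by
      rw [Real.norm_eq_abs, abs_mul, abs_of_nonneg (poissonOrderKPmf_nonneg k hl n)]
      refine mul_le_mul_of_nonneg_left ?_ (poissonOrderKPmf_nonneg k hl n)
      unfold signedDirichlet
      split_ifs with h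
      · rw [abs_neg]
        refine (abs_dirichletSum_le _ _).trans ?_
        rw [Nat.cast_sub h]
        linarith [Nat.cast_nonneg (α := ℝ) n]
      · refine (abs_dirichletSum_le _ _).trans ?_
        rw [Nat.cast_sub (by omega), Nat.cast_sub (by omega)]
        push_cast
        linarith [Nat.cast_nonneg (α := ℝ) ν])
    (Filter.Eventually.of_forall fun t _ =>
      summable_poissonOrderKPmf_mul k hl _ (by positivity))
    (by simp)
    (Filter.Eventually.of_forall fun t ht => by
      rw [Set.uIoc_of_le Real.pi_pos.le] at ht
      have hs : Real.sin (t / 2) ≠ 0 :=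
        (Real.sin_pos_of_pos_of_lt_pi (by linarith [ht.1]) (by linarith [ht.2, ht.1])).ne'
      have h := (hasSum_poissonOrderKPmf_sin k lam (ν + 1 / 2) t).div_const (Real.sin (t / 2))
      refine h.congr_fun fun n => ?_
      rw [← signedDirichlet_mul_sin, ← mul_assoc, mul_div_cancel_right₀ _ hs])
  have hval : ∀ n, ∫ t in (0 : ℝ)..Real.pi, poissonOrderKPmf k lam n * signedDirichlet ν n t =
      Real.pi * (poissonOrderKPmf k lam n - 2 * if n ∈ Finset.range (ν + 1) then
        poissonOrderKPmf k lam n else 0) := by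
    intro n
    rw [intervalIntegral.integral_const_mul]
    unfold signedDirichlet
    simp only [Finset.mem_range, Nat.lt_succ_iff]
    split_ifs with h
    · rw [intervalIntegral.integral_neg, integral_dirichletSum]
      ring
    · rw [integral_dirichletSum]
      ring
  simp only [hval] at hsum
  have h2 : HasSum (fun n => if n ∈ Finset.range (ν + 1) then poissonOrderKPmf k lam n else 0)
      (∑ j ∈ Finset.range (ν + 1), poissonOrderKPmf k lam j) := by
    have h3 : HasSum (fun n =>
        if n ∈ Finset.range (ν + 1) then poissonOrderKPmf k lam n else 0) _ :=
      hasSum_sum_of_ne_finset_zero (s := Finset.range (ν + 1)) fun n hn => if_neg hn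
    rwa [Finset.sum_ite_mem, Finset.inter_self] at h3
  exact hsum.unique (((hasSum_poissonOrderKPmf_one k lam).sub (h2.mul_left 2)).mul_left Real.pi)

lemma nonneg_of_hasDerivAt_nonneg {f f' : ℝ → ℝ} (hf : ∀ x, HasDerivAt f (f' x) x)
    (h0 : f 0 = 0) (h' : ∀ x, 0 ≤ x → 0 ≤ f' x) {x : ℝ} (hx : 0 ≤ x) : 0 ≤ f x := by
  have hm : MonotoneOn f (Set.Ici 0) := by
    refine monotoneOn_of_deriv_nonneg (convex_Ici 0)
      (fun y _ => (hf y).continuousAt.continuousWithinAt)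
      (fun y _ => (hf y).differentiableAt.differentiableWithinAt) fun y hy => ?_
    rw [interior_Ici] at hy
    rw [(hf y).deriv]
    exact h' y (le_of_lt hy)
  rw [← h0]
  exact hm Set.self_mem_Ici hx hx

lemma hasDerivAt_pow_div (n : ℕ) (c d x : ℝ) (h : d * (n + 1) = c) (hd : d ≠ 0) :
    HasDerivAt (fun x : ℝ => x ^ (n + 1) / c) (x ^ n / d) x := by
  have h1 := (hasDerivAt_pow (n + 1) x).div_const c
  refine h1.congr_deriv ?_
  have : (n : ℝ) + 1 ≠ 0 := by positivity
  subst h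
  simp only [Nat.add_sub_cancel]
  push_cast
  field_simp

lemma sin_lower_three {x : ℝ} (hx : 0 ≤ x) : x - x ^ 3 / 6 ≤ Real.sin x := by
  have := nonneg_of_hasDerivAt_nonneg (f := fun x => Real.sin x - (x - x ^ 3 / 6))
    (f' := fun x => Real.cos x - (1 - x ^ 2 / 2))
    (fun x => (Real.hasDerivAt_sin x).sub ((hasDerivAt_id x).sub
      (hasDerivAt_pow_div 2 6 2 x (by norm_num) (by norm_num))))
    (by simp) (fun x _ => by linarith [Real.one_sub_sq_div_two_le_cos (x := x)]) hx
  linarith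

lemma cos_upper_four {x : ℝ} (hx : 0 ≤ x) : Real.cos x ≤ 1 - x ^ 2 / 2 + x ^ 4 / 24 := by
  have := nonneg_of_hasDerivAt_nonneg (f := fun x => (1 - x ^ 2 / 2 + x ^ 4 / 24) - Real.cos x)
    (f' := fun x => (0 - x ^ 1 / 1 + x ^ 3 / 6) - -Real.sin x)
    (fun x => (((hasDerivAt_const x (1 : ℝ)).sub
      (hasDerivAt_pow_div 1 2 1 x (by norm_num) (by norm_num))).add
      (hasDerivAt_pow_div 3 24 6 x (by norm_num) (by norm_num))).sub (Real.hasDerivAt_cos x))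
    (by simp) (fun x h => by have := sin_lower_three h; linarith) hx
  linarith

lemma sin_upper_five {x : ℝ} (hx : 0 ≤ x) : Real.sin x ≤ x - x ^ 3 / 6 + x ^ 5 / 120 := by
  have := nonneg_of_hasDerivAt_nonneg (f := fun x => (x - x ^ 3 / 6 + x ^ 5 / 120) - Real.sin x)
    (f' := fun x => (1 - x ^ 2 / 2 + x ^ 4 / 24) - Real.cos x)
    (fun x => (((hasDerivAt_id x).sub
      (hasDerivAt_pow_div 2 6 2 x (by norm_num) (by norm_num))).add
      (hasDerivAt_pow_div 4 120 24 x (by norm_num) (by norm_num))).sub (Real.hasDerivAt_sin x))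
    (by simp) (fun x h => by have := cos_upper_four h; linarith) hx
  linarith

lemma cos_lower_six {x : ℝ} (hx : 0 ≤ x) :
    1 - x ^ 2 / 2 + x ^ 4 / 24 - x ^ 6 / 720 ≤ Real.cos x := by
  have := nonneg_of_hasDerivAt_nonneg
    (f := fun x => Real.cos x - (1 - x ^ 2 / 2 + x ^ 4 / 24 - x ^ 6 / 720))
    (f' := fun x => -Real.sin x - (0 - x ^ 1 / 1 + x ^ 3 / 6 - x ^ 5 / 120))
    (fun x => (Real.hasDerivAt_cos x).sub ((((hasDerivAt_const x (1 : ℝ)).sub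
      (hasDerivAt_pow_div 1 2 1 x (by norm_num) (by norm_num))).add
      (hasDerivAt_pow_div 3 24 6 x (by norm_num) (by norm_num))).sub
      (hasDerivAt_pow_div 5 720 120 x (by norm_num) (by norm_num))))
    (by simp) (fun x h => by have := sin_upper_five h; linarith) hx
  linarith

lemma sin_lower_seven {x : ℝ} (hx : 0 ≤ x) :
    x - x ^ 3 / 6 + x ^ 5 / 120 - x ^ 7 / 5040 ≤ Real.sin x := by
  have := nonneg_of_hasDerivAt_nonneg
    (f := fun x => Real.sin x - (x - x ^ 3 / 6 + x ^ 5 / 120 - x ^ 7 / 5040))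
    (f' := fun x => Real.cos x - (1 - x ^ 2 / 2 + x ^ 4 / 24 - x ^ 6 / 720))
    (fun x => (Real.hasDerivAt_sin x).sub ((((hasDerivAt_id x).sub
      (hasDerivAt_pow_div 2 6 2 x (by norm_num) (by norm_num))).add
      (hasDerivAt_pow_div 4 120 24 x (by norm_num) (by norm_num))).sub
      (hasDerivAt_pow_div 6 5040 720 x (by norm_num) (by norm_num))))
    (by simp) (fun x h => by have := cos_lower_six h; linarith) hx
  linarith

lemma cos_upper_eight {x : ℝ} (hx : 0 ≤ x) :
    Real.cos x ≤ 1 - x ^ 2 / 2 + x ^ 4 / 24 - x ^ 6 / 720 + x ^ 8 / 40320 := by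
  have := nonneg_of_hasDerivAt_nonneg
    (f := fun x => (1 - x ^ 2 / 2 + x ^ 4 / 24 - x ^ 6 / 720 + x ^ 8 / 40320) - Real.cos x)
    (f' := fun x => (0 - x ^ 1 / 1 + x ^ 3 / 6 - x ^ 5 / 120 + x ^ 7 / 5040) - -Real.sin x)
    (fun x => (((((hasDerivAt_const x (1 : ℝ)).sub
      (hasDerivAt_pow_div 1 2 1 x (by norm_num) (by norm_num))).add
      (hasDerivAt_pow_div 3 24 6 x (by norm_num) (by norm_num))).sub
      (hasDerivAt_pow_div 5 720 120 x (by norm_num) (by norm_num))).add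
      (hasDerivAt_pow_div 7 40320 5040 x (by norm_num) (by norm_num))).sub
      (Real.hasDerivAt_cos x))
    (by simp) (fun x h => by have := sin_lower_seven h; linarith) hx
  linarith

lemma sin_upper_nine {x : ℝ} (hx : 0 ≤ x) :
    Real.sin x ≤ x - x ^ 3 / 6 + x ^ 5 / 120 - x ^ 7 / 5040 + x ^ 9 / 362880 := by
  have := nonneg_of_hasDerivAt_nonneg
    (f := fun x => (x - x ^ 3 / 6 + x ^ 5 / 120 - x ^ 7 / 5040 + x ^ 9 / 362880) - Real.sin x)
    (f' := fun x => (1 - x ^ 2 / 2 + x ^ 4 / 24 - x ^ 6 / 720 + x ^ 8 / 40320) - Real.cos x)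
    (fun x => (((((hasDerivAt_id x).sub
      (hasDerivAt_pow_div 2 6 2 x (by norm_num) (by norm_num))).add
      (hasDerivAt_pow_div 4 120 24 x (by norm_num) (by norm_num))).sub
      (hasDerivAt_pow_div 6 5040 720 x (by norm_num) (by norm_num))).add
      (hasDerivAt_pow_div 8 362880 40320 x (by norm_num) (by norm_num))).sub
      (Real.hasDerivAt_sin x))
    (by simp) (fun x h => by have := cos_upper_eight h; linarith) hx
  linarith

/-- The scale `k + 1/2`. -/
noncomputable def okM (k : ℕ) : ℝ := k + 1 / 2

/-- The normalising weight `(k + 1/2) / (k (k + 1))`. -/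
noncomputable def okW (k : ℕ) : ℝ := okM k / (k * (k + 1))

/-- The rescaled jump sizes. -/
noncomputable def okQ (k i : ℕ) : ℝ := ((i : ℝ) + 1) / okM k

/-- The rescaled moments of the jump sizes. -/
noncomputable def okB (k r : ℕ) : ℝ := okW k * ∑ i ∈ Finset.range k, okQ k i ^ r

/-- The real part of the rescaled exponent. -/
noncomputable def okA (k : ℕ) (u : ℝ) : ℝ :=
  okW k * ∑ i ∈ Finset.range k, (1 - Real.cos (okQ k i * u))

/-- The imaginary part of the rescaled exponent, without its linear term. -/
noncomputable def okC (k : ℕ) (u : ℝ) : ℝ :=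
  okW k * ∑ i ∈ Finset.range k, (okQ k i * u - Real.sin (okQ k i * u))

/-- The derivative of `okA`. -/
noncomputable def okA' (k : ℕ) (u : ℝ) : ℝ :=
  okW k * ∑ i ∈ Finset.range k, okQ k i * Real.sin (okQ k i * u)

/-- The derivative of `okC`. -/
noncomputable def okC' (k : ℕ) (u : ℝ) : ℝ :=
  okW k * ∑ i ∈ Finset.range k, okQ k i * (1 - Real.cos (okQ k i * u))

lemma okM_pos (k : ℕ) : 0 < okM k := by unfold okM; positivity

lemma okW_nonneg (k : ℕ) : 0 ≤ okW k := div_nonneg (okM_pos k).le (by positivity)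

lemma okQ_nonneg (k i : ℕ) : 0 ≤ okQ k i := div_nonneg (by positivity) (okM_pos k).le

lemma okQ_le_one {k i : ℕ} (h : i ∈ Finset.range k) : okQ k i ≤ 1 := by
  rw [okQ, div_le_one (okM_pos k), okM]
  have : ((i : ℝ) + 1) ≤ k := by exact_mod_cast Finset.mem_range.mp h
  linarith

lemma okB_nonneg (k r : ℕ) : 0 ≤ okB k r :=
  mul_nonneg (okW_nonneg k) (Finset.sum_nonneg fun _ _ => pow_nonneg (okQ_nonneg k _) _)

lemma okB_antitone (k r : ℕ) : okB k (r + 1) ≤ okB k r := by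
  refine mul_le_mul_of_nonneg_left (Finset.sum_le_sum fun i hi => ?_) (okW_nonneg k)
  exact pow_le_pow_of_le_one (okQ_nonneg k i) (okQ_le_one hi) (Nat.le_succ r)

lemma hasDerivAt_okA (k : ℕ) (u : ℝ) : HasDerivAt (okA k) (okA' k u) u := by
  unfold okA okA'
  refine HasDerivAt.const_mul _ (HasDerivAt.fun_sum fun i _ => ?_)
  have := (((hasDerivAt_id u).const_mul (okQ k i)).cos).const_sub 1
  refine this.congr_deriv ?_
  simp
  ring

lemma hasDerivAt_okC (k : ℕ) (u : ℝ) : HasDerivAt (okC k) (okC' k u) u := by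
  unfold okC okC'
  refine HasDerivAt.const_mul _ (HasDerivAt.fun_sum fun i _ => ?_)
  have := ((hasDerivAt_id u).const_mul (okQ k i)).sub (((hasDerivAt_id u).const_mul (okQ k i)).sin)
  refine this.congr_deriv ?_
  simp
  ring

lemma continuous_okA (k : ℕ) : Continuous (okA k) := by unfold okA; fun_prop
lemma continuous_okC (k : ℕ) : Continuous (okC k) := by unfold okC; fun_prop
lemma continuous_okA' (k : ℕ) : Continuous (okA' k) := by unfold okA'; fun_prop
lemma continuous_okC' (k : ℕ) : Continuous (okC' k) := by unfold okC'; fun_prop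

lemma okW_mul_sum_le (k : ℕ) {f g : ℝ → ℝ} {u : ℝ} (hu : 0 ≤ u)
    (h : ∀ y, 0 ≤ y → f y ≤ g y) :
    okW k * ∑ i ∈ Finset.range k, f (okQ k i * u) ≤
      okW k * ∑ i ∈ Finset.range k, g (okQ k i * u) :=
  mul_le_mul_of_nonneg_left (Finset.sum_le_sum fun i _ =>
    h _ (mul_nonneg (okQ_nonneg k i) hu)) (okW_nonneg k)

lemma okW_mul_sum_le' (k : ℕ) {f g : ℝ → ℝ} {u : ℝ} (hu : 0 ≤ u)
    (h : ∀ y, 0 ≤ y → f y ≤ g y) :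
    okW k * ∑ i ∈ Finset.range k, okQ k i * f (okQ k i * u) ≤
      okW k * ∑ i ∈ Finset.range k, okQ k i * g (okQ k i * u) :=
  mul_le_mul_of_nonneg_left (Finset.sum_le_sum fun i _ => mul_le_mul_of_nonneg_left
    (h _ (mul_nonneg (okQ_nonneg k i) hu)) (okQ_nonneg k i)) (okW_nonneg k)

lemma okA_le_six (k : ℕ) {u : ℝ} (hu : 0 ≤ u) :
    okA k u ≤ okB k 2 * u ^ 2 / 2 - okB k 4 * u ^ 4 / 24 + okB k 6 * u ^ 6 / 720 := by
  refine (okW_mul_sum_le k (f := fun y => 1 - Real.cos y)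
    (g := fun y => y ^ 2 / 2 - y ^ 4 / 24 + y ^ 6 / 720) hu
    fun y hy => by linarith [cos_lower_six hy]).trans_eq ?_
  simp only [okB, mul_pow, Finset.sum_add_distrib, Finset.sum_sub_distrib, ← Finset.sum_mul,
    ← Finset.sum_div]
  ring

lemma okA_ge_six (k : ℕ) {u : ℝ} (hu : 0 ≤ u) :
    okB k 2 * u ^ 2 / 2 - okB k 4 * u ^ 4 / 24 + okB k 6 * u ^ 6 / 720 - okB k 8 * u ^ 8 / 40320
      ≤ okA k u := by
  refine Eq.trans_le ?_ (okW_mul_sum_le k (g := fun y => 1 - Real.cos y)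
    (f := fun y => y ^ 2 / 2 - y ^ 4 / 24 + y ^ 6 / 720 - y ^ 8 / 40320) hu
    fun y hy => by linarith [cos_upper_eight hy])
  simp only [okB, mul_pow, Finset.sum_add_distrib, Finset.sum_sub_distrib, ← Finset.sum_mul,
    ← Finset.sum_div]
  ring

lemma okA_le_two (k : ℕ) {u : ℝ} : okA k u ≤ okB k 2 * u ^ 2 / 2 := by
  have : okA k u ≤ okW k * ∑ i ∈ Finset.range k, (okQ k i * u) ^ 2 / 2 :=
    mul_le_mul_of_nonneg_left (Finset.sum_le_sum fun i _ => by
      linarith [Real.one_sub_sq_div_two_le_cos (x := okQ k i * u)]) (okW_nonneg k)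
  refine this.trans_eq ?_
  simp only [okB, mul_pow, ← Finset.sum_mul, ← Finset.sum_div]
  ring

lemma okA_ge_four (k : ℕ) {u : ℝ} (hu : 0 ≤ u) :
    okB k 2 * u ^ 2 / 2 - okB k 4 * u ^ 4 / 24 ≤ okA k u := by
  refine Eq.trans_le ?_ (okW_mul_sum_le k (g := fun y => 1 - Real.cos y)
    (f := fun y => y ^ 2 / 2 - y ^ 4 / 24) hu
    fun y hy => by linarith [cos_upper_four hy])
  simp only [okB, mul_pow, Finset.sum_sub_distrib, ← Finset.sum_mul, ← Finset.sum_div]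
  ring

lemma okA'_le_five (k : ℕ) {u : ℝ} (hu : 0 ≤ u) :
    okA' k u ≤ okB k 2 * u - okB k 4 * u ^ 3 / 6 + okB k 6 * u ^ 5 / 120 := by
  refine (okW_mul_sum_le' k (f := fun y => Real.sin y)
    (g := fun y => y - y ^ 3 / 6 + y ^ 5 / 120) hu
    fun y hy => by linarith [sin_upper_five hy]).trans_eq ?_
  simp only [okB, mul_add, mul_sub, Finset.sum_add_distrib, Finset.sum_sub_distrib]
  simp only [Finset.mul_sum, Finset.sum_mul, Finset.sum_div, ← Finset.sum_add_distrib,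
    ← Finset.sum_sub_distrib]
  exact Finset.sum_congr rfl fun i _ => by ring

lemma okA'_ge_five (k : ℕ) {u : ℝ} (hu : 0 ≤ u) :
    okB k 2 * u - okB k 4 * u ^ 3 / 6 + okB k 6 * u ^ 5 / 120 - okB k 8 * u ^ 7 / 5040
      ≤ okA' k u := by
  refine Eq.trans_le ?_ (okW_mul_sum_le' k (g := fun y => Real.sin y)
    (f := fun y => y - y ^ 3 / 6 + y ^ 5 / 120 - y ^ 7 / 5040) hu
    fun y hy => by linarith [sin_lower_seven hy])
  simp only [okB, Finset.mul_sum, Finset.sum_mul, Finset.sum_div, ← Finset.sum_add_distrib,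
    ← Finset.sum_sub_distrib]
  exact Finset.sum_congr rfl fun i _ => by ring

lemma okA'_ge_three (k : ℕ) {u : ℝ} (hu : 0 ≤ u) :
    okB k 2 * u - okB k 4 * u ^ 3 / 6 ≤ okA' k u := by
  refine Eq.trans_le ?_ (okW_mul_sum_le' k (g := fun y => Real.sin y)
    (f := fun y => y - y ^ 3 / 6) hu
    fun y hy => by linarith [sin_lower_three hy])
  simp only [okB, Finset.mul_sum, Finset.sum_mul, Finset.sum_div, ← Finset.sum_sub_distrib]
  exact Finset.sum_congr rfl fun i _ => by ring

lemma okC_ge_seven (k : ℕ) {u : ℝ} (hu : 0 ≤ u) :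
    okB k 3 * u ^ 3 / 6 - okB k 5 * u ^ 5 / 120 + okB k 7 * u ^ 7 / 5040
      - okB k 9 * u ^ 9 / 362880 ≤ okC k u := by
  refine Eq.trans_le ?_ (okW_mul_sum_le k (g := fun y => y - Real.sin y)
    (f := fun y => y ^ 3 / 6 - y ^ 5 / 120 + y ^ 7 / 5040 - y ^ 9 / 362880) hu
    fun y hy => by linarith [sin_upper_nine hy])
  simp only [okB, Finset.mul_sum, Finset.sum_mul, Finset.sum_div, ← Finset.sum_add_distrib,
    ← Finset.sum_sub_distrib]
  exact Finset.sum_congr rfl fun i _ => by ring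

lemma okC_le_seven (k : ℕ) {u : ℝ} (hu : 0 ≤ u) :
    okC k u ≤ okB k 3 * u ^ 3 / 6 - okB k 5 * u ^ 5 / 120 + okB k 7 * u ^ 7 / 5040 := by
  refine (okW_mul_sum_le k (f := fun y => y - Real.sin y)
    (g := fun y => y ^ 3 / 6 - y ^ 5 / 120 + y ^ 7 / 5040) hu
    fun y hy => by linarith [sin_lower_seven hy]).trans_eq ?_
  simp only [okB, Finset.mul_sum, Finset.sum_mul, Finset.sum_div, ← Finset.sum_add_distrib,
    ← Finset.sum_sub_distrib]
  exact Finset.sum_congr rfl fun i _ => by ring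

lemma okC_le_three (k : ℕ) {u : ℝ} (hu : 0 ≤ u) : okC k u ≤ okB k 3 * u ^ 3 / 6 := by
  refine (okW_mul_sum_le k (f := fun y => y - Real.sin y)
    (g := fun y => y ^ 3 / 6) hu
    fun y hy => by linarith [sin_lower_three hy]).trans_eq ?_
  simp only [okB, Finset.mul_sum, Finset.sum_mul, Finset.sum_div]
  exact Finset.sum_congr rfl fun i _ => by ring

lemma okC_nonneg (k : ℕ) {u : ℝ} (hu : 0 ≤ u) : 0 ≤ okC k u :=
  mul_nonneg (okW_nonneg k) (Finset.sum_nonneg fun i _ => by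
    linarith [Real.sin_le (mul_nonneg (okQ_nonneg k i) hu)])

lemma okA_nonneg (k : ℕ) (u : ℝ) : 0 ≤ okA k u :=
  mul_nonneg (okW_nonneg k) (Finset.sum_nonneg fun i _ => by
    linarith [Real.cos_le_one (okQ k i * u)])

lemma okC'_ge_six (k : ℕ) {u : ℝ} (hu : 0 ≤ u) :
    okB k 3 * u ^ 2 / 2 - okB k 5 * u ^ 4 / 24 + okB k 7 * u ^ 6 / 720
      - okB k 9 * u ^ 8 / 40320 ≤ okC' k u := by
  refine Eq.trans_le ?_ (okW_mul_sum_le' k (g := fun y => 1 - Real.cos y)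
    (f := fun y => y ^ 2 / 2 - y ^ 4 / 24 + y ^ 6 / 720 - y ^ 8 / 40320) hu
    fun y hy => by linarith [cos_upper_eight hy])
  simp only [okB, Finset.mul_sum, Finset.sum_mul, Finset.sum_div, ← Finset.sum_add_distrib,
    ← Finset.sum_sub_distrib]
  exact Finset.sum_congr rfl fun i _ => by ring

lemma okC'_le_six (k : ℕ) {u : ℝ} (hu : 0 ≤ u) :
    okC' k u ≤ okB k 3 * u ^ 2 / 2 - okB k 5 * u ^ 4 / 24 + okB k 7 * u ^ 6 / 720 := by
  refine (okW_mul_sum_le' k (f := fun y => 1 - Real.cos y)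
    (g := fun y => y ^ 2 / 2 - y ^ 4 / 24 + y ^ 6 / 720) hu
    fun y hy => by linarith [cos_lower_six hy]).trans_eq ?_
  simp only [okB, Finset.mul_sum, Finset.sum_mul, Finset.sum_div, ← Finset.sum_add_distrib,
    ← Finset.sum_sub_distrib]
  exact Finset.sum_congr rfl fun i _ => by ring

/-- The inverse square of the scale. -/
noncomputable def okX (k : ℕ) : ℝ := 1 / okM k ^ 2

lemma okB_eq (k r : ℕ) : okB k r * (k * (k + 1)) * okM k ^ r =
    okM k * ∑ i ∈ Finset.range k, ((i : ℝ) + 1) ^ r ∨ k = 0 := by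
  rcases Nat.eq_zero_or_pos k with h | h
  · exact Or.inr h
  · left
    have hM := (okM_pos k).ne'
    have hk : (k : ℝ) ≠ 0 := by positivity
    have hk1 : (k : ℝ) + 1 ≠ 0 := by positivity
    simp only [okB, okW, okQ, div_pow, ← Finset.sum_div]
    field_simp

section powersums

variable (k : ℕ)

lemma sum_pow_one : ∑ i ∈ Finset.range k, ((i : ℝ) + 1) ^ 1 =
    (k * (k + 1) / 2 : ℝ) := by
  induction k with
  | zero => simp
  | succ k ih => rw [Finset.sum_range_succ, ih]; push_cast; ring

lemma sum_pow_two : ∑ i ∈ Finset.range k, ((i : ℝ) + 1) ^ 2 =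
    (k * (k + 1) * (2 * k + 1) / 6 : ℝ) := by
  induction k with
  | zero => simp
  | succ k ih => rw [Finset.sum_range_succ, ih]; push_cast; ring

lemma sum_pow_three : ∑ i ∈ Finset.range k, ((i : ℝ) + 1) ^ 3 =
    (k ^ 2 * (k + 1) ^ 2 / 4 : ℝ) := by
  induction k with
  | zero => simp
  | succ k ih => rw [Finset.sum_range_succ, ih]; push_cast; ring

lemma sum_pow_four : ∑ i ∈ Finset.range k, ((i : ℝ) + 1) ^ 4 =
    (k * (k + 1) * (2 * k + 1) * (3 * k ^ 2 + 3 * k - 1) / 30 : ℝ) := by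
  induction k with
  | zero => simp
  | succ k ih => rw [Finset.sum_range_succ, ih]; push_cast; ring

lemma sum_pow_five : ∑ i ∈ Finset.range k, ((i : ℝ) + 1) ^ 5 =
    (k ^ 2 * (k + 1) ^ 2 * (2 * k ^ 2 + 2 * k - 1) / 12 : ℝ) := by
  induction k with
  | zero => simp
  | succ k ih => rw [Finset.sum_range_succ, ih]; push_cast; ring

lemma sum_pow_six : ∑ i ∈ Finset.range k, ((i : ℝ) + 1) ^ 6 =
    (k * (k + 1) * (2 * k + 1) * (3 * k ^ 4 + 6 * k ^ 3 - 3 * k + 1) / 42 : ℝ) := by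
  induction k with
  | zero => simp
  | succ k ih => rw [Finset.sum_range_succ, ih]; push_cast; ring

lemma sum_pow_seven : ∑ i ∈ Finset.range k, ((i : ℝ) + 1) ^ 7 =
    (k ^ 2 * (k + 1) ^ 2 * (3 * k ^ 4 + 6 * k ^ 3 - k ^ 2 - 4 * k + 2) / 24 : ℝ) := by
  induction k with
  | zero => simp
  | succ k ih => rw [Finset.sum_range_succ, ih]; push_cast; ring

end powersums

/-- Closed form of `okB k 3` in terms of `okX k`. -/
noncomputable def cb3 (x : ℝ) : ℝ := 1 / 4 - x / 16
/-- Closed form of `okB k 4` in terms of `okX k`. -/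
noncomputable def cb4 (x : ℝ) : ℝ := 1 / 5 - 7 * x / 60
/-- Closed form of `okB k 5` in terms of `okX k`. -/
noncomputable def cb5 (x : ℝ) : ℝ := 1 / 6 - x / 6 + x ^ 2 / 32
/-- Closed form of `okB k 6` in terms of `okX k`. -/
noncomputable def cb6 (x : ℝ) : ℝ := 1 / 7 - 3 * x / 14 + 31 * x ^ 2 / 336
/-- Closed form of `okB k 7` in terms of `okX k`. -/
noncomputable def cb7 (x : ℝ) : ℝ := 1 / 8 - 25 * x / 96 + 73 * x ^ 2 / 384 - 17 * x ^ 3 / 512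

lemma okB_eq_of_sum {k r : ℕ} (hk : 0 < k) {s c : ℝ}
    (hs : ∑ i ∈ Finset.range k, ((i : ℝ) + 1) ^ r = s)
    (h : okM k * s = c * (k * (k + 1)) * okM k ^ r) : okB k r = c := by
  have h1 := (okB_eq k r).resolve_right hk.ne'
  rw [hs, h] at h1
  have hM := (okM_pos k).ne'
  have hk : (k : ℝ) ≠ 0 := by positivity
  have hk1 : (k : ℝ) + 1 ≠ 0 := by positivity
  have : (k * (k + 1) : ℝ) * okM k ^ r ≠ 0 := by positivity
  apply mul_right_cancel₀ this
  linarith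

lemma okB_one {k : ℕ} (hk : 0 < k) : okB k 1 = 1 / 2 :=
  okB_eq_of_sum hk (sum_pow_one k) (by ring)

lemma okB_two {k : ℕ} (hk : 0 < k) : okB k 2 = 1 / 3 :=
  okB_eq_of_sum hk (sum_pow_two k) (by unfold okM; ring)

lemma okX_mul (k : ℕ) : okX k * okM k ^ 2 = 1 := by
  have := (okM_pos k).ne'
  unfold okX
  field_simp

lemma okB_three {k : ℕ} (hk : 0 < k) : okB k 3 = cb3 (okX k) :=
  okB_eq_of_sum hk (sum_pow_three k) (by
    have hx := okX_mul k
    have : cb3 (okX k) * (k * (k + 1)) * okM k ^ 3 =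
      (okM k ^ 2 / 4 - okX k * okM k ^ 2 / 16) * (k * (k + 1)) * okM k := by unfold cb3; ring
    rw [this, hx]
    unfold okM
    ring)

lemma okB_four {k : ℕ} (hk : 0 < k) : okB k 4 = cb4 (okX k) :=
  okB_eq_of_sum hk (sum_pow_four k) (by
    have hx := okX_mul k
    have : cb4 (okX k) * (k * (k + 1)) * okM k ^ 4 =
      (okM k ^ 2 / 5 - 7 * (okX k * okM k ^ 2) / 60) * (k * (k + 1)) * okM k ^ 2 := by
      unfold cb4; ring
    rw [this, hx]
    unfold okM
    ring)

lemma okB_five {k : ℕ} (hk : 0 < k) : okB k 5 = cb5 (okX k) :=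
  okB_eq_of_sum hk (sum_pow_five k) (by
    have hx := okX_mul k
    have : cb5 (okX k) * (k * (k + 1)) * okM k ^ 5 =
      (okM k ^ 4 / 6 - okX k * okM k ^ 2 * okM k ^ 2 / 6 + (okX k * okM k ^ 2) ^ 2 / 32)
        * (k * (k + 1)) * okM k := by unfold cb5; ring
    rw [this, hx]
    unfold okM
    ring)

lemma okB_six {k : ℕ} (hk : 0 < k) : okB k 6 = cb6 (okX k) :=
  okB_eq_of_sum hk (sum_pow_six k) (by
    have hx := okX_mul k
    have : cb6 (okX k) * (k * (k + 1)) * okM k ^ 6 =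
      (okM k ^ 4 / 7 - 3 * (okX k * okM k ^ 2) * okM k ^ 2 / 14 +
        31 * (okX k * okM k ^ 2) ^ 2 / 336) * (k * (k + 1)) * okM k ^ 2 := by unfold cb6; ring
    rw [this, hx]
    unfold okM
    ring)

lemma okB_seven {k : ℕ} (hk : 0 < k) : okB k 7 = cb7 (okX k) :=
  okB_eq_of_sum hk (sum_pow_seven k) (by
    have hx := okX_mul k
    have : cb7 (okX k) * (k * (k + 1)) * okM k ^ 7 =
      (okM k ^ 6 / 8 - 25 * (okX k * okM k ^ 2) * okM k ^ 4 / 96 +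
        73 * (okX k * okM k ^ 2) ^ 2 * okM k ^ 2 / 384 - 17 * (okX k * okM k ^ 2) ^ 3 / 512)
        * (k * (k + 1)) * okM k := by unfold cb7; ring
    rw [this, hx]
    unfold okM
    ring)

lemma okX_pos (k : ℕ) : 0 < okX k := by
  have := okM_pos k
  unfold okX
  positivity

lemma okM_ge {k : ℕ} (hk : 2 ≤ k) : 5 / 2 ≤ okM k := by
  have : (2 : ℝ) ≤ k := by exact_mod_cast hk
  unfold okM
  linarith

lemma okX_le {k : ℕ} (hk : 2 ≤ k) : okX k ≤ 4 / 25 := by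
  have := okM_ge hk
  rw [okX, div_le_div_iff₀ (by positivity) (by norm_num)]
  nlinarith

/-- Coefficient of the correction polynomials. -/
noncomputable def okP2 (x : ℝ) : ℝ := -3 * (cb4 x / 12 + x / 72 - cb3 x ^ 2 / 4)
/-- Coefficient of the correction polynomials. -/
noncomputable def okP3 (x : ℝ) : ℝ :=
  -3 * (cb5 x / 40 + x * cb3 x / 72 - cb3 x * cb4 x / 12 + okP2 x * cb3 x / 2)
/-- Coefficient of the correction polynomials. -/
noncomputable def okE0 (x : ℝ) : ℝ := -3 * (2 * okP2 x - cb3 x ^ 2 / 4)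
/-- Coefficient of the correction polynomials. -/
noncomputable def okE1 (x : ℝ) : ℝ :=
  -3 * (3 * okP3 x + cb3 x * okP2 x / 2 + okE0 x * cb3 x / 2)
/-- The second order correction to the median. -/
noncomputable def okH (x : ℝ) : ℝ := -(okE1 x + cb3 x * okE0 x / 2)

section bounds

variable {x : ℝ}

lemma pow_bounds_x (h0 : 0 ≤ x) (h1 : x ≤ 4 / 25) :
    (0 ≤ x ^ 2 ∧ x ^ 2 ≤ (4 / 25) ^ 2) ∧ (0 ≤ x ^ 3 ∧ x ^ 3 ≤ (4 / 25) ^ 3) ∧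
    (0 ≤ x ^ 4 ∧ x ^ 4 ≤ (4 / 25) ^ 4) ∧ (0 ≤ x ^ 5 ∧ x ^ 5 ≤ (4 / 25) ^ 5) :=
  ⟨⟨by positivity, by gcongr⟩, ⟨by positivity, by gcongr⟩, ⟨by positivity, by gcongr⟩,
    ⟨by positivity, by gcongr⟩⟩

lemma cb_bounds (h0 : 0 ≤ x) (h1 : x ≤ 4 / 25) :
    (6 / 25 ≤ cb3 x ∧ cb3 x ≤ 1 / 4) ∧ (0.18 ≤ cb4 x ∧ cb4 x ≤ 1 / 5) ∧
    (0.138 ≤ cb5 x ∧ cb5 x ≤ 1 / 6 + 0.001) ∧ (0.107 ≤ cb6 x ∧ cb6 x ≤ 1 / 7 + 0.0024) ∧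
    (0.08 ≤ cb7 x ∧ cb7 x ≤ 1 / 8 + 0.005) := by
  obtain ⟨⟨_, _⟩, ⟨_, _⟩, _⟩ := pow_bounds_x h0 h1
  unfold cb3 cb4 cb5 cb6 cb7
  refine ⟨⟨?_, ?_⟩, ⟨?_, ?_⟩, ⟨?_, ?_⟩, ⟨?_, ?_⟩, ⟨?_, ?_⟩⟩ <;> linarith

lemma okP_bounds (h0 : 0 ≤ x) (h1 : x ≤ 4 / 25) :
    (-0.009 ≤ okP2 x ∧ okP2 x ≤ -0.003) ∧ (0.001 ≤ okP3 x ∧ okP3 x ≤ 0.002) ∧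
    (0.065 ≤ okE0 x ∧ okE0 x ≤ 0.0966) ∧ (-0.0496 ≤ okE1 x ∧ okE1 x ≤ -0.0328) ∧
    (0.0248 ≤ okH x ∧ okH x ≤ 0.0379) := by
  obtain ⟨⟨_, _⟩, ⟨_, _⟩, ⟨_, _⟩, ⟨_, _⟩⟩ := pow_bounds_x h0 h1
  unfold okH okE1 okE0 okP3 okP2 cb3 cb4 cb5
  ring_nf
  refine ⟨⟨?_, ?_⟩, ⟨?_, ?_⟩, ⟨?_, ?_⟩, ⟨?_, ?_⟩, ⟨?_, ?_⟩⟩ <;> linarith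

lemma rho_bounds (h0 : 0 ≤ x) (h1 : x ≤ 4 / 25) :
    |cb6 x / 360 - x * cb4 x / 288 - cb6 x / 120 - cb4 x * okP2 x / 6 - cb3 x * okP3 x / 2
      + cb5 x * cb3 x / 48| ≤ 0.0000322 ∧
    |cb7 x / 2520 - x * cb5 x / 1440 + cb6 x * cb3 x / 240 - cb4 x * okP3 x / 6
      - cb5 x * okP2 x / 24 - cb7 x / 720| ≤ 0.0000075 ∧
    |okE0 x * cb5 x / 24 + okE1 x * cb4 x / 6| ≤ 0.00096 ∧
    |cb3 x / 2 * okP3 x + okE0 x * cb4 x / 6 + okE1 x * cb3 x / 2| ≤ 0.0028 ∧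
    |okE0 x * cb6 x / 120 + okE1 x * cb5 x / 24| ≤ 0.00023 ∧
    |x * cb6 x / 8640 + cb6 x * okP2 x / 120 + cb5 x * okP3 x / 24
      - cb7 x * cb3 x / 1440| ≤ 0.0000187 ∧
    |x * cb7 x / 60480 + cb6 x * okP3 x / 120 + cb7 x * okP2 x / 720| ≤ 0.00000096 := by
  obtain ⟨⟨_, _⟩, ⟨_, _⟩, ⟨_, _⟩, ⟨_, _⟩⟩ := pow_bounds_x h0 h1
  unfold okE1 okE0 okP3 okP2 cb3 cb4 cb5 cb6 cb7
  ring_nf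
  refine ⟨?_, ?_, ?_, ?_, ?_, ?_, ?_⟩ <;> rw [abs_le] <;> constructor <;> linarith

end bounds

lemma sin_remainder_eq {x N n η u a a' c' S : ℝ} (hNn : N * n = 1) :
    2 * N * a * S + -2 * okP2 x * u - N * a' * (1 + okE0 x * n - okP2 x * u ^ 2)
      - (η + cb3 x / 2 - N * c') * ((-cb3 x / 2 + okE1 x * n) * u - okP3 x * u ^ 3) =
    (η * cb3 x / 2 - (η + cb3 x / 2) * okE1 x * n) * u
    + (η * okP3 x + (cb3 x / 2 * okP3 x + okE0 x * cb4 x / 6 + okE1 x * cb3 x / 2)) * u ^ 3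
    + (N * (cb6 x / 360 - x * cb4 x / 288 - cb6 x / 120 - cb4 x * okP2 x / 6 - cb3 x * okP3 x / 2
      + cb5 x * cb3 x / 48) - (okE0 x * cb6 x / 120 + okE1 x * cb5 x / 24)) * u ^ 5
    + (N * (x * cb6 x / 8640 + cb6 x * okP2 x / 120 + cb5 x * okP3 x / 24 - cb7 x * cb3 x / 1440)
      + cb7 x * okE1 x / 720) * u ^ 7
    + N * (-cb7 x * okP3 x / 720) * u ^ 9
    + 2 * N * a * (S - (1 + x * u ^ 2 / 24))
    - 2 * N * (1 + x * u ^ 2 / 24) *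
      (1 / 3 * u / 2 - cb4 x * u ^ 3 / 24 + cb6 x * u ^ 5 / 720 - a)
    + N * (1 / 3 * u - cb4 x * u ^ 3 / 6 + cb6 x * u ^ 5 / 120 - a')
      * (1 + okE0 x * n - okP2 x * u ^ 2)
    - N * (cb3 x * u ^ 2 / 2 - cb5 x * u ^ 4 / 24 + cb7 x * u ^ 6 / 720 - c')
      * ((-cb3 x / 2 + okE1 x * n) * u - okP3 x * u ^ 3) := by
  have hE1 : okE0 x = -3 * (2 * okP2 x - cb3 x ^ 2 / 4) := rfl
  have hp2 : cb4 x = 12 * (okP2 x / (-3) - x / 72 + cb3 x ^ 2 / 4) := by unfold okP2; ring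
  linear_combination (-okE0 x * (1 / 3 * u - cb4 x * u ^ 3 / 6 + cb6 x * u ^ 5 / 120)
    + okE1 x * u * (cb3 x * u ^ 2 / 2 - cb5 x * u ^ 4 / 24 + cb7 x * u ^ 6 / 720)) * hNn
    - u / 3 * hE1 + N * u ^ 3 / 12 * hp2

lemma cos_remainder_eq {x N n η u a' c c' S : ℝ} (hNn : N * n = 1) :
    2 * N * c * S + ((-cb3 x / 2 + okE1 x * n) - 3 * okP3 x * u ^ 2)
      - N * a' * ((-cb3 x / 2 + okE1 x * n) * u - okP3 x * u ^ 3)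
      + (η + cb3 x / 2 - N * c') * (1 + okE0 x * n - okP2 x * u ^ 2)
      - (η * (1 + okE0 x * n) - okH x * n) =
    -η * okP2 x * u ^ 2
    + (okE0 x * cb5 x / 24 + okE1 x * cb4 x / 6) * u ^ 4
    + (N * (cb7 x / 2520 - x * cb5 x / 1440 + cb6 x * cb3 x / 240 - cb4 x * okP3 x / 6
      - cb5 x * okP2 x / 24 - cb7 x / 720) - (okE0 x * cb7 x / 720 + okE1 x * cb6 x / 120)) * u ^ 6
    + N * (x * cb7 x / 60480 + cb6 x * okP3 x / 120 + cb7 x * okP2 x / 720) * u ^ 8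
    + 2 * N * c * (S - (1 + x * u ^ 2 / 24))
    - 2 * N * (1 + x * u ^ 2 / 24) *
      (cb3 x * u ^ 2 / 6 - cb5 x * u ^ 4 / 120 + cb7 x * u ^ 6 / 5040 - c)
    + N * (1 / 3 * u - cb4 x * u ^ 3 / 6 + cb6 x * u ^ 5 / 120 - a')
      * ((-cb3 x / 2 + okE1 x * n) * u - okP3 x * u ^ 3)
    + N * (cb3 x * u ^ 2 / 2 - cb5 x * u ^ 4 / 24 + cb7 x * u ^ 6 / 720 - c')
      * (1 + okE0 x * n - okP2 x * u ^ 2) := by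
  have hh : okH x = -(okE1 x + cb3 x * okE0 x / 2) := rfl
  have hE1 : okE1 x = -3 * (3 * okP3 x + cb3 x * okP2 x / 2 + okE0 x * cb3 x / 2) := rfl
  have hp3 : cb5 x = 40 * (okP3 x / (-3) - x * cb3 x / 72 + cb3 x * cb4 x / 12
    - okP2 x * cb3 x / 2) := by unfold okP3; ring
  linear_combination (-okE1 x * u * (1 / 3 * u - cb4 x * u ^ 3 / 6 + cb6 x * u ^ 5 / 120)
    - okE0 x * (cb3 x * u ^ 2 / 2 - cb5 x * u ^ 4 / 24 + cb7 x * u ^ 6 / 720)) * hNn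
    - u ^ 2 / 3 * hE1 + n * hh + N * u ^ 4 / 40 * hp3

lemma abs_sum_nine_le {a b c d e f g h i A B C D E F G H I : ℝ} (ha : |a| ≤ A) (hb : |b| ≤ B)
    (hc : |c| ≤ C) (hd : |d| ≤ D) (he : |e| ≤ E) (hf : |f| ≤ F) (hg : |g| ≤ G) (hh : |h| ≤ H)
    (hi : |i| ≤ I) :
    |a + b + c + d + e + f - g + h - i| ≤ A + B + C + D + E + F + G + H + I := by
  rw [abs_le] at *
  constructor <;> linarith [ha.1, ha.2, hb.1, hb.2, hc.1, hc.2, hd.1, hd.2, he.1, he.2, hf.1, hf.2,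
    hg.1, hg.2, hh.1, hh.2, hi.1, hi.2]

lemma abs_mul_le_of_le {a b A B : ℝ} (ha : |a| ≤ A) (hb : |b| ≤ B) : |a * b| ≤ A * B := by
  rw [abs_mul]
  exact mul_le_mul ha hb (abs_nonneg b) ((abs_nonneg a).trans ha)

set_option maxHeartbeats 1000000 in
lemma sin_remainder_le {x N n η u a a' c' S : ℝ} (h0 : 0 ≤ x) (h1 : x ≤ 4 / 25) (hNn : N * n = 1)
    (hN : 30 ≤ N) (hu0 : 0 ≤ u) (hu2 : u ≤ 2)
    (ha : a ≤ 1 / 3 * u / 2 - cb4 x * u ^ 3 / 24 + cb6 x * u ^ 5 / 720)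
    (ha_pos : 0 ≤ a) (ha2 : a ≤ u / 6)
    (ha_ge : 1 / 3 * u / 2 - cb4 x * u ^ 3 / 24 + cb6 x * u ^ 5 / 720 - u ^ 7 / 282240 ≤ a)
    (ha' : a' ≤ 1 / 3 * u - cb4 x * u ^ 3 / 6 + cb6 x * u ^ 5 / 120)
    (ha'_ge : 1 / 3 * u - cb4 x * u ^ 3 / 6 + cb6 x * u ^ 5 / 120 - u ^ 7 / 35280 ≤ a')
    (hc' : c' ≤ cb3 x * u ^ 2 / 2 - cb5 x * u ^ 4 / 24 + cb7 x * u ^ 6 / 720)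
    (hc'_ge : cb3 x * u ^ 2 / 2 - cb5 x * u ^ 4 / 24 + cb7 x * u ^ 6 / 720 - u ^ 8 / 282240 ≤ c')
    (hS : 1 + x * u ^ 2 / 24 ≤ S) (hS_le : S ≤ 1 + x * u ^ 2 / 24 + x ^ 2 * u ^ 4 / 750) :
    |2 * N * a * S + -2 * okP2 x * u - N * a' * (1 + okE0 x * n - okP2 x * u ^ 2)
      - (η + cb3 x / 2 - N * c') * ((-cb3 x / 2 + okE1 x * n) * u - okP3 x * u ^ 3)| ≤
    (0.127 * |η| + 0.0063 * n) * u + (0.0029 + 0.002 * |η|) * u ^ 3 + 0.000052 * N * u ^ 5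
      + 0.00006 * N * u ^ 7 := by
  have hN0 : 0 < N := by linarith
  have hn0 : 0 < n := by
    by_contra hcon
    nlinarith
  have hn1 : n ≤ 1 / 30 := by
    by_contra hcon
    nlinarith
  obtain ⟨⟨hb3, hb3'⟩, ⟨hb4, hb4'⟩, ⟨hb5, hb5'⟩, ⟨hb6, hb6'⟩, ⟨hb7, hb7'⟩⟩ := cb_bounds h0 h1
  obtain ⟨⟨hp2, hp2'⟩, ⟨hp3, hp3'⟩, ⟨he0, he0'⟩, ⟨he1, he1'⟩, -⟩ := okP_bounds h0 h1
  obtain ⟨hr5, -, -, hr3, hr5', hr7, -⟩ := rho_bounds h0 h1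
  have hx2 : x ^ 2 ≤ (4 / 25) ^ 2 := by gcongr
  have hu2' : u ^ 2 ≤ 2 ^ 2 := by gcongr
  have ha1 : |cb3 x| ≤ 1 / 4 := by rw [abs_le]; constructor <;> linarith
  have ha3 : |okP3 x| ≤ 0.002 := by rw [abs_le]; constructor <;> linarith
  have ha4 : |okE1 x| ≤ 0.0496 := by rw [abs_le]; constructor <;> linarith
  have hη0 := abs_nonneg η
  have c1 : |η * cb3 x / 2 - (η + cb3 x / 2) * okE1 x * n| ≤ 0.127 * |η| + 0.0063 * n := by
    have t1 : |η * cb3 x| ≤ |η| * (1 / 4) := abs_mul_le_of_le le_rfl ha1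
    have t2 : |(η + cb3 x / 2) * okE1 x| ≤ (|η| + 1 / 8) * 0.0496 := by
      refine abs_mul_le_of_le ?_ ha4
      refine (abs_add_le _ _).trans ?_
      rw [abs_div, abs_two]
      linarith
    have t3 : |(η + cb3 x / 2) * okE1 x * n| ≤ (|η| + 1 / 8) * 0.0496 * n :=
      abs_mul_le_of_le t2 (abs_of_pos hn0).le
    refine (abs_sub _ _).trans ?_
    rw [abs_div, abs_two]
    have t4 : |η| * n ≤ |η| * (1 / 30) := by gcongr
    linarith
  have c3 : |η * okP3 x + (cb3 x / 2 * okP3 x + okE0 x * cb4 x / 6 + okE1 x * cb3 x / 2)| ≤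
      0.0029 + 0.002 * |η| := by
    have t1 : |η * okP3 x| ≤ |η| * 0.002 := abs_mul_le_of_le le_rfl ha3
    refine (abs_add_le _ _).trans ?_
    linarith
  have hPi : |(-cb3 x / 2 + okE1 x * n) * u - okP3 x * u ^ 3| ≤ 0.135 * u := by
    have e : (-cb3 x / 2 + okE1 x * n) * u - okP3 x * u ^ 3 =
      (-cb3 x / 2 + okE1 x * n - okP3 x * u ^ 2) * u := by ring
    rw [e]
    refine abs_mul_le_of_le ?_ (abs_of_nonneg hu0).le
    have t1 : 0 ≤ okP3 x * u ^ 2 := by positivity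
    have t2 : okP3 x * u ^ 2 ≤ 0.002 * 2 ^ 2 := by gcongr
    have t3 : |okE1 x * n| ≤ 0.0496 * (1 / 30) :=
      abs_mul_le_of_le ha4 ((abs_of_pos hn0).le.trans hn1)
    rw [abs_le] at t3 ⊢
    constructor <;> linarith [t3.1, t3.2]
  have hPr : |1 + okE0 x * n - okP2 x * u ^ 2| ≤ 1.04 := by
    have t1 : |okP2 x * u ^ 2| ≤ 0.009 * 2 ^ 2 :=
      abs_mul_le_of_le (by rw [abs_le]; constructor <;> linarith)
        (by rw [abs_of_nonneg (by positivity)]; exact hu2')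
    have t3 : |okE0 x * n| ≤ 0.0966 * (1 / 30) :=
      abs_mul_le_of_le (by rw [abs_le]; constructor <;> linarith)
        ((abs_of_pos hn0).le.trans hn1)
    rw [abs_le] at t1 t3 ⊢
    constructor <;> linarith [t3.1, t3.2, t1.1, t1.2]
  have c5 : |N * (cb6 x / 360 - x * cb4 x / 288 - cb6 x / 120 - cb4 x * okP2 x / 6
      - cb3 x * okP3 x / 2 + cb5 x * cb3 x / 48)
      - (okE0 x * cb6 x / 120 + okE1 x * cb5 x / 24)| ≤ 0.00004 * N := by
    have t1 := abs_mul_le_of_le (abs_of_pos hN0).le hr5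
    refine (abs_sub _ _).trans ?_
    linarith
  have c7 : |N * (x * cb6 x / 8640 + cb6 x * okP2 x / 120 + cb5 x * okP3 x / 24
      - cb7 x * cb3 x / 1440) + cb7 x * okE1 x / 720| ≤ 0.000019 * N := by
    have t1 := abs_mul_le_of_le (abs_of_pos hN0).le hr7
    have t2 := abs_mul_le_of_le (a := cb7 x) (A := 0.13) (by rw [abs_le]; constructor <;> linarith)
      ha4
    refine (abs_add_le _ _).trans ?_
    rw [abs_div (cb7 x * okE1 x), abs_of_pos (by norm_num : (0 : ℝ) < 720)]
    linarith
  have c9 : |N * (-cb7 x * okP3 x / 720) * u ^ 9| ≤ 0.0000015 * N * u ^ 7 := by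
    have t2 := abs_mul_le_of_le (a := cb7 x) (A := 0.13) (by rw [abs_le]; constructor <;> linarith)
      ha3
    have t3 := abs_mul_le_of_le t2 (abs_of_nonneg (mul_nonneg hN0.le (pow_nonneg hu0 9))).le
    have e : N * (-cb7 x * okP3 x / 720) * u ^ 9 =
      -(cb7 x * okP3 x * (N * u ^ 9)) / 720 := by ring
    rw [e, abs_div, abs_neg, abs_of_pos (by norm_num : (0 : ℝ) < 720)]
    have e2 : N * u ^ 9 = N * u ^ 7 * u ^ 2 := by ring
    have : N * u ^ 7 * u ^ 2 ≤ N * u ^ 7 * 2 ^ 2 := by gcongr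
    have : 0 ≤ N * u ^ 7 := by positivity
    rw [div_le_iff₀ (by norm_num)]
    rw [e2] at t3 ⊢
    linarith
  have r1 : |2 * N * a * (S - (1 + x * u ^ 2 / 24))| ≤ 0.0000115 * N * u ^ 5 := by
    rw [abs_of_nonneg (mul_nonneg (by positivity) (by linarith))]
    have : 2 * N * a * (S - (1 + x * u ^ 2 / 24)) ≤
        2 * N * (u / 6) * ((4 / 25) ^ 2 * u ^ 4 / 750) := by
      refine mul_le_mul (by gcongr) ?_ (by linarith) (by positivity)
      have : x ^ 2 * u ^ 4 ≤ (4 / 25) ^ 2 * u ^ 4 := by gcongr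
      linarith
    refine this.trans ?_
    have : 0 ≤ N * u ^ 5 := by positivity
    linarith
  have r2 : |2 * N * (1 + x * u ^ 2 / 24) *
      (1 / 3 * u / 2 - cb4 x * u ^ 3 / 24 + cb6 x * u ^ 5 / 720 - a)| ≤ 0.0000073 * N * u ^ 7 := by
    rw [abs_of_nonneg (mul_nonneg (by positivity) (by linarith))]
    have t : x * u ^ 2 ≤ 4 / 25 * 2 ^ 2 := by gcongr
    have : 2 * N * (1 + x * u ^ 2 / 24) *
      (1 / 3 * u / 2 - cb4 x * u ^ 3 / 24 + cb6 x * u ^ 5 / 720 - a) ≤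
        2 * N * (1 + 0.0267) * (u ^ 7 / 282240) := by
      refine mul_le_mul (by gcongr; linarith) (by linarith) (by linarith) (by positivity)
    refine this.trans ?_
    have : 0 ≤ N * u ^ 7 := by positivity
    linarith
  have r3 : |N * (1 / 3 * u - cb4 x * u ^ 3 / 6 + cb6 x * u ^ 5 / 120 - a')
      * (1 + okE0 x * n - okP2 x * u ^ 2)| ≤ 0.0000296 * N * u ^ 7 := by
    have := abs_mul_le_of_le (a := N * (1 / 3 * u - cb4 x * u ^ 3 / 6 + cb6 x * u ^ 5 / 120 - a'))
      (A := N * (u ^ 7 / 35280))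
      (by rw [abs_of_nonneg (mul_nonneg hN0.le (by linarith))]; gcongr; linarith) hPr
    refine this.trans ?_
    have : 0 ≤ N * u ^ 7 := by positivity
    linarith
  have r4 : |N * (cb3 x * u ^ 2 / 2 - cb5 x * u ^ 4 / 24 + cb7 x * u ^ 6 / 720 - c')
      * ((-cb3 x / 2 + okE1 x * n) * u - okP3 x * u ^ 3)| ≤ 0.000002 * N * u ^ 7 := by
    have := abs_mul_le_of_le
      (a := N * (cb3 x * u ^ 2 / 2 - cb5 x * u ^ 4 / 24 + cb7 x * u ^ 6 / 720 - c'))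
      (A := N * (u ^ 8 / 282240))
      (by rw [abs_of_nonneg (mul_nonneg hN0.le (by linarith))]; gcongr; linarith) hPi
    refine this.trans ?_
    have e : N * (u ^ 8 / 282240) * (0.135 * u) = N * u ^ 7 * u ^ 2 * (0.135 / 282240) := by ring
    have : N * u ^ 7 * u ^ 2 ≤ N * u ^ 7 * 2 ^ 2 := by gcongr
    have : 0 ≤ N * u ^ 7 := by positivity
    linarith
  rw [sin_remainder_eq hNn]
  have m1 := abs_mul_le_of_le c1 (abs_of_nonneg hu0).le
  have m3 := abs_mul_le_of_le c3 (abs_of_nonneg (pow_nonneg hu0 3)).le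
  have m5 := abs_mul_le_of_le c5 (abs_of_nonneg (pow_nonneg hu0 5)).le
  have m7 := abs_mul_le_of_le c7 (abs_of_nonneg (pow_nonneg hu0 7)).le
  have hp5 : 0 ≤ N * u ^ 5 := by positivity
  have hp7 : 0 ≤ N * u ^ 7 := by positivity
  refine (abs_sum_nine_le m1 m3 m5 m7 c9 r1 r2 r3 r4).trans ?_
  linarith

lemma abs_sum_eight_le {a b c d e f g h A B C D E F G H : ℝ} (ha : |a| ≤ A) (hb : |b| ≤ B)
    (hc : |c| ≤ C) (hd : |d| ≤ D) (he : |e| ≤ E) (hf : |f| ≤ F) (hg : |g| ≤ G) (hh : |h| ≤ H) :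
    |a + b + c + d + e - f + g + h| ≤ A + B + C + D + E + F + G + H := by
  rw [abs_le] at *
  constructor <;> linarith [ha.1, ha.2, hb.1, hb.2, hc.1, hc.2, hd.1, hd.2, he.1, he.2, hf.1, hf.2,
    hg.1, hg.2, hh.1, hh.2]

set_option maxHeartbeats 1000000 in
lemma cos_remainder_le {x N n η u a' c c' S : ℝ} (h0 : 0 ≤ x) (h1 : x ≤ 4 / 25) (hNn : N * n = 1)
    (hN : 30 ≤ N) (hu0 : 0 ≤ u) (hu2 : u ≤ 2)
    (hc : c ≤ cb3 x * u ^ 2 / 6 - cb5 x * u ^ 4 / 120 + cb7 x * u ^ 6 / 5040)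
    (hc_pos : 0 ≤ c) (hc2 : c ≤ u ^ 2 / 24)
    (hc_ge : cb3 x * u ^ 2 / 6 - cb5 x * u ^ 4 / 120 + cb7 x * u ^ 6 / 5040 - u ^ 8 / 2540160 ≤ c)
    (ha' : a' ≤ 1 / 3 * u - cb4 x * u ^ 3 / 6 + cb6 x * u ^ 5 / 120)
    (ha'_ge : 1 / 3 * u - cb4 x * u ^ 3 / 6 + cb6 x * u ^ 5 / 120 - u ^ 7 / 35280 ≤ a')
    (hc' : c' ≤ cb3 x * u ^ 2 / 2 - cb5 x * u ^ 4 / 24 + cb7 x * u ^ 6 / 720)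
    (hc'_ge : cb3 x * u ^ 2 / 2 - cb5 x * u ^ 4 / 24 + cb7 x * u ^ 6 / 720 - u ^ 8 / 282240 ≤ c')
    (hS : 1 + x * u ^ 2 / 24 ≤ S) (hS_le : S ≤ 1 + x * u ^ 2 / 24 + x ^ 2 * u ^ 4 / 750) :
    |2 * N * c * S + ((-cb3 x / 2 + okE1 x * n) - 3 * okP3 x * u ^ 2)
      - N * a' * ((-cb3 x / 2 + okE1 x * n) * u - okP3 x * u ^ 3)
      + (η + cb3 x / 2 - N * c') * (1 + okE0 x * n - okP2 x * u ^ 2)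
      - (η * (1 + okE0 x * n) - okH x * n)| ≤
    0.009 * |η| * u ^ 2 + 0.00096 * u ^ 4 + 0.000013 * N * u ^ 6 + 0.0000094 * N * u ^ 8 := by
  have hN0 : 0 < N := by linarith
  have hn0 : 0 < n := by
    by_contra hcon
    nlinarith
  have hn1 : n ≤ 1 / 30 := by
    by_contra hcon
    nlinarith
  obtain ⟨⟨hb3, hb3'⟩, ⟨hb4, hb4'⟩, ⟨hb5, hb5'⟩, ⟨hb6, hb6'⟩, ⟨hb7, hb7'⟩⟩ := cb_bounds h0 h1
  obtain ⟨⟨hp2, hp2'⟩, ⟨hp3, hp3'⟩, ⟨he0, he0'⟩, ⟨he1, he1'⟩, -⟩ := okP_bounds h0 h1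
  obtain ⟨-, hr6, hr4, -, -, -, hr8⟩ := rho_bounds h0 h1
  have hx2 : x ^ 2 ≤ (4 / 25) ^ 2 := by gcongr
  have hu2' : u ^ 2 ≤ 2 ^ 2 := by gcongr
  have ha1 : |okE0 x| ≤ 0.0966 := by rw [abs_le]; constructor <;> linarith
  have ha2 : |okP2 x| ≤ 0.009 := by rw [abs_le]; constructor <;> linarith
  have ha3 : |okP3 x| ≤ 0.002 := by rw [abs_le]; constructor <;> linarith
  have ha4 : |okE1 x| ≤ 0.0496 := by rw [abs_le]; constructor <;> linarith
  have hPi : |(-cb3 x / 2 + okE1 x * n) * u - okP3 x * u ^ 3| ≤ 0.135 * u := by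
    have e : (-cb3 x / 2 + okE1 x * n) * u - okP3 x * u ^ 3 =
      (-cb3 x / 2 + okE1 x * n - okP3 x * u ^ 2) * u := by ring
    rw [e]
    refine abs_mul_le_of_le ?_ (abs_of_nonneg hu0).le
    have t1 : 0 ≤ okP3 x * u ^ 2 := by positivity
    have t2 : okP3 x * u ^ 2 ≤ 0.002 * 2 ^ 2 := by gcongr
    have t3 : |okE1 x * n| ≤ 0.0496 * (1 / 30) :=
      abs_mul_le_of_le ha4 ((abs_of_pos hn0).le.trans hn1)
    rw [abs_le] at t3 ⊢
    constructor <;> linarith [t3.1, t3.2]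
  have hPr : |1 + okE0 x * n - okP2 x * u ^ 2| ≤ 1.04 := by
    have t1 : |okP2 x * u ^ 2| ≤ 0.009 * 2 ^ 2 :=
      abs_mul_le_of_le ha2 (by rw [abs_of_nonneg (by positivity)]; exact hu2')
    have t3 : |okE0 x * n| ≤ 0.0966 * (1 / 30) :=
      abs_mul_le_of_le ha1 ((abs_of_pos hn0).le.trans hn1)
    rw [abs_le] at t1 t3 ⊢
    constructor <;> linarith [t3.1, t3.2, t1.1, t1.2]
  have c2 : |-η * okP2 x| ≤ 0.009 * |η| := by
    have := abs_mul_le_of_le (abs_neg η).le ha2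
    linarith
  have c6 : |N * (cb7 x / 2520 - x * cb5 x / 1440 + cb6 x * cb3 x / 240 - cb4 x * okP3 x / 6
      - cb5 x * okP2 x / 24 - cb7 x / 720) - (okE0 x * cb7 x / 720 + okE1 x * cb6 x / 120)|
      ≤ 0.0000101 * N := by
    have t1 := abs_mul_le_of_le (abs_of_pos hN0).le hr6
    have t2 : |okE0 x * cb7 x / 720| ≤ 0.0966 * 0.13 / 720 := by
      rw [abs_div, abs_of_pos (by norm_num : (0 : ℝ) < 720)]
      gcongr
      exact abs_mul_le_of_le ha1 (by rw [abs_le]; constructor <;> linarith)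
    have t3 : |okE1 x * cb6 x / 120| ≤ 0.0496 * 0.146 / 120 := by
      rw [abs_div, abs_of_pos (by norm_num : (0 : ℝ) < 120)]
      gcongr
      exact abs_mul_le_of_le ha4 (by rw [abs_le]; constructor <;> linarith)
    refine (abs_sub _ _).trans ?_
    have := abs_add_le (okE0 x * cb7 x / 720) (okE1 x * cb6 x / 120)
    linarith
  have c8 := abs_mul_le_of_le (abs_of_pos hN0).le hr8
  have r1 : |2 * N * c * (S - (1 + x * u ^ 2 / 24))| ≤ 0.0000029 * N * u ^ 6 := by
    rw [abs_of_nonneg (mul_nonneg (by positivity) (by linarith))]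
    have : 2 * N * c * (S - (1 + x * u ^ 2 / 24)) ≤
        2 * N * (u ^ 2 / 24) * ((4 / 25) ^ 2 * u ^ 4 / 750) := by
      refine mul_le_mul (by gcongr) ?_ (by linarith) (by positivity)
      have : x ^ 2 * u ^ 4 ≤ (4 / 25) ^ 2 * u ^ 4 := by gcongr
      linarith
    refine this.trans ?_
    have : 0 ≤ N * u ^ 6 := by positivity
    linarith
  have r2 : |2 * N * (1 + x * u ^ 2 / 24) *
      (cb3 x * u ^ 2 / 6 - cb5 x * u ^ 4 / 120 + cb7 x * u ^ 6 / 5040 - c)|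
        ≤ 0.00000081 * N * u ^ 8 := by
    rw [abs_of_nonneg (mul_nonneg (by positivity) (by linarith))]
    have t : x * u ^ 2 ≤ 4 / 25 * 2 ^ 2 := by gcongr
    have : 2 * N * (1 + x * u ^ 2 / 24) *
      (cb3 x * u ^ 2 / 6 - cb5 x * u ^ 4 / 120 + cb7 x * u ^ 6 / 5040 - c) ≤
        2 * N * (1 + 0.0267) * (u ^ 8 / 2540160) := by
      refine mul_le_mul (by gcongr; linarith) (by linarith) (by linarith) (by positivity)
    refine this.trans ?_
    have : 0 ≤ N * u ^ 8 := by positivity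
    linarith
  have r3 : |N * (1 / 3 * u - cb4 x * u ^ 3 / 6 + cb6 x * u ^ 5 / 120 - a')
      * ((-cb3 x / 2 + okE1 x * n) * u - okP3 x * u ^ 3)| ≤ 0.0000039 * N * u ^ 8 := by
    have := abs_mul_le_of_le (a := N * (1 / 3 * u - cb4 x * u ^ 3 / 6 + cb6 x * u ^ 5 / 120 - a'))
      (A := N * (u ^ 7 / 35280))
      (by rw [abs_of_nonneg (mul_nonneg hN0.le (by linarith))]; gcongr; linarith) hPi
    refine this.trans ?_
    have : 0 ≤ N * u ^ 8 := by positivity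
    linarith
  have r4 : |N * (cb3 x * u ^ 2 / 2 - cb5 x * u ^ 4 / 24 + cb7 x * u ^ 6 / 720 - c')
      * (1 + okE0 x * n - okP2 x * u ^ 2)| ≤ 0.0000037 * N * u ^ 8 := by
    have := abs_mul_le_of_le
      (a := N * (cb3 x * u ^ 2 / 2 - cb5 x * u ^ 4 / 24 + cb7 x * u ^ 6 / 720 - c'))
      (A := N * (u ^ 8 / 282240))
      (by rw [abs_of_nonneg (mul_nonneg hN0.le (by linarith))]; gcongr; linarith) hPr
    refine this.trans ?_
    have : 0 ≤ N * u ^ 8 := by positivity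
    linarith
  rw [cos_remainder_eq hNn]
  have m2 := abs_mul_le_of_le c2 (abs_of_nonneg (pow_nonneg hu0 2)).le
  have m4 := abs_mul_le_of_le hr4 (abs_of_nonneg (pow_nonneg hu0 4)).le
  have m6 := abs_mul_le_of_le c6 (abs_of_nonneg (pow_nonneg hu0 6)).le
  have m8 := abs_mul_le_of_le c8 (abs_of_nonneg (pow_nonneg hu0 8)).le
  have hp8 : 0 ≤ N * u ^ 8 := by positivity
  refine (abs_sum_eight_le m2 m4 m6 m8 r1 r2 r3 r4).trans ?_
  linarith

/-- The rescaled kernel `1 / (M sin (u / (2 M)))`. -/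
noncomputable def okSig (k : ℕ) (u : ℝ) : ℝ := 1 / (okM k * Real.sin (u / (2 * okM k)))

lemma div_sin_ge {s : ℝ} (h0 : 0 < s) (h1 : s ≤ 2 / 5) : 1 + s ^ 2 / 6 ≤ s / Real.sin s := by
  have hs : 0 < Real.sin s := Real.sin_pos_of_pos_of_lt_pi h0 (by linarith [Real.pi_gt_three])
  rw [le_div_iff₀ hs]
  have h := sin_upper_five h0.le
  have h2 : s ^ 2 ≤ (2 / 5) ^ 2 := by gcongr
  have h5 : 0 < s ^ 5 := by positivity
  calc (1 + s ^ 2 / 6) * Real.sin s ≤ (1 + s ^ 2 / 6) * (s - s ^ 3 / 6 + s ^ 5 / 120) := by gcongr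
    _ = s - s ^ 5 * (7 / 360 - s ^ 2 / 720) := by ring
    _ ≤ s := by nlinarith

lemma div_sin_le {s : ℝ} (h0 : 0 < s) (h1 : s ≤ 2 / 5) :
    s / Real.sin s ≤ 1 + s ^ 2 / 6 + 16 * s ^ 4 / 750 := by
  have hs : 0 < Real.sin s := Real.sin_pos_of_pos_of_lt_pi h0 (by linarith [Real.pi_gt_three])
  rw [div_le_iff₀ hs]
  have h := sin_lower_seven h0.le
  have h2 : s ^ 2 ≤ (2 / 5) ^ 2 := by gcongr
  have h4 : s ^ 4 ≤ (2 / 5) ^ 4 := by gcongr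
  have h6 : s ^ 6 ≤ (2 / 5) ^ 6 := by gcongr
  have h5 : 0 < s ^ 5 := by positivity
  calc s ≤ s + s ^ 5 * (16 / 750 - 7 / 360 + s ^ 2 * (1 / 720 - 1 / 5040 - 16 / 4500)
          + s ^ 4 * (16 / 90000 - 1 / 30240) - s ^ 6 * 16 / 3780000) := by
        have : 0 < s ^ 4 := by positivity
        have : 0 < 16 / 750 - 7 / 360 + s ^ 2 * (1 / 720 - 1 / 5040 - 16 / 4500)
          + s ^ 4 * (16 / 90000 - 1 / 30240) - s ^ 6 * 16 / 3780000 := by nlinarith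
        nlinarith
    _ = (1 + s ^ 2 / 6 + 16 * s ^ 4 / 750) * (s - s ^ 3 / 6 + s ^ 5 / 120 - s ^ 7 / 5040) := by
        ring
    _ ≤ _ := by gcongr

lemma okSig_mul {k : ℕ} {u : ℝ} (hu : 0 < u) :
    u * okSig k u = 2 * (u / (2 * okM k) / Real.sin (u / (2 * okM k))) := by
  have := (okM_pos k).ne'
  unfold okSig
  field_simp

lemma okSig_mul_bounds {k : ℕ} (hk : 2 ≤ k) {u : ℝ} (hu : 0 < u) (hu2 : u ≤ 2) :
    1 + okX k * u ^ 2 / 24 ≤ u * okSig k u / 2 ∧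
      u * okSig k u / 2 ≤ 1 + okX k * u ^ 2 / 24 + okX k ^ 2 * u ^ 4 / 750 := by
  have hM := okM_ge hk
  have hM0 := okM_pos k
  have hs : 0 < u / (2 * okM k) := by positivity
  have hs2 : u / (2 * okM k) ≤ 2 / 5 := by
    rw [div_le_iff₀ (by positivity)]
    linarith
  rw [okSig_mul hu]
  have e1 : okX k * u ^ 2 / 24 = (u / (2 * okM k)) ^ 2 / 6 := by
    unfold okX; field_simp; norm_num
  have e2 : okX k ^ 2 * u ^ 4 / 750 = 16 * (u / (2 * okM k)) ^ 4 / 750 := by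
    unfold okX; field_simp; norm_num
  rw [e1, e2]
  exact ⟨by linarith [div_sin_ge hs hs2], by linarith [div_sin_le hs hs2]⟩

lemma okSig_pos {k : ℕ} {u : ℝ} (hu : 0 < u) (hu2 : u ≤ Real.pi * okM k) : 0 < okSig k u := by
  have hM0 := okM_pos k
  have hs : 0 < u / (2 * okM k) := by positivity
  have hs2 : u / (2 * okM k) ≤ Real.pi / 2 := by
    rw [div_le_iff₀ (by positivity)]
    linarith
  have := Real.sin_pos_of_pos_of_lt_pi hs (by linarith [Real.pi_pos])
  unfold okSig
  positivity

lemma okSig_le {k : ℕ} {u : ℝ} (hu : 0 < u) (hu2 : u ≤ Real.pi * okM k) :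
    okSig k u ≤ Real.pi / u := by
  have hM0 := okM_pos k
  have hs : 0 < u / (2 * okM k) := by positivity
  have hs2 : u / (2 * okM k) ≤ Real.pi / 2 := by
    rw [div_le_iff₀ (by positivity)]
    linarith
  have h1 := Real.mul_le_sin hs.le hs2
  have h2 := Real.sin_pos_of_pos_of_lt_pi hs (by linarith [Real.pi_pos])
  have hpi := Real.pi_pos
  unfold okSig
  rw [div_le_div_iff₀ (by positivity) hu]
  have e : 2 / Real.pi * (u / (2 * okM k)) * (Real.pi * okM k) = u := by field_simp
  have : 2 / Real.pi * (u / (2 * okM k)) * (Real.pi * okM k) ≤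
    Real.sin (u / (2 * okM k)) * (Real.pi * okM k) := by gcongr
  linarith

lemma okB_eight_le (k : ℕ) (hk : 2 ≤ k) : okB k 8 ≤ 1 / 7 ∧ okB k 9 ≤ 1 / 7 := by
  have h6 : okB k 6 ≤ 1 / 7 := by
    rw [okB_six (by omega)]
    have h1 := okX_le hk
    have h0 := okX_pos k
    unfold cb6
    nlinarith
  have h7 := okB_antitone k 6
  have h8 := okB_antitone k 7
  have h9 := okB_antitone k 8
  norm_num at h7 h8 h9
  constructor <;> linarith

lemma okA_ge_quartic {k : ℕ} (hk : 2 ≤ k) {u : ℝ} (hu : 0 ≤ u) :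
    u ^ 2 / 6 - u ^ 4 / 120 ≤ okA k u := by
  have h := okA_ge_four k hu
  rw [okB_two (by omega), okB_four (by omega)] at h
  have hx := okX_pos k
  have : cb4 (okX k) * u ^ 4 ≤ 1 / 5 * u ^ 4 := by
    gcongr; unfold cb4; linarith
  linarith

lemma okA_le_sq {k : ℕ} (hk : 2 ≤ k) {u : ℝ} : okA k u ≤ u ^ 2 / 6 := by
  have h := okA_le_two k (u := u)
  rw [okB_two (by omega)] at h
  linarith

lemma okC_le_cube {k : ℕ} (hk : 2 ≤ k) {u : ℝ} (hu : 0 ≤ u) : okC k u ≤ u ^ 3 / 24 := by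
  have h := okC_le_three k hu
  rw [okB_three (by omega)] at h
  have hx := okX_pos k
  have : cb3 (okX k) * u ^ 3 ≤ 1 / 4 * u ^ 3 := by
    gcongr; unfold cb3; linarith
  linarith

lemma okA'_ge_cubic {k : ℕ} (hk : 2 ≤ k) {u : ℝ} (hu : 0 ≤ u) :
    u / 3 - u ^ 3 / 30 ≤ okA' k u := by
  have h := okA'_ge_three k hu
  rw [okB_two (by omega), okB_four (by omega)] at h
  have hx := okX_pos k
  have : cb4 (okX k) * u ^ 3 ≤ 1 / 5 * u ^ 3 := by
    gcongr; unfold cb4; linarith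
  linarith

/-- The oscillating phase. -/
noncomputable def okArg (k : ℕ) (N d u : ℝ) : ℝ := d * u - N * okC k u

/-- Real part of the correction factor. -/
noncomputable def okPr (k : ℕ) (n u : ℝ) : ℝ := 1 + okE0 (okX k) * n - okP2 (okX k) * u ^ 2

/-- Imaginary part of the correction factor. -/
noncomputable def okPi (k : ℕ) (n u : ℝ) : ℝ :=
  (-cb3 (okX k) / 2 + okE1 (okX k) * n) * u - okP3 (okX k) * u ^ 3

/-- The leading constant. -/
noncomputable def okKap (k : ℕ) (n η : ℝ) : ℝ := η * (1 + okE0 (okX k) * n) - okH (okX k) * n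

/-- The coefficient of the sine after integration by parts. -/
noncomputable def okSs (k : ℕ) (N n η u : ℝ) : ℝ :=
  N * okA k u * okSig k u + -2 * okP2 (okX k) * u - N * okA' k u * okPr k n u
    - (η + cb3 (okX k) / 2 - N * okC' k u) * okPi k n u

/-- The coefficient of the cosine after integration by parts. -/
noncomputable def okSc (k : ℕ) (N n η u : ℝ) : ℝ :=
  N * okC k u * okSig k u + ((-cb3 (okX k) / 2 + okE1 (okX k) * n) - 3 * okP3 (okX k) * u ^ 2)
    - N * okA' k u * okPi k n u
    + (η + cb3 (okX k) / 2 - N * okC' k u) * okPr k n u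

lemma okA'_bounds {k : ℕ} (hk : 2 ≤ k) {u : ℝ} (hu : 0 ≤ u) :
    okA' k u ≤ 1 / 3 * u - cb4 (okX k) * u ^ 3 / 6 + cb6 (okX k) * u ^ 5 / 120 ∧
    1 / 3 * u - cb4 (okX k) * u ^ 3 / 6 + cb6 (okX k) * u ^ 5 / 120 - u ^ 7 / 35280
      ≤ okA' k u := by
  have h1 := okA'_le_five k hu
  have h2 := okA'_ge_five k hu
  have h3 : okB k 8 * u ^ 7 ≤ 1 / 7 * u ^ 7 := by gcongr; exact (okB_eight_le k hk).1
  rw [okB_two (by omega), okB_four (by omega), okB_six (by omega)] at h1 h2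
  constructor <;> linarith

lemma okC'_bounds {k : ℕ} (hk : 2 ≤ k) {u : ℝ} (hu : 0 ≤ u) :
    okC' k u ≤ cb3 (okX k) * u ^ 2 / 2 - cb5 (okX k) * u ^ 4 / 24 + cb7 (okX k) * u ^ 6 / 720 ∧
    cb3 (okX k) * u ^ 2 / 2 - cb5 (okX k) * u ^ 4 / 24 + cb7 (okX k) * u ^ 6 / 720
      - u ^ 8 / 282240 ≤ okC' k u := by
  have h1 := okC'_le_six k hu
  have h2 := okC'_ge_six k hu
  have h3 : okB k 9 * u ^ 8 ≤ 1 / 7 * u ^ 8 := by gcongr; exact (okB_eight_le k hk).2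
  rw [okB_three (by omega), okB_five (by omega), okB_seven (by omega)] at h1 h2
  constructor <;> linarith

lemma okSs_le {k : ℕ} (hk : 2 ≤ k) {N n η u : ℝ} (hNn : N * n = 1) (hN : 30 ≤ N)
    (hu : 0 < u) (hu2 : u ≤ 2) :
    |okSs k N n η u| ≤ (0.127 * |η| + 0.0063 * n) * u + (0.0029 + 0.002 * |η|) * u ^ 3
      + 0.000052 * N * u ^ 5 + 0.00006 * N * u ^ 7 := by
  obtain ⟨hS1, hS2⟩ := okSig_mul_bounds hk hu hu2
  obtain ⟨ha1, ha2⟩ := okA'_bounds hk hu.le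
  obtain ⟨hc1, hc2⟩ := okC'_bounds hk hu.le
  have hA1 := okA_le_six k hu.le
  have hA2 := okA_ge_six k hu.le
  have hA3 := okA_le_sq hk (u := u)
  have hA0 := okA_nonneg k u
  have hB : okB k 8 * u ^ 8 ≤ 1 / 7 * u ^ 8 := by gcongr; exact (okB_eight_le k hk).1
  rw [okB_two (by omega), okB_four (by omega), okB_six (by omega)] at hA1 hA2
  have key := sin_remainder_le (η := η) (a := okA k u / u) (okX_pos k).le (okX_le hk) hNn hN
    hu.le hu2 (by rw [div_le_iff₀ hu]; linarith) (by positivity) (by rw [div_le_iff₀ hu]; linarith)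
    (by rw [le_div_iff₀ hu]; linarith) ha1 ha2 hc1 hc2 hS1 hS2
  convert key using 2
  unfold okSs okPr okPi
  field_simp

lemma okSc_le {k : ℕ} (hk : 2 ≤ k) {N n η u : ℝ} (hNn : N * n = 1) (hN : 30 ≤ N)
    (hu : 0 < u) (hu2 : u ≤ 2) :
    |okSc k N n η u - okKap k n η| ≤
    0.009 * |η| * u ^ 2 + 0.00096 * u ^ 4 + 0.000013 * N * u ^ 6 + 0.0000094 * N * u ^ 8 := by
  obtain ⟨hS1, hS2⟩ := okSig_mul_bounds hk hu hu2
  obtain ⟨ha1, ha2⟩ := okA'_bounds hk hu.le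
  obtain ⟨hc1, hc2⟩ := okC'_bounds hk hu.le
  have hA1 := okC_le_seven k hu.le
  have hA2 := okC_ge_seven k hu.le
  have hA3 := okC_le_cube hk hu.le
  have hA0 := okC_nonneg k hu.le
  have hB : okB k 9 * u ^ 9 ≤ 1 / 7 * u ^ 9 := by gcongr; exact (okB_eight_le k hk).2
  rw [okB_three (by omega), okB_five (by omega), okB_seven (by omega)] at hA1 hA2
  have key := cos_remainder_le (η := η) (c := okC k u / u) (okX_pos k).le (okX_le hk) hNn hN
    hu.le hu2
    (by rw [div_le_iff₀ hu]; linarith) (by positivity) (by rw [div_le_iff₀ hu]; linarith)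
    (by rw [le_div_iff₀ hu]; linarith) ha1 ha2 hc1 hc2 hS1 hS2
  convert key using 2
  unfold okSc okPr okPi okKap
  field_simp

open intervalIntegral in
lemma abs_integral_sub_le_of_pointwise {f g h : ℝ → ℝ} {a b : ℝ} (hab : a ≤ b)
    (hf : IntervalIntegrable f MeasureTheory.volume a b)
    (hg : IntervalIntegrable g MeasureTheory.volume a b)
    (hh : IntervalIntegrable h MeasureTheory.volume a b)
    (H : ∀ u, a < u → u ≤ b → |f u - g u| ≤ h u) :
    |(∫ u in a..b, f u) - ∫ u in a..b, g u| ≤ ∫ u in a..b, h u := by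
  rw [← integral_sub hf hg]
  refine (abs_integral_le_integral_abs hab).trans ?_
  refine integral_mono_on_of_le_Ioo hab (hf.sub hg).abs hh fun u hu => H u hu.1 hu.2.le

/-- The moments of the weight `exp (-N A)` on `[0, 2]`. -/
noncomputable def okMom (k : ℕ) (N : ℝ) (r : ℕ) : ℝ :=
  ∫ u in (0 : ℝ)..2, Real.exp (-(N * okA k u)) * u ^ r

lemma continuous_exp_okA (k : ℕ) (N : ℝ) : Continuous fun u => Real.exp (-(N * okA k u)) :=
  Real.continuous_exp.comp (((continuous_okA k).const_mul N).neg)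

lemma intervalIntegrable_okMom (k : ℕ) (N : ℝ) (r : ℕ) (a b : ℝ) :
    IntervalIntegrable (fun u => Real.exp (-(N * okA k u)) * u ^ r) MeasureTheory.volume a b :=
  ((continuous_exp_okA k N).mul (continuous_pow r)).intervalIntegrable a b

lemma okMom_nonneg (k : ℕ) (N : ℝ) (r : ℕ) : 0 ≤ okMom k N r :=
  intervalIntegral.integral_nonneg (by norm_num) fun u hu =>
    mul_nonneg (Real.exp_nonneg _) (pow_nonneg hu.1 r)

lemma integral_okA'_mul_le (k : ℕ) (N : ℝ) (r : ℕ) :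
    ∫ u in (0 : ℝ)..2, Real.exp (-(N * okA k u)) * (N * okA' k u * u ^ (r + 1)) ≤
      (r + 1) * okMom k N r := by
  have hc : Continuous fun u => Real.exp (-(N * okA k u)) * (N * okA' k u * u ^ (r + 1)) :=
    (continuous_exp_okA k N).mul (((continuous_okA' k).const_mul N).mul (continuous_pow (r + 1)))
  have hd : ∀ u : ℝ, HasDerivAt (fun u => Real.exp (-(N * okA k u)) * u ^ (r + 1))
      ((r + 1) * (Real.exp (-(N * okA k u)) * u ^ r)
        - Real.exp (-(N * okA k u)) * (N * okA' k u * u ^ (r + 1))) u := fun u => by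
    refine ((((hasDerivAt_okA k u).const_mul N).neg.exp).mul
      (hasDerivAt_pow (r + 1) u)).congr_deriv ?_
    push_cast
    simp only [Pi.neg_apply]
    ring
  have h1 := intervalIntegral.integral_eq_sub_of_hasDerivAt (a := 0) (b := 2)
    (fun u _ => hd u) ((((intervalIntegrable_okMom k N r 0 2).const_mul (r + 1 : ℝ))).sub
      (hc.intervalIntegrable 0 2))
  rw [intervalIntegral.integral_sub (((intervalIntegrable_okMom k N r 0 2).const_mul (r + 1 : ℝ)))
      (hc.intervalIntegrable 0 2), intervalIntegral.integral_const_mul] at h1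
  have h2 : 0 ≤ Real.exp (-(N * okA k 2)) * (2 : ℝ) ^ (r + 1) := by positivity
  have h3 : (0 : ℝ) ^ (r + 1) = 0 := by simp
  rw [h3, mul_zero] at h1
  unfold okMom
  linarith

lemma okMom_rec_crude {k : ℕ} (hk : 2 ≤ k) {N : ℝ} (hN : 0 ≤ N) (r : ℕ) :
    N * okMom k N (r + 2) ≤ 5 * ((r + 1) * okMom k N r) := by
  have hc : Continuous fun u => Real.exp (-(N * okA k u)) * (N * okA' k u * u ^ (r + 1)) :=
    (continuous_exp_okA k N).mul (((continuous_okA' k).const_mul N).mul (continuous_pow (r + 1)))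
  have h := integral_okA'_mul_le k N r
  have h2 : N / 5 * okMom k N (r + 2) ≤
      ∫ u in (0 : ℝ)..2, Real.exp (-(N * okA k u)) * (N * okA' k u * u ^ (r + 1)) := by
    unfold okMom
    rw [← intervalIntegral.integral_const_mul]
    refine intervalIntegral.integral_mono_on (by norm_num)
      ((intervalIntegrable_okMom k N (r + 2) 0 2).const_mul _) (hc.intervalIntegrable 0 2)
      fun u hu => ?_
    have hu0 := hu.1
    have h5 : u / 5 ≤ okA' k u := by
      refine le_trans ?_ (okA'_ge_cubic hk hu0)
      have : u ^ 2 ≤ 2 ^ 2 := by gcongr; exact hu.2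
      nlinarith
    calc N / 5 * (Real.exp (-(N * okA k u)) * u ^ (r + 2))
        = Real.exp (-(N * okA k u)) * (N * (u / 5) * u ^ (r + 1)) := by ring
      _ ≤ _ := by gcongr
  linarith

lemma okMom_rec {k : ℕ} (hk : 2 ≤ k) {N : ℝ} (hN : 0 ≤ N) (r : ℕ) :
    okMom k N (r + 2) * (N / 3 - (r + 3) / 6) ≤ (r + 1) * okMom k N r := by
  have hc : Continuous fun u => Real.exp (-(N * okA k u)) * (N * okA' k u * u ^ (r + 1)) :=
    (continuous_exp_okA k N).mul (((continuous_okA' k).const_mul N).mul (continuous_pow (r + 1)))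
  have h := integral_okA'_mul_le k N r
  have h2 : N / 3 * okMom k N (r + 2) - N / 30 * okMom k N (r + 4) ≤
      ∫ u in (0 : ℝ)..2, Real.exp (-(N * okA k u)) * (N * okA' k u * u ^ (r + 1)) := by
    unfold okMom
    rw [← intervalIntegral.integral_const_mul, ← intervalIntegral.integral_const_mul,
      ← intervalIntegral.integral_sub ((intervalIntegrable_okMom k N (r + 2) 0 2).const_mul _)
      ((intervalIntegrable_okMom k N (r + 4) 0 2).const_mul _)]
    refine intervalIntegral.integral_mono_on (by norm_num)
      (((intervalIntegrable_okMom k N (r + 2) 0 2).const_mul _).sub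
      ((intervalIntegrable_okMom k N (r + 4) 0 2).const_mul _)) (hc.intervalIntegrable 0 2)
      fun u hu => ?_
    have hu0 := hu.1
    calc N / 3 * (Real.exp (-(N * okA k u)) * u ^ (r + 2))
          - N / 30 * (Real.exp (-(N * okA k u)) * u ^ (r + 4))
        = Real.exp (-(N * okA k u)) * (N * (u / 3 - u ^ 3 / 30) * u ^ (r + 1)) := by ring
      _ ≤ _ := by gcongr; exact okA'_ge_cubic hk hu0
  have h3 := okMom_rec_crude hk hN (r + 2)
  push_cast at h3
  nlinarith

lemma okMom_bounds {k : ℕ} (hk : 2 ≤ k) {N n : ℝ} (hNn : N * n = 1) (hN : 30 ≤ N) :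
    okMom k N 2 ≤ 3.16 * n * okMom k N 0 ∧ okMom k N 4 ≤ 31.1 * n ^ 2 * okMom k N 0 ∧
    okMom k N 6 ≤ 529 * n ^ 3 * okMom k N 0 ∧ okMom k N 8 ≤ 13080 * n ^ 4 * okMom k N 0 ∧
    okMom k N 10 ≤ 433000 * n ^ 5 * okMom k N 0 := by
  have hn0 : 0 < n := by
    by_contra hcon
    nlinarith
  have step : ∀ r : ℕ, ∀ c : ℝ, 0 ≤ c → r ≤ 8 → (r + 1 : ℝ) ≤ c * (1 / 3 - (r + 3) / 180) →
      okMom k N (r + 2) ≤ c * n * okMom k N r := by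
    intro r c hc hr h
    have h1 := okMom_rec hk (by linarith : 0 ≤ N) r
    have h2 := okMom_nonneg k N r
    have h3 := okMom_nonneg k N (r + 2)
    have hr' : (r : ℝ) ≤ 8 := by exact_mod_cast hr
    have h4 : N * (1 / 3 - (r + 3) / 180) ≤ N / 3 - (r + 3) / 6 := by nlinarith
    have h5 : okMom k N (r + 2) * (N * (1 / 3 - (r + 3) / 180)) ≤
      c * (1 / 3 - (r + 3) / 180) * okMom k N r :=
      (mul_le_mul_of_nonneg_left h4 h3).trans (h1.trans (mul_le_mul_of_nonneg_right h h2))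
    have h6 : 0 < 1 / 3 - ((r : ℝ) + 3) / 180 := by linarith
    have h7 : okMom k N (r + 2) * N ≤ c * okMom k N r := by
      refine le_of_mul_le_mul_right ?_ h6
      linarith
    calc okMom k N (r + 2) = okMom k N (r + 2) * N * n := by rw [mul_assoc, hNn, mul_one]
      _ ≤ c * okMom k N r * n := by gcongr
      _ = _ := by ring
  have s0 := step 0 3.16 (by norm_num) (by norm_num) (by norm_num)
  have s2 := step 2 9.82 (by norm_num) (by norm_num) (by norm_num)
  have s4 := step 4 17 (by norm_num) (by norm_num) (by norm_num)
  have s6 := step 6 24.72 (by norm_num) (by norm_num) (by norm_num)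
  have s8 := step 8 33.1 (by norm_num) (by norm_num) (by norm_num)
  norm_num at s0 s2 s4 s6 s8
  have h0 := okMom_nonneg k N 0
  have b2 : okMom k N 2 ≤ 3.16 * n * okMom k N 0 := by linarith
  have b4 : okMom k N 4 ≤ 31.1 * n ^ 2 * okMom k N 0 := by
    calc okMom k N 4 ≤ 9.82 * n * (3.16 * n * okMom k N 0) :=
          (by linarith : okMom k N 4 ≤ 9.82 * n * okMom k N 2).trans (by gcongr)
      _ = 31.0312 * (n ^ 2 * okMom k N 0) := by ring
      _ ≤ _ := by nlinarith [mul_nonneg (pow_nonneg hn0.le 2) h0]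
  have b6 : okMom k N 6 ≤ 529 * n ^ 3 * okMom k N 0 := by
    calc okMom k N 6 ≤ 17 * n * (31.1 * n ^ 2 * okMom k N 0) :=
          (by linarith : okMom k N 6 ≤ 17 * n * okMom k N 4).trans (by gcongr)
      _ = 528.7 * (n ^ 3 * okMom k N 0) := by ring
      _ ≤ _ := by nlinarith [mul_nonneg (pow_nonneg hn0.le 3) h0]
  have b8 : okMom k N 8 ≤ 13080 * n ^ 4 * okMom k N 0 := by
    calc okMom k N 8 ≤ 24.72 * n * (529 * n ^ 3 * okMom k N 0) :=
          (by linarith : okMom k N 8 ≤ 24.72 * n * okMom k N 6).trans (by gcongr)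
      _ = 13076.88 * (n ^ 4 * okMom k N 0) := by ring
      _ ≤ _ := by nlinarith [mul_nonneg (pow_nonneg hn0.le 4) h0]
  refine ⟨b2, b4, b6, b8, ?_⟩
  calc okMom k N 10 ≤ 33.1 * n * (13080 * n ^ 4 * okMom k N 0) :=
        (by linarith : okMom k N 10 ≤ 33.1 * n * okMom k N 8).trans (by gcongr)
    _ = 432948 * (n ^ 5 * okMom k N 0) := by ring
    _ ≤ _ := by nlinarith [mul_nonneg (pow_nonneg hn0.le 5) h0]

lemma integral_even_poly (k : ℕ) (N c2 c4 c6 c8 c10 : ℝ) :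
    ∫ u in (0 : ℝ)..2, Real.exp (-(N * okA k u)) *
      (c2 * u ^ 2 + c4 * u ^ 4 + c6 * u ^ 6 + c8 * u ^ 8 + c10 * u ^ 10) =
    c2 * okMom k N 2 + c4 * okMom k N 4 + c6 * okMom k N 6 + c8 * okMom k N 8
      + c10 * okMom k N 10 := by
  have hi : ∀ (c : ℝ) (r : ℕ), IntervalIntegrable
      (fun u => c * (Real.exp (-(N * okA k u)) * u ^ r)) MeasureTheory.volume 0 2 :=
    fun c r => (intervalIntegrable_okMom k N r 0 2).const_mul c
  unfold okMom
  simp only [← intervalIntegral.integral_const_mul]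
  rw [← intervalIntegral.integral_add (hi c2 2) (hi c4 4),
    ← intervalIntegral.integral_add ((hi c2 2).add (hi c4 4)) (hi c6 6),
    ← intervalIntegral.integral_add (((hi c2 2).add (hi c4 4)).add (hi c6 6)) (hi c8 8),
    ← intervalIntegral.integral_add ((((hi c2 2).add (hi c4 4)).add (hi c6 6)).add (hi c8 8))
      (hi c10 10)]
  refine intervalIntegral.integral_congr fun u _ => ?_
  ring

/-- Integrand of the derivative in the scale parameter. -/
noncomputable def okF (k : ℕ) (N d u : ℝ) : ℝ :=
  Real.exp (-(N * okA k u)) * (N * okA k u * Real.sin (okArg k N d u)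
    + N * okC k u * Real.cos (okArg k N d u)) * okSig k u

/-- The boundary function of the integration by parts. -/
noncomputable def okG (k : ℕ) (N n d u : ℝ) : ℝ :=
  Real.exp (-(N * okA k u)) * (okPr k n u * Real.sin (okArg k N d u)
    + okPi k n u * Real.cos (okArg k N d u))

/-- The derivative of `okG`. -/
noncomputable def okG' (k : ℕ) (N n d u : ℝ) : ℝ :=
  Real.exp (-(N * okA k u)) * ((-2 * okP2 (okX k) * u - N * okA' k u * okPr k n u
    - (d - N * okC' k u) * okPi k n u) * Real.sin (okArg k N d u)
    + ((-cb3 (okX k) / 2 + okE1 (okX k) * n) - 3 * okP3 (okX k) * u ^ 2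
    - N * okA' k u * okPi k n u + (d - N * okC' k u) * okPr k n u) * Real.cos (okArg k N d u))

lemma hasDerivAt_okArg (k : ℕ) (N d u : ℝ) :
    HasDerivAt (okArg k N d) (d - N * okC' k u) u := by
  refine (((hasDerivAt_id u).const_mul d).sub ((hasDerivAt_okC k u).const_mul N)).congr_deriv ?_
  simp

lemma continuous_okArg (k : ℕ) (N d : ℝ) : Continuous (okArg k N d) :=
  (continuous_const.mul continuous_id).sub (continuous_const.mul (continuous_okC k))

lemma continuous_okPr (k : ℕ) (n : ℝ) : Continuous (okPr k n) := by unfold okPr; fun_prop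
lemma continuous_okPi (k : ℕ) (n : ℝ) : Continuous (okPi k n) := by unfold okPi; fun_prop

lemma hasDerivAt_okG (k : ℕ) (N n d u : ℝ) :
    HasDerivAt (okG k N n d) (okG' k N n d u) u := by
  have hpr : HasDerivAt (okPr k n) (-2 * okP2 (okX k) * u) u := by
    refine (((hasDerivAt_pow 2 u).const_mul (okP2 (okX k))).const_sub _).congr_deriv ?_
    push_cast
    ring
  have hpi : HasDerivAt (okPi k n) ((-cb3 (okX k) / 2 + okE1 (okX k) * n)
      - 3 * okP3 (okX k) * u ^ 2) u := by
    refine (((hasDerivAt_id u).const_mul (-cb3 (okX k) / 2 + okE1 (okX k) * n)).sub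
      ((hasDerivAt_pow 3 u).const_mul (okP3 (okX k)))).congr_deriv ?_
    push_cast
    ring
  have hB := hasDerivAt_okArg k N d u
  refine ((((hasDerivAt_okA k u).const_mul N).neg.exp).mul
    ((hpr.mul hB.sin).add (hpi.mul hB.cos))).congr_deriv ?_
  unfold okG'
  simp only [Pi.neg_apply, Pi.add_apply, Pi.mul_apply]
  ring

lemma continuous_okG' (k : ℕ) (N n d : ℝ) : Continuous (okG' k N n d) := by
  have h1 := continuous_exp_okA k N
  have h2 := continuous_okArg k N d
  have h3 := continuous_okPr k n
  have h4 := continuous_okPi k n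
  have h5 := continuous_okA' k
  have h6 := continuous_okC' k
  unfold okG'
  fun_prop

lemma okG_zero (k : ℕ) (N n d : ℝ) : okG k N n d 0 = 0 := by
  simp [okG, okArg, okPi, okC]

lemma okA_le_linear {k : ℕ} (hk : 2 ≤ k) {u : ℝ} (hu : 0 ≤ u) : okA k u ≤ u / 2 := by
  have h := okW_mul_sum_le k (f := fun y => 1 - Real.cos y) (g := fun y => y) hu fun y hy => by
    rcases le_total y 2 with h | h
    · nlinarith [Real.one_sub_sq_div_two_le_cos (x := y)]
    · linarith [Real.neg_one_le_cos y]
  have h1 := okB_one (k := k) (by omega)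
  unfold okB at h1
  simp only [← Finset.sum_mul] at h
  simp only [pow_one] at h1
  rw [← mul_assoc, h1] at h
  unfold okA
  linarith

lemma okC_le_linear {k : ℕ} (hk : 2 ≤ k) {u : ℝ} (hu : 0 ≤ u) : okC k u ≤ u := by
  have h := okW_mul_sum_le k (f := fun y => y - Real.sin y) (g := fun y => y * 2) hu fun y hy => by
    have := neg_le_of_abs_le (Real.abs_sin_le_abs (x := y))
    rw [abs_of_nonneg hy] at this
    linarith
  have h1 := okB_one (k := k) (by omega)
  unfold okB at h1
  simp only [← Finset.sum_mul] at h
  simp only [pow_one] at h1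
  rw [← mul_assoc, ← mul_assoc, h1] at h
  unfold okC
  linarith

lemma measurable_okSig (k : ℕ) : Measurable (okSig k) := by
  unfold okSig
  fun_prop

lemma measurable_okF (k : ℕ) (N d : ℝ) : Measurable (okF k N d) := by
  have h1 := (continuous_exp_okA k N).measurable
  have h2 := (continuous_okArg k N d).measurable
  have h3 := measurable_okSig k
  have h4 := (continuous_okA k).measurable
  have h5 := (continuous_okC k).measurable
  unfold okF
  fun_prop

lemma abs_okF_le {k : ℕ} {N d u : ℝ} (hN : 0 ≤ N) (hu : 0 < u)
    (hu2 : u ≤ Real.pi * okM k) :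
    |okF k N d u| ≤ Real.exp (-(N * okA k u)) * (N * ((okA k u + okC k u) * (Real.pi / u))) := by
  have h1 := okA_nonneg k u
  have h2 := okC_nonneg k hu.le
  have h3 := okSig_pos hu hu2
  have h4 := okSig_le hu hu2
  have h5 : |N * okA k u * Real.sin (okArg k N d u) + N * okC k u * Real.cos (okArg k N d u)| ≤
      N * okA k u + N * okC k u := by
    refine (abs_add_le _ _).trans ?_
    rw [abs_mul, abs_mul (N * okC k u), abs_of_nonneg (mul_nonneg hN h1),
      abs_of_nonneg (mul_nonneg hN h2)]
    have := mul_le_mul_of_nonneg_left (Real.abs_sin_le_one (okArg k N d u)) (mul_nonneg hN h1)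
    have := mul_le_mul_of_nonneg_left (Real.abs_cos_le_one (okArg k N d u)) (mul_nonneg hN h2)
    linarith
  unfold okF
  rw [abs_mul, abs_mul, abs_of_pos (Real.exp_pos _), abs_of_pos h3]
  calc Real.exp (-(N * okA k u)) * |_| * okSig k u
      ≤ Real.exp (-(N * okA k u)) * (N * okA k u + N * okC k u) * (Real.pi / u) := by gcongr
    _ = _ := by ring

lemma okA_add_okC_mul_le {k : ℕ} (hk : 2 ≤ k) {u : ℝ} (hu : 0 < u) :
    (okA k u + okC k u) * (Real.pi / u) ≤ 4.8 := by
  have h1 := okA_le_linear hk hu.le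
  have h2 := okC_le_linear hk hu.le
  have hpi := Real.pi_lt_d2
  have hpi0 := Real.pi_pos
  calc (okA k u + okC k u) * (Real.pi / u) ≤ (u / 2 + u) * (Real.pi / u) := by gcongr
    _ = 1.5 * Real.pi := by field_simp; norm_num
    _ ≤ 4.8 := by linarith

lemma intervalIntegrable_okF {k : ℕ} (hk : 2 ≤ k) {N d a b : ℝ} (hN : 0 ≤ N) (ha : 0 ≤ a)
    (hab : a ≤ b) (hb : b ≤ Real.pi * okM k) :
    IntervalIntegrable (okF k N d) MeasureTheory.volume a b := by
  rw [intervalIntegrable_iff_integrableOn_Ioc_of_le hab]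
  refine MeasureTheory.Measure.integrableOn_of_bounded (M := N * 4.8) (by simp)
    (measurable_okF k N d).aestronglyMeasurable ?_
  refine (MeasureTheory.ae_restrict_mem measurableSet_Ioc).mono fun u hu => ?_
  have hu0 : 0 < u := ha.trans_lt hu.1
  refine (abs_okF_le hN hu0 (hu.2.trans hb)).trans ?_
  have h1 : Real.exp (-(N * okA k u)) ≤ 1 :=
    Real.exp_le_one_iff.mpr (neg_nonpos.mpr (mul_nonneg hN (okA_nonneg k u)))
  have h2 := okA_add_okC_mul_le hk hu0
  have h3 : 0 ≤ (okA k u + okC k u) * (Real.pi / u) :=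
    mul_nonneg (add_nonneg (okA_nonneg k u) (okC_nonneg k hu0.le))
      (div_nonneg Real.pi_pos.le hu0.le)
  calc _ ≤ 1 * (N * 4.8) := by gcongr
    _ = N * 4.8 := one_mul _

lemma okF_add_okG' (k : ℕ) (N n η u : ℝ) :
    okF k N (η + cb3 (okX k) / 2) u + okG' k N n (η + cb3 (okX k) / 2) u =
      Real.exp (-(N * okA k u)) *
        (okSs k N n η u * Real.sin (okArg k N (η + cb3 (okX k) / 2) u)
        + okSc k N n η u * Real.cos (okArg k N (η + cb3 (okX k) / 2) u)) := by
  unfold okF okG' okSs okSc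
  ring

lemma abs_okArg_le {k : ℕ} (hk : 2 ≤ k) {N d u : ℝ} (hN : 0 ≤ N) (hu : 0 ≤ u) :
    |okArg k N d u| ≤ |d| * u + N * u ^ 3 / 24 := by
  unfold okArg
  refine (abs_sub _ _).trans ?_
  rw [abs_mul, abs_of_nonneg hu, abs_of_nonneg (mul_nonneg hN (okC_nonneg k hu))]
  have := mul_le_mul_of_nonneg_left (okC_le_cube hk hu) hN
  linarith

lemma integrand_le {k : ℕ} (hk : 2 ≤ k) {N n η u : ℝ} (hNn : N * n = 1) (hN : 30 ≤ N)
    (hu : 0 < u) (hu2 : u ≤ 2) :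
    |okF k N (η + cb3 (okX k) / 2) u + okG' k N n (η + cb3 (okX k) / 2) u
      - okKap k n η * (Real.exp (-(N * okA k u)) *
        Real.cos (okArg k N (η + cb3 (okX k) / 2) u))| ≤
    Real.exp (-(N * okA k u)) *
      (((0.127 * |η| + 0.0063 * n) * (|η| + 1 / 8) + 0.009 * |η|) * u ^ 2
      + ((0.127 * |η| + 0.0063 * n) * (N / 24) + (0.0029 + 0.002 * |η|) * (|η| + 1 / 8)
          + 0.00096) * u ^ 4
      + ((0.0029 + 0.002 * |η|) * (N / 24) + 0.000052 * N * (|η| + 1 / 8)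
          + 0.000013 * N) * u ^ 6
      + (0.000052 * N * (N / 24) + 0.00006 * N * (|η| + 1 / 8) + 0.0000094 * N) * u ^ 8
      + (0.00006 * N * (N / 24)) * u ^ 10) := by
  have h1 := okSs_le (η := η) hk hNn hN hu hu2
  have h2 := okSc_le (η := η) hk hNn hN hu hu2
  have hN0 : 0 ≤ N := by linarith
  have h3 : |Real.sin (okArg k N (η + cb3 (okX k) / 2) u)| ≤
      (|η| + 1 / 8) * u + N * u ^ 3 / 24 := by
    refine Real.abs_sin_le_abs.trans ((abs_okArg_le hk hN0 hu.le).trans ?_)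
    have hb := (cb_bounds (okX_pos k).le (okX_le hk)).1
    have : |η + cb3 (okX k) / 2| ≤ |η| + 1 / 8 := by
      refine (abs_add_le _ _).trans ?_
      rw [abs_of_nonneg (by linarith : 0 ≤ cb3 (okX k) / 2)]
      linarith
    gcongr
  have h4 := abs_mul_le_of_le h1 h3
  have h5 := abs_mul_le_of_le h2 (Real.abs_cos_le_one (okArg k N (η + cb3 (okX k) / 2) u))
  rw [okF_add_okG']
  have e : ∀ E s c S C K : ℝ, E * (S * s + C * c) - K * (E * c) = E * (S * s + (C - K) * c) := by
    intros; ring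
  rw [e, abs_mul, abs_of_pos (Real.exp_pos _)]
  refine mul_le_mul_of_nonneg_left ?_ (Real.exp_nonneg _)
  refine (abs_add_le _ _).trans ((add_le_add h4 h5).trans_eq ?_)
  ring

/-- The cosine integral over the core. -/
noncomputable def okJ (k : ℕ) (N d : ℝ) : ℝ :=
  ∫ u in (0 : ℝ)..2, Real.exp (-(N * okA k u)) * Real.cos (okArg k N d u)

lemma continuous_exp_mul_cos (k : ℕ) (N d : ℝ) :
    Continuous fun u => Real.exp (-(N * okA k u)) * Real.cos (okArg k N d u) :=
  (continuous_exp_okA k N).mul (Real.continuous_cos.comp (continuous_okArg k N d))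

lemma two_le_pi_mul_okM {k : ℕ} (hk : 2 ≤ k) : 7 ≤ Real.pi * okM k := by
  have := okM_ge hk
  have := Real.pi_gt_three
  nlinarith

lemma integral_okG' (k : ℕ) (N n d : ℝ) :
    ∫ u in (0 : ℝ)..2, okG' k N n d u = okG k N n d 2 := by
  rw [intervalIntegral.integral_eq_sub_of_hasDerivAt (fun u _ => hasDerivAt_okG k N n d u)
    ((continuous_okG' k N n d).intervalIntegrable 0 2), okG_zero, sub_zero]

lemma core_le {k : ℕ} (hk : 2 ≤ k) {N n η : ℝ} (hNn : N * n = 1) (hN : 30 ≤ N)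
    (hη : |η| ≤ 0.41) :
    |(∫ u in (0 : ℝ)..2, okF k N (η + cb3 (okX k) / 2) u) + okG k N n (η + cb3 (okX k) / 2) 2
      - okKap k n η * okJ k N (η + cb3 (okX k) / 2)| ≤
    (0.0068 + 0.42 * |η|) * n * okMom k N 0 := by
  have hN0 : 0 ≤ N := by linarith
  have hF := intervalIntegrable_okF (d := η + cb3 (okX k) / 2) hk hN0 le_rfl
    (by norm_num : (0 : ℝ) ≤ 2) (by linarith [two_le_pi_mul_okM hk])
  have hG := (continuous_okG' k N n (η + cb3 (okX k) / 2)).intervalIntegrable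
    (μ := MeasureTheory.volume) 0 2
  have h := abs_integral_sub_le_of_pointwise (by norm_num : (0 : ℝ) ≤ 2) (hF.add hG)
    (((continuous_exp_mul_cos k N (η + cb3 (okX k) / 2)).intervalIntegrable 0 2).const_mul
      (okKap k n η))
    (Continuous.intervalIntegrable (by
      refine (continuous_exp_okA k N).mul ?_
      fun_prop) 0 2)
    (fun u hu hu2 => integrand_le hk hNn hN hu hu2)
  rw [intervalIntegral.integral_add hF hG, integral_okG', intervalIntegral.integral_const_mul,
    integral_even_poly] at h
  refine h.trans ?_
  obtain ⟨h2, h4, h6, h8, h10⟩ := okMom_bounds hk hNn hN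
  have hn0 : 0 < n := by
    by_contra hcon
    nlinarith
  have hn1 : n ≤ 1 / 30 := by
    rw [le_div_iff₀ (by norm_num)]
    nlinarith
  have hm := okMom_nonneg k N 0
  set e := |η| with he
  have he0 : 0 ≤ e := abs_nonneg η
  have a2 : ((0.127 * e + 0.0063 * n) * (e + 1 / 8) + 0.009 * e) * okMom k N 2 ≤
      ((0.127 * e + 0.0063 * n) * (e + 1 / 8) + 0.009 * e) * (3.16 * n * okMom k N 0) := by
    gcongr
  have a4 := mul_le_mul_of_nonneg_left h4 (by positivity :
    0 ≤ (0.127 * e + 0.0063 * n) * (N / 24) + (0.0029 + 0.002 * e) * (e + 1 / 8) + 0.00096)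
  have a6 := mul_le_mul_of_nonneg_left h6 (by positivity :
    0 ≤ (0.0029 + 0.002 * e) * (N / 24) + 0.000052 * N * (e + 1 / 8) + 0.000013 * N)
  have a8 := mul_le_mul_of_nonneg_left h8 (by positivity :
    0 ≤ 0.000052 * N * (N / 24) + 0.00006 * N * (e + 1 / 8) + 0.0000094 * N)
  have a10 := mul_le_mul_of_nonneg_left h10 (by positivity :
    0 ≤ 0.00006 * N * (N / 24))
  refine (add_le_add (add_le_add (add_le_add (add_le_add a2 a4) a6) a8) a10).trans ?_
  have key : ((0.127 * e + 0.0063 * n) * (e + 1 / 8) + 0.009 * e) * 3.16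
      + ((0.127 * e + 0.0063 * n) / 24 + n * ((0.0029 + 0.002 * e) * (e + 1 / 8) + 0.00096)) * 31.1
      + ((0.0029 + 0.002 * e) / 24 + (0.000052 * (e + 1 / 8) + 0.000013)) * n * 529
      + (0.000052 / 24 + n * (0.00006 * (e + 1 / 8) + 0.0000094)) * n * 13080
      + 0.00006 / 24 * n ^ 2 * 433000 ≤ 0.0068 + 0.42 * e := by
    have q1 : e * e ≤ 0.41 * e := by gcongr
    have q2 : n * e ≤ 1 / 30 * e := by gcongr
    have q3 : n * n ≤ 1 / 30 * n := by gcongr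
    have q4 : n * (e * e) ≤ 1 / 30 * (0.41 * e) := by gcongr
    have q5 : n * (n * e) ≤ 1 / 30 * (1 / 30 * e) := by gcongr
    nlinarith
  have := mul_le_mul_of_nonneg_right key (mul_nonneg hn0.le hm)
  refine Eq.trans_le ?_ (this.trans_eq (by ring))
  have e1 : N * n ^ 2 = n := by rw [pow_two, ← mul_assoc, hNn, one_mul]
  have e2 : N * n ^ 3 = n ^ 2 := by rw [pow_succ' n 2, ← mul_assoc, hNn, one_mul]
  have e3 : N * n ^ 4 = n ^ 3 := by rw [pow_succ' n 3, ← mul_assoc, hNn, one_mul]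
  have e4 : N * N * n ^ 4 = n ^ 2 := by rw [mul_assoc, e3, e2]
  have e5 : N * N * n ^ 5 = n ^ 3 := by linear_combination (N * n ^ 4) * hNn + e3
  linear_combination (31.1 * okMom k N 0 * (0.127 * e + 0.0063 * n) / 24) * e1
    + (529 * okMom k N 0 * ((0.0029 + 0.002 * e) / 24 + 0.000052 * (e + 1 / 8) + 0.000013)) * e2
    + 13080 * okMom k N 0 * (0.000052 / 24) * e4
    + 13080 * okMom k N 0 * (0.00006 * (e + 1 / 8) + 0.0000094) * e3
    + 433000 * okMom k N 0 * (0.00006 / 24) * e5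

lemma okA_eq_sin {k : ℕ} {u : ℝ} (hu : 0 < u) (hu2 : u ≤ Real.pi * okM k) :
    okA k u = okW k * okM k * (1 - Real.sin u * okSig k u / 2) := by
  have hM := okM_pos k
  have hs : 0 < Real.sin (u / (2 * okM k)) := by
    apply Real.sin_pos_of_pos_of_lt_pi (by positivity)
    rw [div_lt_iff₀ (by positivity)]
    nlinarith [Real.pi_pos]
  have h := dirichletSum_mul_sin k (u / okM k)
  have e1 : ((k : ℝ) + 1 / 2) * (u / okM k) = u := mul_div_cancel₀ u hM.ne'
  have e2 : u / okM k / 2 = u / (2 * okM k) := by rw [div_div, mul_comm]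
  rw [e1, e2] at h
  have e3 : ∀ i : ℕ, okQ k i * u = ((i : ℝ) + 1) * (u / okM k) := fun i => by
    unfold okQ
    ring
  have e4 : dirichletSum k (u / okM k) = Real.sin u / Real.sin (u / (2 * okM k)) := by
    rw [eq_div_iff hs.ne', h]
  unfold dirichletSum at e4
  unfold okA okSig
  simp only [e3, Finset.sum_sub_distrib, Finset.sum_const, Finset.card_range, nsmul_eq_mul, mul_one]
  have e5 : ∑ i ∈ Finset.range k, Real.cos (((i : ℝ) + 1) * (u / okM k)) =
    (Real.sin u / Real.sin (u / (2 * okM k)) - 1) / 2 := by linarith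
  rw [e5]
  have e6 : (k : ℝ) = okM k - 1 / 2 := by unfold okM; ring
  rw [mul_assoc, e6]
  congr 1
  field_simp
  ring

lemma one_le_okW_mul_okM {k : ℕ} (hk : 0 < k) : 1 ≤ okW k * okM k := by
  have : (0 : ℝ) < k := by exact_mod_cast hk
  unfold okW okM
  rw [div_mul_eq_mul_div, le_div_iff₀ (by positivity)]
  nlinarith

lemma okA_ge_tail {k : ℕ} (hk : 2 ≤ k) {u : ℝ} (hu : 2.6 ≤ u) (hu2 : u ≤ Real.pi * okM k) :
    0.72 ≤ okA k u := by
  have hpi := Real.pi_gt_three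
  have hpi2 := Real.pi_lt_d2
  have hu0 : 0 < u := by linarith
  rcases le_total u Real.pi with h | h
  · have h1 := okA_ge_quartic hk hu0.le
    have h2 : 6.76 ≤ u ^ 2 := by nlinarith
    have h3 : u ^ 2 ≤ 10 := by nlinarith
    nlinarith
  rw [okA_eq_sin hu0 hu2]
  have hw := one_le_okW_mul_okM (k := k) (by omega)
  have hs := okSig_pos hu0 hu2
  have : Real.sin u * okSig k u / 2 ≤ 1 / 4 := by
    rcases le_total u (2 * Real.pi) with h' | h'
    · have : Real.sin u ≤ 0 := by
        rw [← Real.sin_sub_two_pi]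
        exact Real.sin_nonpos_of_nonpos_of_neg_pi_le (by linarith) (by linarith)
      nlinarith
    · have h1 := okSig_le hu0 hu2
      have h2 : Real.pi / u ≤ 1 / 2 := by
        rw [div_le_iff₀ hu0]
        linarith
      nlinarith [Real.sin_le_one u]
  nlinarith

lemma okA_ge_mid {k : ℕ} (hk : 2 ≤ k) {u : ℝ} (hu : 2 ≤ u) (hu2 : u ≤ 2.6) :
    8 / 15 ≤ okA k u := by
  have h1 := okA_ge_quartic hk (by linarith : 0 ≤ u)
  have h2 : 4 ≤ u ^ 2 := by nlinarith
  have h3 : u ^ 2 ≤ 7 := by nlinarith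
  nlinarith

lemma abs_tail_le {k : ℕ} (hk : 2 ≤ k) {N d : ℝ} (hN : 0 < N) (hMN : okM k ≤ 1.05 * N) :
    |∫ u in (2 : ℝ)..(Real.pi * okM k), okF k N d u| ≤
      1.35 * N * Real.exp (-(8 / 15 * N)) + 15.9 * N ^ 2 * Real.exp (-(0.72 * N)) := by
  have h7 := two_le_pi_mul_okM hk
  have hpi := Real.pi_lt_d2
  have hpi0 := Real.pi_pos
  rw [← intervalIntegral.integral_add_adjacent_intervals (b := 2.6)
    (intervalIntegrable_okF hk hN.le (by norm_num) (by norm_num) (by linarith))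
    (intervalIntegrable_okF hk hN.le (by norm_num) (by linarith) le_rfl)]
  refine (abs_add_le _ _).trans (add_le_add ?_ ?_)
  · rw [← Real.norm_eq_abs]
    refine (intervalIntegral.norm_integral_le_of_norm_le_const
      (C := Real.exp (-(8 / 15 * N)) * (N * 2.25)) fun u hu => ?_).trans ?_
    · rw [Set.uIoc_of_le (by norm_num)] at hu
      have hu0 : 0 < u := by linarith [hu.1]
      refine (abs_okF_le hN.le hu0 (by linarith [hu.2])).trans ?_
      have h1 := okA_ge_mid hk hu.1.le hu.2
      have h2 := okA_le_sq hk (u := u)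
      have h3 := okC_le_cube hk hu0.le
      have h4 := okA_nonneg k u
      have h5 := okC_nonneg k hu0.le
      have h6 : (okA k u + okC k u) * (Real.pi / u) ≤ 2.25 := by
        calc _ ≤ (u ^ 2 / 6 + u ^ 3 / 24) * (Real.pi / u) := by gcongr
          _ = (u / 6 + u ^ 2 / 24) * Real.pi := by field_simp
          _ ≤ (2.6 / 6 + 2.6 ^ 2 / 24) * 3.1416 := by
            have := hu.2
            have := Real.pi_lt_d4
            gcongr
          _ ≤ 2.25 := by norm_num
      have h8 : 0 ≤ (okA k u + okC k u) * (Real.pi / u) := by positivity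
      exact mul_le_mul (Real.exp_le_exp.mpr (by nlinarith)) (by gcongr)
        (mul_nonneg hN.le h8) (Real.exp_nonneg _)
    · rw [abs_of_nonneg (by norm_num)]
      apply le_of_eq
      ring
  · rw [← Real.norm_eq_abs]
    refine (intervalIntegral.norm_integral_le_of_norm_le_const
      (C := Real.exp (-(0.72 * N)) * (N * 4.8)) fun u hu => ?_).trans ?_
    · rw [Set.uIoc_of_le (by linarith)] at hu
      have hu0 : 0 < u := by linarith [hu.1]
      refine (abs_okF_le hN.le hu0 hu.2).trans ?_
      have h1 := okA_ge_tail hk hu.1.le hu.2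
      have h4 := okA_nonneg k u
      have h5 := okC_nonneg k hu0.le
      have h6 := okA_add_okC_mul_le hk hu0
      have h8 : 0 ≤ (okA k u + okC k u) * (Real.pi / u) := by positivity
      exact mul_le_mul (Real.exp_le_exp.mpr (by nlinarith)) (by gcongr)
        (mul_nonneg hN.le h8) (Real.exp_nonneg _)
    · rw [abs_of_nonneg (by linarith)]
      have : Real.pi * okM k - 2.6 ≤ 3.3075 * N := by
        have := Real.pi_lt_d2
        nlinarith [okM_pos k]
      calc _ ≤ Real.exp (-(0.72 * N)) * (N * 4.8) * (3.3075 * N) := by gcongr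
        _ ≤ _ := by
          have := mul_nonneg (sq_nonneg N) (Real.exp_nonneg (-(0.72 * N)))
          nlinarith

lemma abs_okG_two_le {k : ℕ} (hk : 2 ≤ k) {N n d : ℝ} (hN : 0 < N) (hn0 : 0 ≤ n) (hn : n ≤ 1 / 30) :
    |okG k N n d 2| ≤ 1.32 * Real.exp (-(8 / 15 * N)) := by
  obtain ⟨⟨p1, p2⟩, ⟨q1, q2⟩, ⟨r1, r2⟩, ⟨s1, s2⟩, -⟩ := okP_bounds (okX_pos k).le (okX_le hk)
  obtain ⟨b1, b2⟩ := (cb_bounds (okX_pos k).le (okX_le hk)).1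
  have h1 : |okPr k n 2| ≤ 1.04 := by
    unfold okPr
    rw [abs_le]
    constructor <;> nlinarith
  have h2 : |okPi k n 2| ≤ 0.28 := by
    unfold okPi
    rw [abs_le]
    constructor <;> nlinarith
  have h3 := okA_ge_mid hk le_rfl (by norm_num)
  unfold okG
  rw [abs_mul, abs_of_pos (Real.exp_pos _), mul_comm]
  have h4 := abs_mul_le_of_le h1 (Real.abs_sin_le_one (okArg k N d 2))
  have h5 := abs_mul_le_of_le h2 (Real.abs_cos_le_one (okArg k N d 2))
  have h6 := (abs_add_le _ _).trans (add_le_add h4 h5)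
  refine mul_le_mul (h6.trans (by norm_num)) (Real.exp_le_exp.mpr (by nlinarith))
    (Real.exp_nonneg _) (by norm_num)

lemma okMom_zero_ge {k : ℕ} (hk : 2 ≤ k) {N n : ℝ} (hNn : N * n = 1) (hN : 30 ≤ N) :
    8.9 * n ≤ okMom k N 0 := by
  have hn0 : 0 < n := by
    by_contra hcon
    nlinarith
  have hn1 : n ≤ 1 / 30 := by
    rw [le_div_iff₀ (by norm_num)]
    nlinarith
  have hi := intervalIntegrable_okMom k N 0
  have h1 : okMom k N 0 = (∫ u in (0 : ℝ)..(13.4 * n), Real.exp (-(N * okA k u)) * u ^ 0)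
      + ∫ u in (13.4 * n)..2, Real.exp (-(N * okA k u)) * u ^ 0 :=
    (intervalIntegral.integral_add_adjacent_intervals (hi _ _) (hi _ _)).symm
  have h2 : 0 ≤ ∫ u in (13.4 * n)..2, Real.exp (-(N * okA k u)) * u ^ 0 :=
    intervalIntegral.integral_nonneg (by linarith) fun u _ => by positivity
  have h3 : ∫ u in (0 : ℝ)..(13.4 * n), (1 - N / 6 * u ^ 2) ≤
      ∫ u in (0 : ℝ)..(13.4 * n), Real.exp (-(N * okA k u)) * u ^ 0 := by
    refine intervalIntegral.integral_mono_on (by positivity)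
      (Continuous.intervalIntegrable (by fun_prop) _ _) (hi _ _) fun u _ => ?_
    have := Real.add_one_le_exp (-(N * okA k u))
    have := mul_le_mul_of_nonneg_left (okA_le_sq hk (u := u)) (by linarith : 0 ≤ N)
    rw [pow_zero, mul_one]
    linarith
  have h4 : ∫ u in (0 : ℝ)..(13.4 * n), (1 - N / 6 * u ^ 2) = 13.4 * n - 13.4 ^ 3 * n ^ 2 / 18 := by
    rw [intervalIntegral.integral_sub (by simp) (Continuous.intervalIntegrable (by fun_prop) _ _)]
    simp only [intervalIntegral.integral_const_mul, integral_pow, intervalIntegral.integral_const]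
    have : N * n ^ 3 = n ^ 2 := by rw [pow_succ' n 2, ← mul_assoc, hNn, one_mul]
    simp only [smul_eq_mul]
    linear_combination (-(13.4 : ℝ) ^ 3 / 18) * this
  nlinarith

lemma exp_neg_mul_pow_le {N c : ℝ} (hN : 30 ≤ N) {p : ℕ} (hp : p ≤ 30 * c) :
    N ^ p * Real.exp (-(c * N)) ≤ 30 ^ p * Real.exp (-(c * 30)) := by
  have h : N ≤ 30 * Real.exp ((N - 30) / 30) := by
    have := Real.add_one_le_exp ((N - 30) / 30)
    linarith
  have h2 : N ^ p ≤ 30 ^ p * Real.exp (p * ((N - 30) / 30)) := by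
    rw [Real.exp_nat_mul, ← mul_pow]
    exact pow_le_pow_left₀ (by linarith) h p
  calc _ ≤ 30 ^ p * Real.exp (p * ((N - 30) / 30)) * Real.exp (-(c * N)) := by gcongr
    _ = 30 ^ p * Real.exp (p * ((N - 30) / 30) + -(c * N)) := by rw [Real.exp_add]; ring
    _ ≤ _ := by
      gcongr
      have : p * ((N - 30) / 30) ≤ 30 * c * ((N - 30) / 30) := by
        gcongr
      linarith

lemma tail_total_le {N n : ℝ} (hNn : N * n = 1) (hN : 30 ≤ N) :
    1.35 * N * Real.exp (-(8 / 15 * N)) + 15.9 * N ^ 2 * Real.exp (-(0.72 * N))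
      + 1.32 * Real.exp (-(8 / 15 * N)) ≤ 0.016 * n ^ 2 := by
  have e1 : Real.exp (-1) ≤ 0.368 := by linarith [Real.exp_neg_one_lt_d9]
  have h1 : Real.exp (-(8 / 15 * 30)) ≤ 0.368 ^ 16 := by
    rw [show -(8 / 15 * 30 : ℝ) = (16 : ℕ) * (-1) by norm_num, Real.exp_nat_mul]
    exact pow_le_pow_left₀ (Real.exp_nonneg _) e1 16
  have h2 : Real.exp (-(0.72 * 30)) ≤ 0.368 ^ 21 := by
    refine (Real.exp_le_exp.mpr (by norm_num : -(0.72 * 30 : ℝ) ≤ (21 : ℕ) * (-1))).trans ?_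
    rw [Real.exp_nat_mul]
    exact pow_le_pow_left₀ (Real.exp_nonneg _) e1 21
  have a3 := exp_neg_mul_pow_le (c := 8 / 15) (p := 3) hN (by norm_num)
  have a2 := exp_neg_mul_pow_le (c := 8 / 15) (p := 2) hN (by norm_num)
  have a4 := exp_neg_mul_pow_le (c := 0.72) (p := 4) hN (by norm_num)
  have hn2 : N ^ 2 * n ^ 2 = 1 := by rw [← mul_pow, hNn, one_pow]
  have hn0 : 0 < n ^ 2 := by
    by_contra hcon
    nlinarith [sq_nonneg N]
  have hs : 1.35 * (N ^ 3 * Real.exp (-(8 / 15 * N))) + 15.9 * (N ^ 4 * Real.exp (-(0.72 * N)))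
      + 1.32 * (N ^ 2 * Real.exp (-(8 / 15 * N))) ≤ 0.016 := by
    norm_num at h1 h2 a2 a3 a4 ⊢
    linarith
  have := mul_le_mul_of_nonneg_right hs hn0.le
  refine Eq.trans_le ?_ this
  linear_combination (-(1.35 * N * Real.exp (-(8 / 15 * N)) + 15.9 * N ^ 2 * Real.exp (-(0.72 * N))
      + 1.32 * Real.exp (-(8 / 15 * N)))) * hn2

/-- Minus `N` times the scale derivative of the inversion integral. -/
noncomputable def okI (k : ℕ) (N d : ℝ) : ℝ :=
  ∫ u in (0 : ℝ)..(Real.pi * okM k), okF k N d u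

lemma inv_bounds {N n : ℝ} (hNn : N * n = 1) (hN : 30 ≤ N) : 0 < n ∧ n ≤ 1 / 30 := by
  have hn0 : 0 < n := by
    by_contra hcon
    nlinarith
  refine ⟨hn0, ?_⟩
  rw [le_div_iff₀ (by norm_num)]
  nlinarith

lemma abs_okI_sub_le {k : ℕ} (hk : 2 ≤ k) {N n η : ℝ} (hNn : N * n = 1) (hN : 30 ≤ N)
    (hMN : okM k ≤ 1.05 * N) (hη : |η| ≤ 0.41) :
    |okI k N (η + cb3 (okX k) / 2) - okKap k n η * okJ k N (η + cb3 (okX k) / 2)| ≤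
      (0.0086 + 0.42 * |η|) * n * okMom k N 0 := by
  obtain ⟨hn0, hn1⟩ := inv_bounds hNn hN
  have hN0 : 0 < N := by linarith
  have h7 := two_le_pi_mul_okM hk
  have hsplit : okI k N (η + cb3 (okX k) / 2) =
      (∫ u in (0 : ℝ)..2, okF k N (η + cb3 (okX k) / 2) u)
      + ∫ u in (2 : ℝ)..(Real.pi * okM k), okF k N (η + cb3 (okX k) / 2) u :=
    (intervalIntegral.integral_add_adjacent_intervals
      (intervalIntegrable_okF hk hN0.le le_rfl (by norm_num) (by linarith))
      (intervalIntegrable_okF hk hN0.le (by norm_num) (by linarith) le_rfl)).symm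
  have h1 := core_le hk hNn hN hη
  have h2 := abs_tail_le (d := η + cb3 (okX k) / 2) hk hN0 hMN
  have h3 := abs_okG_two_le (d := η + cb3 (okX k) / 2) hk hN0 hn0.le hn1
  have h4 := tail_total_le hNn hN
  have h5 := mul_le_mul_of_nonneg_left (okMom_zero_ge hk hNn hN) hn0.le
  rw [hsplit]
  rw [abs_le] at h1 h2 h3 ⊢
  constructor <;> nlinarith [h1.1, h1.2, h2.1, h2.2, h3.1, h3.2]

lemma okJ_le (k : ℕ) (N d : ℝ) : okJ k N d ≤ okMom k N 0 := by
  refine intervalIntegral.integral_mono_on (by norm_num)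
    ((continuous_exp_mul_cos k N d).intervalIntegrable 0 2)
    (intervalIntegrable_okMom k N 0 0 2) fun u _ => ?_
  rw [pow_zero]
  exact mul_le_mul_of_nonneg_left (Real.cos_le_one _) (Real.exp_nonneg _)

lemma okJ_ge {k : ℕ} (hk : 2 ≤ k) {N n η : ℝ} (hNn : N * n = 1) (hN : 30 ≤ N)
    (hη : |η| ≤ 0.41) :
    (1 - 1.61 * n) * okMom k N 0 ≤ okJ k N (η + cb3 (okX k) / 2) := by
  obtain ⟨hn0, hn1⟩ := inv_bounds hNn hN
  obtain ⟨b1, b2⟩ := (cb_bounds (okX_pos k).le (okX_le hk)).1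
  have hd : |η + cb3 (okX k) / 2| ≤ 0.535 := by
    rw [abs_le] at hη ⊢
    constructor <;> linarith
  have hcont : Continuous fun u => Real.exp (-(N * okA k u)) * (0.535 ^ 2 / 2 * u ^ 2
      + 0.535 * N / 24 * u ^ 4 + N ^ 2 / 1152 * u ^ 6 + 0 * u ^ 8 + 0 * u ^ 10) :=
    (continuous_exp_okA k N).mul (by fun_prop)
  have h := abs_integral_sub_le_of_pointwise (by norm_num : (0 : ℝ) ≤ 2)
    (intervalIntegrable_okMom k N 0 0 2)
    ((continuous_exp_mul_cos k N (η + cb3 (okX k) / 2)).intervalIntegrable 0 2)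
    (hcont.intervalIntegrable 0 2)
    (fun u hu hu2 => by
      have hB := abs_okArg_le (d := η + cb3 (okX k) / 2) hk (by linarith : 0 ≤ N) hu.le
      have hB2 : |okArg k N (η + cb3 (okX k) / 2) u| ≤ 0.535 * u + N * u ^ 3 / 24 := by
        refine hB.trans ?_
        gcongr
      have hc := Real.one_sub_sq_div_two_le_cos (x := okArg k N (η + cb3 (okX k) / 2) u)
      have hs : okArg k N (η + cb3 (okX k) / 2) u ^ 2 ≤ (0.535 * u + N * u ^ 3 / 24) ^ 2 := by
        rw [← sq_abs]
        gcongr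
      rw [← mul_sub, abs_mul, abs_of_pos (Real.exp_pos _), pow_zero,
        abs_of_nonneg (by linarith [Real.cos_le_one (okArg k N (η + cb3 (okX k) / 2) u)])]
      refine mul_le_mul_of_nonneg_left ?_ (Real.exp_nonneg _)
      linear_combination hc + hs / 2)
  rw [integral_even_poly] at h
  obtain ⟨h2, h4, h6, -, -⟩ := okMom_bounds hk hNn hN
  have a2 := mul_le_mul_of_nonneg_left h2 (by norm_num : (0 : ℝ) ≤ 0.535 ^ 2 / 2)
  have a4 := mul_le_mul_of_nonneg_left h4 (by positivity : 0 ≤ 0.535 * N / 24)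
  have a6 := mul_le_mul_of_nonneg_left h6 (by positivity : 0 ≤ N ^ 2 / 1152)
  have e1 : N * n ^ 2 = n := by rw [pow_two, ← mul_assoc, hNn, one_mul]
  have e2 : N ^ 2 * n ^ 3 = n := by linear_combination (N * n ^ 2) * hNn + e1
  have hm := mul_nonneg hn0.le (okMom_nonneg k N 0)
  have h' := (le_abs_self _).trans h
  change okMom k N 0 - okJ k N _ ≤ _ at h'
  have f4 : 0.535 * N / 24 * (31.1 * n ^ 2 * okMom k N 0) =
      0.535 * 31.1 / 24 * (n * okMom k N 0) := by
    linear_combination (0.535 * 31.1 / 24 * okMom k N 0) * e1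
  have f6 : N ^ 2 / 1152 * (529 * n ^ 3 * okMom k N 0) = 529 / 1152 * (n * okMom k N 0) := by
    linear_combination (529 / 1152 * okMom k N 0) * e2
  rw [f4] at a4
  rw [f6] at a6
  linarith

lemma okMom_zero_pos {k : ℕ} (hk : 2 ≤ k) {N n : ℝ} (hNn : N * n = 1) (hN : 30 ≤ N) :
    0 < okMom k N 0 := by
  have := okMom_zero_ge hk hNn hN
  have := (inv_bounds hNn hN).1
  linarith

lemma okI_neg {k : ℕ} (hk : 2 ≤ k) {N n η : ℝ} (hNn : N * n = 1) (hN : 30 ≤ N)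
    (hMN : okM k ≤ 1.05 * N) (hη : -0.41 ≤ η) (hη2 : η ≤ 0) :
    okI k N (η + cb3 (okX k) / 2) < 0 := by
  obtain ⟨hn0, hn1⟩ := inv_bounds hNn hN
  have habs : |η| ≤ 0.41 := by rw [abs_le]; constructor <;> linarith
  have h1 := (le_abs_self _).trans (abs_okI_sub_le hk hNn hN hMN habs)
  have h2 := okJ_ge hk hNn hN habs
  have hm := okMom_zero_pos hk hNn hN
  obtain ⟨-, -, ⟨e0, e0'⟩, -, ⟨hh, -⟩⟩ := okP_bounds (okX_pos k).le (okX_le hk)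
  rw [abs_of_nonpos hη2] at h1
  have h3 : 0.94 * okMom k N 0 ≤ okJ k N (η + cb3 (okX k) / 2) :=
    le_trans (by nlinarith) h2
  have h4 : okKap k n η ≤ η - 0.0248 * n := by
    unfold okKap
    nlinarith [mul_nonneg (by linarith : 0 ≤ okE0 (okX k)) hn0.le]
  have h5 : okKap k n η * okJ k N (η + cb3 (okX k) / 2) ≤
      (η - 0.0248 * n) * (0.94 * okMom k N 0) := by
    have : 0 ≤ okJ k N (η + cb3 (okX k) / 2) := le_trans (by positivity) h3
    nlinarith
  have h6 : η - 0.0248 * n ≤ 0 := by linarith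
  nlinarith [mul_pos hn0 hm, mul_nonneg (neg_nonneg.mpr hη2) hm.le,
    mul_nonneg (neg_nonneg.mpr hη2) (mul_pos hn0 hm).le]

lemma eta_ge_of_okI_nonneg {k : ℕ} (hk : 2 ≤ k) {N n η : ℝ} (hNn : N * n = 1) (hN : 30 ≤ N)
    (hMN : okM k ≤ 1.05 * N) (hη : 0 ≤ η) (hη2 : η ≤ 0.41)
    (hI : 0 ≤ okI k N (η + cb3 (okX k) / 2)) :
    (0.946 * okH (okX k) - 0.0086) * n ≤ 0.964 * η := by
  obtain ⟨hn0, hn1⟩ := inv_bounds hNn hN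
  have habs : |η| ≤ 0.41 := by rw [abs_le]; constructor <;> linarith
  have h1 := (le_abs_self _).trans (abs_okI_sub_le hk hNn hN hMN habs)
  have h2 := okJ_ge hk hNn hN habs
  have hm := okMom_zero_pos hk hNn hN
  obtain ⟨-, -, ⟨e0, e0'⟩, -, ⟨hh, -⟩⟩ := okP_bounds (okX_pos k).le (okX_le hk)
  rw [abs_of_nonneg hη] at h1
  have h3 : 0.946 * okMom k N 0 ≤ okJ k N (η + cb3 (okX k) / 2) :=
    le_trans (by nlinarith) h2
  have h4 : η * (1 + okE0 (okX k) * n) ≤ 1.00323 * η := by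
    have : okE0 (okX k) * n ≤ 0.0966 * (1 / 30) := by gcongr
    nlinarith
  by_contra! hcon
  have h5 : okKap k n η ≤ 1.00323 * η - okH (okX k) * n := by
    unfold okKap
    linarith
  have h6 : 1.00323 * η - okH (okX k) * n ≤ 0 := by
    nlinarith [mul_nonneg (by linarith : 0 ≤ okH (okX k)) hn0.le]
  have h7 : okKap k n η * okJ k N (η + cb3 (okX k) / 2) ≤
      (1.00323 * η - okH (okX k) * n) * (0.946 * okMom k N 0) := by
    have : 0 ≤ okJ k N (η + cb3 (okX k) / 2) := le_trans (by positivity) h3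
    nlinarith
  have h8 : 0 ≤ ((1.00323 * η - okH (okX k) * n) * 0.946 + (0.0086 + 0.42 * η) * n)
      * okMom k N 0 := by linarith
  have h9 : (1.00323 * η - okH (okX k) * n) * 0.946 + (0.0086 + 0.42 * η) * n < 0 := by nlinarith
  nlinarith

lemma okI_ge {k : ℕ} (hk : 2 ≤ k) {N n η : ℝ} (hNn : N * n = 1) (hN : 30 ≤ N)
    (hMN : okM k ≤ 1.05 * N) (hη : 0 ≤ η) (hη2 : η ≤ 0.41) :
    (0.932 * η - (okH (okX k) + 0.0086) * n) * okMom k N 0 ≤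
      okI k N (η + cb3 (okX k) / 2) := by
  obtain ⟨hn0, hn1⟩ := inv_bounds hNn hN
  have habs : |η| ≤ 0.41 := by rw [abs_le]; constructor <;> linarith
  have h1 := (neg_le_of_abs_le (abs_okI_sub_le hk hNn hN hMN habs))
  have h2 := okJ_ge hk hNn hN habs
  have h2' := okJ_le k N (η + cb3 (okX k) / 2)
  have hm := okMom_zero_pos hk hNn hN
  obtain ⟨-, -, ⟨e0, e0'⟩, -, ⟨hh, -⟩⟩ := okP_bounds (okX_pos k).le (okX_le hk)
  rw [abs_of_nonneg hη] at h1
  have h3 : 0 ≤ okJ k N (η + cb3 (okX k) / 2) := le_trans (by nlinarith) h2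
  have a1 : η * ((1 - 1.61 * n) * okMom k N 0) ≤ η * (1 + okE0 (okX k) * n) *
      okJ k N (η + cb3 (okX k) / 2) := by
    rw [mul_assoc]
    refine mul_le_mul_of_nonneg_left ?_ hη
    have : 0 ≤ okE0 (okX k) * n := mul_nonneg (by linarith) hn0.le
    nlinarith
  have a2 : okH (okX k) * n * okJ k N (η + cb3 (okX k) / 2) ≤ okH (okX k) * n * okMom k N 0 := by
    have : 0 ≤ okH (okX k) * n := mul_nonneg (by linarith) hn0.le
    gcongr
  have a3 : η * n * okMom k N 0 ≤ η * (1 / 30) * okMom k N 0 := by gcongr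
  unfold okKap at h1
  nlinarith [mul_nonneg hη hm.le]

open Filter Topology

/-- The inversion integral. -/
noncomputable def okK (k : ℕ) (N d : ℝ) : ℝ :=
  ∫ u in (0 : ℝ)..(Real.pi * okM k),
    Real.exp (-(N * okA k u)) * Real.sin (okArg k N d u) * okSig k u

lemma measurable_okK_integrand (k : ℕ) (N d : ℝ) : Measurable fun u =>
    Real.exp (-(N * okA k u)) * Real.sin (okArg k N d u) * okSig k u := by
  have h1 := (continuous_exp_okA k N).measurable
  have h2 := (continuous_okArg k N d).measurable
  have h3 := measurable_okSig k
  fun_prop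

lemma exp_mul_le {k : ℕ} {N : ℝ} (hN : 0 ≤ N) (u : ℝ) :
    Real.exp (-(N * okA k u)) ≤ 1 ∧ Real.exp (-(N * okA k u)) * (N * okA k u) ≤ 1 := by
  have h0 := mul_nonneg hN (okA_nonneg k u)
  refine ⟨Real.exp_le_one_iff.mpr (neg_nonpos.mpr h0), ?_⟩
  rw [Real.exp_neg, inv_mul_le_iff₀ (Real.exp_pos _)]
  linarith [Real.add_one_le_exp (N * okA k u)]

lemma abs_okK_integrand_le {k : ℕ} (hk : 2 ≤ k) {N d u : ℝ} (hN : 0 ≤ N) (hu : 0 < u)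
    (hu2 : u ≤ Real.pi * okM k) :
    |Real.exp (-(N * okA k u)) * Real.sin (okArg k N d u) * okSig k u| ≤
      Real.pi * (|d| + 1) := by
  have hs := okSig_pos hu hu2
  have hs2 := okSig_le hu hu2
  have hpi := Real.pi_pos
  obtain ⟨he1, he2⟩ := exp_mul_le (k := k) hN u
  have hd := abs_nonneg d
  rw [abs_mul, abs_mul, abs_of_pos (Real.exp_pos _), abs_of_pos hs]
  rcases le_total u 2 with h | h
  · have hB := Real.abs_sin_le_abs.trans (abs_okArg_le (d := d) hk hN hu.le)
    have hA := okA_ge_quartic hk hu.le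
    have h1 : u ^ 2 ≤ 4 := by nlinarith
    have h3 : u ^ 2 / 24 ≤ okA k u := by nlinarith
    calc _ ≤ Real.exp (-(N * okA k u)) * (|d| * u + N * u ^ 3 / 24) * (Real.pi / u) := by gcongr
      _ = Real.pi * (Real.exp (-(N * okA k u)) * |d|
          + Real.exp (-(N * okA k u)) * (N * (u ^ 2 / 24))) := by field_simp
      _ ≤ Real.pi * (1 * |d| + Real.exp (-(N * okA k u)) * (N * okA k u)) := by gcongr
      _ ≤ _ := by gcongr; linarith
  · have h1 : Real.pi / u ≤ Real.pi := by
      rw [div_le_iff₀ hu]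
      nlinarith
    calc _ ≤ 1 * 1 * Real.pi := by
          gcongr
          · exact Real.abs_sin_le_one _
          · exact hs2.trans h1
      _ ≤ _ := by nlinarith

lemma intervalIntegrable_okK {k : ℕ} (hk : 2 ≤ k) {N d : ℝ} (hN : 0 ≤ N) :
    IntervalIntegrable (fun u => Real.exp (-(N * okA k u)) * Real.sin (okArg k N d u) * okSig k u)
      MeasureTheory.volume 0 (Real.pi * okM k) := by
  rw [intervalIntegrable_iff_integrableOn_Ioc_of_le (by linarith [two_le_pi_mul_okM hk])]
  refine MeasureTheory.Measure.integrableOn_of_bounded (M := Real.pi * (|d| + 1)) (by simp)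
    (measurable_okK_integrand k N d).aestronglyMeasurable ?_
  exact (MeasureTheory.ae_restrict_mem measurableSet_Ioc).mono fun u hu =>
    abs_okK_integrand_le hk hN hu.1 hu.2

lemma hasDerivAt_okK {k : ℕ} (hk : 2 ≤ k) {N : ℝ} (hN : 0 < N) (d : ℝ) :
    HasDerivAt (fun N => okK k N d) (-(okI k N d / N)) N := by
  have h0 : (0 : ℝ) ≤ Real.pi * okM k := by linarith [two_le_pi_mul_okM hk]
  have key := intervalIntegral.hasDerivAt_integral_of_dominated_loc_of_deriv_le
    (μ := MeasureTheory.volume) (a := 0) (b := Real.pi * okM k) (bound := fun _ => 4.8)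
    (F := fun N u => Real.exp (-(N * okA k u)) * Real.sin (okArg k N d u) * okSig k u)
    (F' := fun N u => -(okF k N d u / N)) (x₀ := N) (s := Set.Ioi 0) (Ioi_mem_nhds hN)
    (Eventually.of_forall fun N => (measurable_okK_integrand k N d).aestronglyMeasurable)
    (intervalIntegrable_okK hk hN.le)
    ((measurable_okF k N d).div_const N).neg.aestronglyMeasurable
    (Eventually.of_forall fun u hu x hx => ?_)
    intervalIntegrable_const
    (Eventually.of_forall fun u hu x hx => ?_)
  · refine key.2.congr_deriv ?_
    rw [intervalIntegral.integral_neg, intervalIntegral.integral_div]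
    rfl
  · rw [Set.uIoc_of_le h0] at hu
    have hx' : 0 < x := hx
    have h1 := abs_okF_le (d := d) hx'.le hu.1 hu.2
    have h2 := (exp_mul_le (k := k) hx'.le u).1
    have h3 := okA_add_okC_mul_le hk hu.1
    have h4 := okA_nonneg k u
    have h5 := okC_nonneg k hu.1.le
    have h6 : 0 ≤ (okA k u + okC k u) * (Real.pi / u) :=
      mul_nonneg (add_nonneg h4 h5) (div_nonneg Real.pi_pos.le hu.1.le)
    rw [norm_neg, norm_div, Real.norm_eq_abs, Real.norm_eq_abs, abs_of_pos hx',
      div_le_iff₀ hx']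
    calc _ ≤ 1 * (x * 4.8) := h1.trans (by gcongr)
      _ = _ := by ring
  · have hx' : x ≠ 0 := (show 0 < x from hx).ne'
    have e1 : HasDerivAt (fun x => -(x * okA k u)) (-(1 * okA k u)) x :=
      ((hasDerivAt_id x).mul_const _).neg
    have e2 : HasDerivAt (fun x => okArg k x d u) (-(1 * okC k u)) x :=
      ((hasDerivAt_id x).mul_const _).const_sub _
    refine ((e1.exp.mul e2.sin).mul_const _).congr_deriv ?_
    unfold okF
    field_simp
    ring

lemma okA_pos {k : ℕ} (hk : 2 ≤ k) {u : ℝ} (hu : 0 < u) (hu2 : u ≤ Real.pi * okM k) :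
    0 < okA k u := by
  rcases le_total u 2.6 with h | h
  · have hA := okA_ge_quartic hk hu.le
    have : u ^ 2 ≤ 2.6 ^ 2 := by gcongr
    have : 0 < u ^ 2 := by positivity
    nlinarith
  · linarith [okA_ge_tail hk h hu2]

lemma tendsto_exp_okA {k : ℕ} (hk : 2 ≤ k) {u : ℝ} (hu : 0 < u) (hu2 : u ≤ Real.pi * okM k) :
    Tendsto (fun N => Real.exp (-(N * okA k u))) atTop (𝓝 0) :=
  Real.tendsto_exp_neg_atTop_nhds_zero.comp (tendsto_id.atTop_mul_const (okA_pos hk hu hu2))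

lemma tendsto_okK {k : ℕ} (hk : 2 ≤ k) (d : ℝ) :
    Tendsto (fun N => okK k N d) atTop (𝓝 0) := by
  have h0 : (0 : ℝ) ≤ Real.pi * okM k := by linarith [two_le_pi_mul_okM hk]
  have key := intervalIntegral.tendsto_integral_filter_of_dominated_convergence
    (μ := MeasureTheory.volume) (a := 0) (b := Real.pi * okM k) (l := atTop) (f := fun _ => 0)
    (F := fun N u => Real.exp (-(N * okA k u)) * Real.sin (okArg k N d u) * okSig k u)
    (fun _ => Real.pi * (|d| + 1))
    (Eventually.of_forall fun N => (measurable_okK_integrand k N d).aestronglyMeasurable)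
    ((eventually_ge_atTop 0).mono fun N hN => Eventually.of_forall fun u hu => ?_)
    intervalIntegrable_const
    (Eventually.of_forall fun u hu => ?_)
  · rw [intervalIntegral.integral_zero] at key
    exact key
  · rw [Set.uIoc_of_le h0] at hu
    exact abs_okK_integrand_le hk hN hu.1 hu.2
  · rw [Set.uIoc_of_le h0] at hu
    have hs := okSig_pos hu.1 hu.2
    have h1 := (tendsto_exp_okA hk hu.1 hu.2).mul_const (okSig k u)
    rw [zero_mul] at h1
    refine squeeze_zero_norm (fun N => ?_) h1
    rw [norm_mul, norm_mul, Real.norm_eq_abs, Real.norm_eq_abs, Real.norm_eq_abs,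
      abs_of_pos (Real.exp_pos _), abs_of_pos hs]
    refine mul_le_mul_of_nonneg_right ?_ hs.le
    exact mul_le_of_le_one_right (Real.exp_nonneg _) (Real.abs_sin_le_one _)

lemma tendsto_okMom_zero {k : ℕ} (hk : 2 ≤ k) :
    Tendsto (fun N => okMom k N 0) atTop (𝓝 0) := by
  have key := intervalIntegral.tendsto_integral_filter_of_dominated_convergence
    (μ := MeasureTheory.volume) (a := 0) (b := 2) (l := atTop) (f := fun _ => 0)
    (F := fun N u => Real.exp (-(N * okA k u)) * u ^ 0)
    (fun _ => 1)
    (Eventually.of_forall fun N =>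
      ((continuous_exp_okA k N).mul (continuous_pow 0)).aestronglyMeasurable)
    ((eventually_ge_atTop 0).mono fun N hN => Eventually.of_forall fun u hu => ?_)
    intervalIntegrable_const
    (Eventually.of_forall fun u hu => ?_)
  · rw [intervalIntegral.integral_zero] at key
    exact key
  · rw [pow_zero, mul_one, Real.norm_eq_abs, abs_of_pos (Real.exp_pos _)]
    exact (exp_mul_le hN u).1
  · rw [Set.uIoc_of_le (by norm_num)] at hu
    simpa using tendsto_exp_okA hk hu.1 (by linarith [two_le_pi_mul_okM hk, hu.2])

/-- Minus the scale derivative of `okMom k N 0`. -/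
noncomputable def okD (k : ℕ) (N : ℝ) : ℝ :=
  ∫ u in (0 : ℝ)..2, Real.exp (-(N * okA k u)) * okA k u

lemma continuous_okD_integrand (k : ℕ) (N : ℝ) :
    Continuous fun u => Real.exp (-(N * okA k u)) * okA k u :=
  (continuous_exp_okA k N).mul (continuous_okA k)

lemma hasDerivAt_okMom_zero {k : ℕ} (hk : 2 ≤ k) {N : ℝ} (hN : 0 < N) :
    HasDerivAt (fun N => okMom k N 0) (-okD k N) N := by
  have key := intervalIntegral.hasDerivAt_integral_of_dominated_loc_of_deriv_le
    (μ := MeasureTheory.volume) (a := 0) (b := 2) (bound := fun _ => 1)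
    (F := fun N u => Real.exp (-(N * okA k u)) * u ^ 0)
    (F' := fun N u => -(Real.exp (-(N * okA k u)) * okA k u)) (x₀ := N) (s := Set.Ioi 0)
    (Ioi_mem_nhds hN)
    (Eventually.of_forall fun N =>
      ((continuous_exp_okA k N).mul (continuous_pow 0)).aestronglyMeasurable)
    (intervalIntegrable_okMom k N 0 0 2)
    (continuous_okD_integrand k N).neg.aestronglyMeasurable
    (Eventually.of_forall fun u hu x hx => ?_)
    intervalIntegrable_const
    (Eventually.of_forall fun u hu x hx => ?_)
  · refine key.2.congr_deriv ?_
    rw [intervalIntegral.integral_neg]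
    rfl
  · rw [Set.uIoc_of_le (by norm_num)] at hu
    have h1 := (exp_mul_le (k := k) (show 0 < x from hx).le u).1
    have h2 := okA_le_sq hk (u := u)
    have h3 := okA_nonneg k u
    have h4 : u ^ 2 ≤ 2 ^ 2 := by
      have := hu.1
      have := hu.2
      gcongr
    rw [norm_neg, norm_mul, Real.norm_eq_abs, Real.norm_eq_abs, abs_of_pos (Real.exp_pos _),
      abs_of_nonneg h3]
    nlinarith [Real.exp_pos (-(x * okA k u))]
  · have e1 : HasDerivAt (fun x => -(x * okA k u)) (-(1 * okA k u)) x :=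
      ((hasDerivAt_id x).mul_const _).neg
    refine (e1.exp.mul_const _).congr_deriv ?_
    ring

lemma okD_le {k : ℕ} (hk : 2 ≤ k) {N n : ℝ} (hNn : N * n = 1) (hN : 30 ≤ N) :
    okD k N ≤ 0.527 * n * okMom k N 0 := by
  have h2 := (okMom_bounds hk hNn hN).1
  have h1 : okD k N ≤ 1 / 6 * okMom k N 2 := by
    unfold okMom
    rw [← intervalIntegral.integral_const_mul]
    refine intervalIntegral.integral_mono_on (by norm_num)
      ((continuous_okD_integrand k N).intervalIntegrable 0 2)
      ((intervalIntegrable_okMom k N 2 0 2).const_mul _) fun u _ => ?_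
    have := mul_le_mul_of_nonneg_left (okA_le_sq hk (u := u)) (Real.exp_nonneg (-(N * okA k u)))
    linarith
  have := mul_nonneg (inv_bounds hNn hN).1.le (okMom_nonneg k N 0)
  linarith

lemma mul_okA'_le {k : ℕ} {u : ℝ} (hu : 0 ≤ u) (hu2 : u ≤ 2) :
    okA' k u * u ≤ 2 * okA k u := by
  have h1 := mul_le_mul_of_nonneg_right (okA'_le_five k hu) hu
  have h2 := okA_ge_four k hu
  have h3 : okB k 6 ≤ okB k 4 := (okB_antitone k 5).trans (okB_antitone k 4)
  have h4 := okB_nonneg k 4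
  have h5 : okB k 6 * u ^ 6 ≤ okB k 4 * (u ^ 4 * 2 ^ 2) := by
    rw [pow_add u 4 2]
    gcongr
  nlinarith [mul_nonneg h4 (pow_nonneg hu 4)]

lemma okD_ge {k : ℕ} (hk : 2 ≤ k) {N n : ℝ} (hNn : N * n = 1) (hN : 30 ≤ N) :
    0.49 * n * okMom k N 0 ≤ okD k N := by
  obtain ⟨hn0, hn1⟩ := inv_bounds hNn hN
  have hc : Continuous fun u => Real.exp (-(N * okA k u)) * (N * (okA' k u * u)) :=
    (continuous_exp_okA k N).mul (((continuous_okA' k).mul continuous_id).const_mul N)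
  have hd : ∀ u : ℝ, HasDerivAt (fun u => Real.exp (-(N * okA k u)) * u)
      (Real.exp (-(N * okA k u)) * u ^ 0
        - Real.exp (-(N * okA k u)) * (N * (okA' k u * u))) u := fun u => by
    refine ((((hasDerivAt_okA k u).const_mul N).neg.exp).mul (hasDerivAt_id u)).congr_deriv ?_
    simp only [Pi.neg_apply, id]
    ring
  have h1 := intervalIntegral.integral_eq_sub_of_hasDerivAt (a := 0) (b := 2)
    (fun u _ => hd u) ((intervalIntegrable_okMom k N 0 0 2).sub (hc.intervalIntegrable 0 2))
  rw [intervalIntegral.integral_sub (intervalIntegrable_okMom k N 0 0 2)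
      (hc.intervalIntegrable 0 2), mul_zero, sub_zero] at h1
  have h2 : ∫ u in (0 : ℝ)..2, Real.exp (-(N * okA k u)) * (N * (okA' k u * u)) ≤
      2 * N * okD k N := by
    unfold okD
    rw [← intervalIntegral.integral_const_mul]
    refine intervalIntegral.integral_mono_on (by norm_num) (hc.intervalIntegrable 0 2)
      (((continuous_okD_integrand k N).intervalIntegrable 0 2).const_mul _) fun u hu => ?_
    calc _ ≤ Real.exp (-(N * okA k u)) * (N * (2 * okA k u)) := by
          have := mul_okA'_le (k := k) hu.1 hu.2
          gcongr
      _ = _ := by ring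
  have h3 : Real.exp (-(N * okA k 2)) * 2 ≤ 0.02 * okMom k N 0 := by
    have := okA_ge_mid hk le_rfl (by norm_num)
    have h4 : Real.exp (-(N * okA k 2)) ≤ 1.32 * Real.exp (-(8 / 15 * N)) := by
      refine (Real.exp_le_exp.mpr (by nlinarith : _ ≤ -(8 / 15 * N))).trans ?_
      linarith [Real.exp_pos (-(8 / 15 * N))]
    have h5 := tail_total_le hNn hN
    have h6 : 0 ≤ 1.35 * N * Real.exp (-(8 / 15 * N))
      + 15.9 * N ^ 2 * Real.exp (-(0.72 * N)) := by positivity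
    have h7 := okMom_zero_ge hk hNn hN
    nlinarith
  change okMom k N 0 - _ = _ at h1
  have h4 : 0.49 * okMom k N 0 ≤ N * okD k N := by linarith
  calc 0.49 * n * okMom k N 0 = n * (0.49 * okMom k N 0) := by ring
    _ ≤ n * (N * okD k N) := by gcongr
    _ = okD k N := by rw [← mul_assoc, mul_comm n, hNn, one_mul]

lemma nonneg_of_hasDerivAt_nonpos {f f' : ℝ → ℝ} {a : ℝ} (hf : ∀ x, a ≤ x → HasDerivAt f (f' x) x)
    (h' : ∀ x, a ≤ x → f' x ≤ 0) (h0 : Tendsto f atTop (𝓝 0)) : 0 ≤ f a := by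
  have hanti : AntitoneOn f (Set.Ici a) := by
    refine antitoneOn_of_deriv_nonpos (convex_Ici a)
      (fun x hx => (hf x hx).continuousAt.continuousWithinAt)
      (fun x hx => ?_) (fun x hx => ?_)
    · rw [interior_Ici] at hx
      exact (hf x hx.le).differentiableAt.differentiableWithinAt
    · rw [interior_Ici] at hx
      rw [(hf x hx.le).deriv]
      exact h' x hx.le
  refine le_of_tendsto h0 ((eventually_ge_atTop a).mono fun x hx => ?_)
  exact hanti Set.self_mem_Ici hx hx

lemma okK_nonpos {k : ℕ} (hk : 2 ≤ k) {N η : ℝ} (hN : 30 ≤ N)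
    (hMN : okM k ≤ 1.05 * N) (hη : -0.41 ≤ η) (hη2 : η ≤ 0) :
    okK k N (η + cb3 (okX k) / 2) ≤ 0 := by
  have := nonneg_of_hasDerivAt_nonpos (f := fun N => -okK k N (η + cb3 (okX k) / 2)) (a := N)
    (fun x hx => (hasDerivAt_okK hk (by linarith) _).neg) (fun x hx => ?_) ?_
  · linarith
  · have hx0 : 0 < x := by linarith
    have h := okI_neg hk (mul_inv_cancel₀ hx0.ne') (hN.trans hx) (by linarith) hη hη2
    rw [neg_neg]
    exact (div_neg_of_neg_of_pos h hx0).le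
  · simpa using (tendsto_okK hk (η + cb3 (okX k) / 2)).neg

lemma okK_neg {k : ℕ} (hk : 2 ≤ k) {N η : ℝ} (hN : 30 ≤ N)
    (hMN : okM k ≤ 1.05 * N) (hη : -0.41 ≤ η) (hη2 : η ≤ 0) :
    okK k N (η + cb3 (okX k) / 2) < 0 := by
  have h1 := okK_nonpos (N := N + 1) hk (by linarith) (by linarith) hη hη2
  obtain ⟨x, hx, hd⟩ := exists_hasDerivAt_eq_slope (fun N => okK k N (η + cb3 (okX k) / 2))
    (fun N => -(okI k N (η + cb3 (okX k) / 2) / N)) (lt_add_one N)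
    (fun x hx => (hasDerivAt_okK hk (by linarith [hx.1]) _).continuousAt.continuousWithinAt)
    (fun x hx => hasDerivAt_okK hk (by linarith [hx.1]) _)
  have hx0 : 0 < x := by linarith [hx.1]
  have h := okI_neg hk (mul_inv_cancel₀ hx0.ne') (by linarith [hx.1]) (by linarith [hx.1]) hη hη2
  have h2 := div_neg_of_neg_of_pos h hx0
  rw [add_sub_cancel_left, div_one] at hd
  linarith

lemma okK_pos {k : ℕ} (hk : 2 ≤ k) {N n η : ℝ} (hNn : N * n = 1) (hN : 30 ≤ N)
    (hMN : okM k ≤ 1.05 * N) (hη : 0.38 * (okH (okX k) + 0.0086) * n < η) (hη2 : η ≤ 0.41) :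
    0 < okK k N (η + cb3 (okX k) / 2) := by
  obtain ⟨hn0, hn1⟩ := inv_bounds hNn hN
  obtain ⟨-, -, -, -, ⟨hh, -⟩⟩ := okP_bounds (okX_pos k).le (okX_le hk)
  obtain ⟨e, he⟩ : ∃ e, e = okH (okX k) + 0.0086 := ⟨_, rfl⟩
  rw [← he] at hη
  have he0 : 0 < e := by linarith
  have hη0 : 0 ≤ η := le_trans (by positivity) hη.le
  have hm := okMom_zero_pos hk hNn hN
  have h := nonneg_of_hasDerivAt_nonpos (a := N)
    (f := fun N => okK k N (η + cb3 (okX k) / 2) - 1.768 * η * okMom k N 0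
      + e * (100 / 149) * (okMom k N 0 * N⁻¹))
    (fun x hx => (((hasDerivAt_okK hk (by linarith) _).sub
      ((hasDerivAt_okMom_zero hk (by linarith)).const_mul (1.768 * η))).add
      (((hasDerivAt_okMom_zero hk (by linarith)).mul
        (hasDerivAt_inv (by linarith : x ≠ 0))).const_mul (e * (100 / 149)))))
    (fun x hx => ?_) ?_
  · have hi : N⁻¹ = n := (eq_inv_of_mul_eq_one_right hNn).symm
    rw [hi] at h
    have : 0 < (1.768 * η - e * (100 / 149) * n) * okMom k N 0 := by
      refine mul_pos ?_ hm
      nlinarith only [mul_pos he0 hn0, hη]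
    linarith
  · have hx0 : 0 < x := by linarith
    have hxn := mul_inv_cancel₀ hx0.ne'
    have hx30 := hN.trans hx
    obtain ⟨hn0, hn1⟩ := inv_bounds hxn hx30
    have h1 := okI_ge hk hxn hx30 (by linarith) hη0 hη2
    rw [← he] at h1
    have h2 := okD_le hk hxn hx30
    have h3 := okD_ge hk hxn hx30
    have hm := okMom_nonneg k x 0
    have e1 : (x ^ 2)⁻¹ = x⁻¹ ^ 2 := by rw [inv_pow]
    rw [e1, div_eq_mul_inv]
    generalize x⁻¹ = n at *
    have a1 := mul_le_mul_of_nonneg_right h1 hn0.le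
    have a2 := mul_le_mul_of_nonneg_left h2 (by positivity : 0 ≤ 1.768 * η)
    have a3 := mul_le_mul_of_nonneg_left h3 (by positivity : 0 ≤ e * (100 / 149) * n)
    have a4 : 0 ≤ η * n * okMom k x 0 := by positivity
    have a5 : 0 ≤ e * n ^ 2 * okMom k x 0 := by positivity
    nlinarith only [a1, a2, a3, a4, a5]
  · have := ((tendsto_okK hk (η + cb3 (okX k) / 2)).sub
      ((tendsto_okMom_zero hk).const_mul (1.768 * η))).add
      (((tendsto_okMom_zero hk).mul tendsto_inv_atTop_zero).const_mul (e * (100 / 149)))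
    simpa using this

/-- The cumulative distribution function. -/
noncomputable def okCdf (k ν : ℕ) (lam : ℝ) : ℝ :=
  ∑ j ∈ Finset.range (ν + 1), poissonOrderKPmf k lam j

lemma okCdf_mono (k : ℕ) {lam : ℝ} (hl : 0 ≤ lam) : Monotone fun ν => okCdf k ν lam :=
  fun _ _ h => Finset.sum_le_sum_of_subset_of_nonneg
    (Finset.range_subset_range.mpr (by omega)) fun _ _ _ => poissonOrderKPmf_nonneg k hl _

lemma okCdf_anti (k ν : ℕ) {lam lam' : ℝ} (hl : 0 ≤ lam) (h : lam ≤ lam') :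
    okCdf k ν lam' ≤ okCdf k ν lam :=
  sum_poissonOrderKPmf_antitone k (ν + 1) hl (hl.trans h) h

lemma okW_pos {k : ℕ} (hk : 0 < k) : 0 < okW k := by
  have : (0 : ℝ) < k := by exact_mod_cast hk
  exact div_pos (okM_pos k) (by positivity)

/-- The mean at parameter `1`. -/
noncomputable def okKappa (k : ℕ) : ℝ := k * (k + 1) / 2

lemma okKappa_mul_okW {k : ℕ} (hk : 0 < k) : okKappa k * okW k = okM k / 2 := by
  have : (0 : ℝ) < k := by exact_mod_cast hk
  unfold okKappa okW
  field_simp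

lemma okK_eq {k : ℕ} (hk : 2 ≤ k) {lam : ℝ} (hl : 0 ≤ lam) (ν : ℕ) :
    okK k (lam / okW k) ((okKappa k * lam - ν - 1 / 2) / okM k) =
      Real.pi * (1 - 2 * okCdf k ν lam) := by
  have hM := okM_pos k
  have hw := okW_pos (k := k) (by omega)
  rw [okCdf, ← sum_poissonOrderKPmf_eq_integral k hl ν]
  unfold okK
  have h := intervalIntegral.smul_integral_comp_mul_right (a := 0) (b := Real.pi)
    (fun u => Real.exp (-(lam / okW k * okA k u)) *
      Real.sin (okArg k (lam / okW k) ((okKappa k * lam - ν - 1 / 2) / okM k) u) * okSig k u)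
    (okM k)
  rw [zero_mul] at h
  rw [← h, smul_eq_mul, ← intervalIntegral.integral_const_mul]
  refine intervalIntegral.integral_congr fun t _ => ?_
  have e3 : ∀ i : ℕ, okQ k i * (t * okM k) = ((i : ℝ) + 1) * t := fun i => by
    unfold okQ
    field_simp
  have e1 : lam / okW k * okA k (t * okM k) =
      lam * ∑ i ∈ Finset.range k, (1 - Real.cos (((i : ℝ) + 1) * t)) := by
    unfold okA
    simp only [e3]
    rw [← mul_assoc, div_mul_cancel₀ _ hw.ne']
  have e2 : okArg k (lam / okW k) ((okKappa k * lam - ν - 1 / 2) / okM k) (t * okM k) =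
      lam * ∑ i ∈ Finset.range k, Real.sin (((i : ℝ) + 1) * t) - (ν + 1 / 2) * t := by
    unfold okArg okC
    have hs := sum_pow_one k
    simp only [pow_one] at hs
    simp only [e3, Finset.sum_sub_distrib, ← Finset.sum_mul, hs]
    unfold okKappa
    field_simp
    ring
  have e4 : t * okM k / (2 * okM k) = t / 2 := by field_simp
  have e5 : ∀ E S s : ℝ, okM k * (E * S * (1 / (okM k * s))) = E * S / s := fun E S s => by
    rcases eq_or_ne s 0 with rfl | hs
    · simp
    · field_simp
  simp only [e1, e2, okSig, e4]
  exact e5 _ _ _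

/-- The mean shifted by the median correction at the level of the first order. -/
noncomputable def okR (k : ℕ) (lam : ℝ) : ℝ :=
  okKappa k * lam - 1 / 2 - cb3 (okX k) / 2 * okM k

lemma okK_eq_okR {k : ℕ} (hk : 2 ≤ k) {lam : ℝ} (hl : 0 ≤ lam) (ν : ℕ) :
    okK k (lam / okW k) ((okR k lam - ν) / okM k + cb3 (okX k) / 2) =
      Real.pi * (1 - 2 * okCdf k ν lam) := by
  have hM := okM_pos k
  rw [← okK_eq hk hl]
  congr 1
  unfold okR
  field_simp
  ring

lemma half_lt_okCdf {k : ℕ} (hk : 2 ≤ k) {lam : ℝ} (hl : 0 ≤ lam) (hN : 30 ≤ lam / okW k)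
    (hMN : okM k ≤ 1.05 * (lam / okW k)) {ν : ℕ} (hr : 0 ≤ okR k lam) (h : okR k lam ≤ ν) :
    1 / 2 < okCdf k ν lam := by
  have hM := okM_ge hk
  have h1 : ⌈okR k lam⌉₊ ≤ ν := Nat.ceil_le.mpr h
  refine lt_of_lt_of_le ?_ (okCdf_mono k hl h1)
  have h2 := Nat.ceil_lt_add_one hr
  have h3 := Nat.le_ceil (okR k lam)
  have h4 := okK_neg (η := (okR k lam - ⌈okR k lam⌉₊) / okM k) hk hN hMN
    (by rw [le_div_iff₀ (by linarith)]; nlinarith)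
    (div_nonpos_of_nonpos_of_nonneg (by linarith) (by linarith))
  rw [okK_eq_okR hk hl] at h4
  nlinarith [Real.pi_pos]

lemma okH_bounds (k : ℕ) (hk : 2 ≤ k) : 0.0248 ≤ okH (okX k) ∧ okH (okX k) ≤ 0.0379 := by
  obtain ⟨-, -, -, -, hh⟩ := okP_bounds (okX_pos k).le (okX_le hk)
  exact hh

lemma okCdf_lt_half {k : ℕ} (hk : 2 ≤ k) {lam : ℝ} (hl : 0 ≤ lam) (hN : 30 ≤ lam / okW k)
    (hMN : okM k ≤ 1.05 * (lam / okW k)) {ν : ℕ} (h : ν ≤ okR k lam - 0.001 * okM k) :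
    okCdf k ν lam < 1 / 2 := by
  have hM := okM_ge hk
  have h1 : ν ≤ ⌊okR k lam - 0.001 * okM k⌋₊ := Nat.le_floor h
  refine lt_of_le_of_lt (okCdf_mono k hl h1) ?_
  have h2 := Nat.lt_floor_add_one (okR k lam - 0.001 * okM k)
  have h3 := Nat.floor_le ((Nat.cast_nonneg ν).trans h)
  have hN0 : 0 < lam / okW k := by linarith
  have hNn := mul_inv_cancel₀ hN0.ne'
  obtain ⟨hn0, hn1⟩ := inv_bounds hNn hN
  have hh := okH_bounds k hk
  have h4 := okK_pos (η := (okR k lam - ⌊okR k lam - 0.001 * okM k⌋₊) / okM k) hk hNn hN hMN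
    (by
      rw [lt_div_iff₀ (by linarith)]
      have : 0.38 * (okH (okX k) + 0.0086) * (lam / okW k)⁻¹ ≤
        0.38 * (0.0379 + 0.0086) * (1 / 30) := by gcongr; exact hh.2
      nlinarith)
    (by rw [div_le_iff₀ (by linarith)]; nlinarith)
  rw [okK_eq_okR hk hl] at h4
  nlinarith [Real.pi_pos]

/-- The conjecture for all sufficiently large values of the scale parameter. -/
lemma mean_sub_lt_one_of_large {k : ℕ} (hk : 2 ≤ k) {ν : ℕ} {lam₀ lam₁ lam₂ : ℝ}
    (hN : 30 ≤ lam₀ / okW k) (hMN : okM k ≤ 1.05 * (lam₀ / okW k))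
    (hr : 0 ≤ okR k lam₀) (hν : okR k lam₀ ≤ ν) (h0 : 0 ≤ lam₀)
    (h₁ : 0 < lam₁) (hF₁ : okCdf k ν lam₁ = 1 / 2) (hF₂ : okCdf k (ν + 1) lam₂ = 1 / 2) :
    okKappa k * lam₂ - okKappa k * lam₁ < 1 := by
  have hw := okW_pos (k := k) (by omega)
  have hM := okM_ge hk
  have hM0 := okM_pos k
  have hk0 : (0 : ℝ) < k := by exact_mod_cast (by omega : 0 < k)
  have hκ : 0 < okKappa k := by unfold okKappa; positivity
  have hκw := okKappa_mul_okW (k := k) (by omega)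
  have hle : lam₀ ≤ lam₁ := by
    by_contra! hlt
    have := okCdf_anti k ν h₁.le hlt.le
    have := half_lt_okCdf hk h0 hN hMN hr hν
    linarith
  have hNle : lam₀ / okW k ≤ lam₁ / okW k := by gcongr
  have hN1 : 30 ≤ lam₁ / okW k := hN.trans hNle
  have hMN1 : okM k ≤ 1.05 * (lam₁ / okW k) := by linarith
  have hrpos : okR k lam₁ - 0.001 * okM k < ν := by
    by_contra! hcon
    have := okCdf_lt_half hk h₁.le hN1 hMN1 hcon
    linarith
  have hrle : ν < okR k lam₁ := by
    by_contra! hcon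
    have h5 : okR k lam₀ ≤ okR k lam₁ := by
      unfold okR
      gcongr
    have := half_lt_okCdf hk h₁.le hN1 hMN1 (hr.trans h5) hcon
    linarith
  by_contra! hcon
  have hlam : lam₁ + 1 / okKappa k ≤ lam₂ := by
    have : 1 / okKappa k ≤ lam₂ - lam₁ := by
      rw [div_le_iff₀ hκ]
      linarith
    linarith
  have hl' : 0 ≤ lam₁ + 1 / okKappa k := by positivity
  have hF' : 1 / 2 ≤ okCdf k (ν + 1) (lam₁ + 1 / okKappa k) := by
    have := okCdf_anti k (ν + 1) hl' hlam
    linarith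
  have k1 := okK_eq_okR hk h₁.le ν
  have k2 := okK_eq_okR hk hl' (ν + 1)
  have e1 : okR k (lam₁ + 1 / okKappa k) - (ν + 1 : ℕ) = okR k lam₁ - ν := by
    unfold okR
    push_cast
    field_simp
    ring
  have e2 : (lam₁ + 1 / okKappa k) / okW k = lam₁ / okW k + 2 / okM k := by
    have : 1 / okKappa k / okW k = 2 / okM k := by
      rw [div_div, hκw, one_div_div]
    rw [add_div, this]
  rw [e1, e2] at k2
  have hη0 : 0 ≤ (okR k lam₁ - ν) / okM k := div_nonneg (by linarith) (by linarith)
  have hη1 : (okR k lam₁ - ν) / okM k ≤ 0.41 := by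
    rw [div_le_iff₀ (by linarith)]
    linarith
  set η := (okR k lam₁ - ν) / okM k
  set N := lam₁ / okW k
  have k1' : okK k N (η + cb3 (okX k) / 2) = 0 := by rw [k1, hF₁]; ring
  have k2' : okK k (N + 2 / okM k) (η + cb3 (okX k) / 2) ≤ 0 := by
    rw [k2]
    nlinarith [Real.pi_pos]
  have h2M : 0 < 2 / okM k := by positivity
  have h2M' : 2 / okM k ≤ 0.8 := by
    rw [div_le_iff₀ (by linarith)]
    linarith
  obtain ⟨x, hx, hd⟩ := exists_hasDerivAt_eq_slope (fun N => okK k N (η + cb3 (okX k) / 2))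
    (fun N => -(okI k N (η + cb3 (okX k) / 2) / N)) (by linarith : N < N + 2 / okM k)
    (fun x hx => (hasDerivAt_okK hk (by linarith [hx.1]) _).continuousAt.continuousWithinAt)
    (fun x hx => hasDerivAt_okK hk (by linarith [hx.1]) _)
  have hx0 : 0 < x := by linarith [hx.1]
  have hI : 0 ≤ okI k x (η + cb3 (okX k) / 2) := by
    by_contra! hneg
    have h6 := div_neg_of_neg_of_pos hneg hx0
    rw [k1', sub_zero, add_sub_cancel_left] at hd
    have h7 := div_nonpos_of_nonpos_of_nonneg k2' h2M.le
    linarith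
  have hxn := mul_inv_cancel₀ hx0.ne'
  have hx30 : 30 ≤ x := by linarith [hx.1]
  have c1 := eta_ge_of_okI_nonneg hk hxn hx30 (by linarith [hx.1]) hη0 hη1 hI
  have hN0 : 0 < N := by linarith
  have hNn := mul_inv_cancel₀ hN0.ne'
  have c2 : η ≤ 0.38 * (okH (okX k) + 0.0086) * N⁻¹ := by
    by_contra! hgt
    have := okK_pos hk hNn hN1 hMN1 hgt hη1
    linarith
  obtain ⟨hn0, hn1⟩ := inv_bounds hxn hx30
  have hinv : N⁻¹ ≤ 1.027 * x⁻¹ := by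
    rw [inv_le_iff_one_le_mul₀ hN0, ← hxn]
    have : x ≤ 1.027 * N := by linarith [hx.2]
    calc x * x⁻¹ ≤ 1.027 * N * x⁻¹ := by gcongr
      _ = _ := by ring
  obtain ⟨hh, -⟩ := okH_bounds k hk
  have c3 : 0.38 * (okH (okX k) + 0.0086) * N⁻¹ ≤
      0.38 * (okH (okX k) + 0.0086) * (1.027 * x⁻¹) := by gcongr
  nlinarith

/-- Evaluate a natural number before passing it on. -/
def forceNat {α : Type} (x : ℕ) (f : ℕ → α) : α :=
  Nat.rec (f 0) (fun n _ => f (Nat.succ n)) x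

/-- Reversal onto an accumulator. -/
def revOnto (l : List ℕ) : List ℕ → List ℕ :=
  List.rec (fun r => r) (fun a _ ih r => ih (a :: r)) l

/-- One pass of the fixed-point recurrence over a block of delayed cumulative sums. -/
def okPass (p q k e : ℕ) (l : List ℕ) :
    ℕ → ℕ → ℕ → List ℕ → (ℕ → ℕ → ℕ → List ℕ → Bool) → Bool :=
  List.rec (fun m C V acc f => f m C V acc)
    (fun d _ ih m C V acc f =>
      forceNat (Nat.sub (Nat.add V C) d) fun V' =>
      forceNat (Nat.add (Nat.add C (Nat.div (Nat.mul p (Nat.sub V' (Nat.mul k d))) m)) e) fun C' =>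
      ih (Nat.add m q) C' V' (C :: acc) f) l

/-- Run `b` full blocks and then a block of length `r`. -/
def okRun (p q k e r : ℕ) (f : ℕ → Bool) (b : ℕ) : List ℕ → ℕ → ℕ → ℕ → Bool :=
  Nat.rec (fun l m C V => okPass p q k e (l.take r) m C V [] fun _ C _ _ => f C)
    (fun _ ih l m C V => okPass p q k e l m C V [] fun m C V acc =>
      forceNat m fun m => ih (revOnto acc []) m C V) b

/-- Numerator, denominator and power for the Taylor polynomial of the exponential at `u / v`. -/
def expTaylor (u v : ℕ) (f : ℕ → ℕ → ℕ → Bool) (m : ℕ) : ℕ → ℕ → ℕ → ℕ → Bool :=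
  Nat.rec (fun _ a b c => f a b c)
    (fun _ ih j a b c =>
      forceNat (Nat.mul c u) fun c₁ => forceNat (Nat.add (Nat.mul a (Nat.mul v j)) c₁) fun a₁ =>
      forceNat (Nat.mul b (Nat.mul v j)) fun b₁ => forceNat (Nat.succ j) fun j₁ =>
      ih j₁ a₁ b₁ c₁) m

/-- The scale of the fixed-point arithmetic. -/
def okScale : ℕ := 2 ^ 40

/-- Pass the fixed-point cumulative sum up to `ν` at parameter `p / q` to `f`. -/
def okSum (p q k e ν : ℕ) (f : ℕ → Bool) : Bool :=
  okRun p q k e (ν % k) f (ν / k) (List.replicate k 0) q okScale 0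

/-- Conjunction, evaluating the first argument first. -/
def andThen (a b : Bool) : Bool :=
  Bool.rec false b a

/-- Certify that the cumulative distribution function at `ν` and `p / q` exceeds one half. -/
def okLower (p q k ν : ℕ) : Bool :=
  andThen (Nat.ble (k * p) (32 * q))
    (expTaylor (k * p) (32 * q) (fun a b c => okSum p q k 0 ν fun C =>
      Nat.blt (Nat.mul okScale (Nat.pow (16 * a + 17 * c) 32))
        (Nat.mul (2 * C) (Nat.pow (16 * b) 32))) 16 1 1 1 1)

/-- Certify that the cumulative distribution function at `ν` and `p / q` is below one half. -/
def okUpper (p q k ν : ℕ) : Bool :=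
  expTaylor (k * p) (32 * q) (fun a b _ => okSum p q k 1 ν fun C =>
    Nat.blt (Nat.mul (2 * C) (Nat.pow b 32)) (Nat.mul okScale (Nat.pow a 32))) 16 1 1 1 1

/-- The common denominator of the approximations to the means. -/
def okDen : ℕ := 2 ^ 24

/-- Certify one instance of the monotonicity, using an approximation to the mean at the median. -/
def okCheck (A B C k s κ n : ℕ) : Bool :=
  forceNat (okDen * n + A + B / n - C / n ^ 2) fun p =>
  forceNat (okDen * κ) fun q =>
  forceNat (n - s) fun ν =>
  forceNat (okDen + p) fun p' =>
    andThen (okLower p q k ν) (okUpper p' q k (ν + 1))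

/-- Check `m` consecutive numbers. -/
def checkRange (f : ℕ → Bool) (n m : ℕ) : Bool :=
  Nat.rec true (fun i ih => andThen (forceNat (n + i) f) ih) m

/-- Certify `m` consecutive instances of the monotonicity. -/
def okCheckRange (A B C k n m : ℕ) : Bool :=
  forceNat k fun k => forceNat ((k + 4) / 8) fun s => forceNat (k * (k + 1) / 2) fun κ =>
    checkRange (okCheck A B C k s κ) n m

lemma forceNat_eq {α : Type} (x : ℕ) (f : ℕ → α) : forceNat x f = f x := by
  cases x <;> rfl

lemma revOnto_eq (l r : List ℕ) : revOnto l r = l.reverse ++ r := by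
  induction l generalizing r with
  | nil => rfl
  | cons a l ih =>
    rw [show revOnto (a :: l) r = revOnto l (a :: r) from rfl, ih]
    simp

lemma sum_mul_add_mul_sum_range (c : ℕ → ℕ) (k t : ℕ) :
    (∑ i ∈ Finset.range k, if i ≤ t then (i + 1) * c (t - i) else 0) +
        k * ∑ j ∈ Finset.range (t + 1 - k), c j =
      ∑ i ∈ Finset.range k, ∑ j ∈ Finset.range (t + 1 - i), c j := by
  induction k with
  | zero => simp
  | succ k ih =>
    rw [Finset.sum_range_succ, Finset.sum_range_succ, ← ih]
    by_cases h : k ≤ t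
    · rw [if_pos h, show t + 1 - k = t - k + 1 by omega, Finset.sum_range_succ,
        show t + 1 - (k + 1) = t - k by omega]
      ring
    · rw [if_neg h, show t + 1 - k = 0 by omega, show t + 1 - (k + 1) = 0 by omega]
      simp

/-- Fixed-point approximations, rounded down (`e = 0`) or up (`e = 1`), to `orderKCoeff`. -/
def okFix (p q k e : ℕ) : ℕ → ℕ
  | 0 => okScale
  | n + 1 => p * (∑ i ∈ Finset.range k, if i ≤ n then (i + 1) * okFix p q k e (n - i) else 0) /
      (q * (n + 1)) + e
decreasing_by omega

/-- Partial sums of `okFix`. -/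
def okFixSum (p q k e n : ℕ) : ℕ := ∑ j ∈ Finset.range n, okFix p q k e j

/-- Sum of the `k` partial sums preceding the index `n`. -/
def okFixWin (p q k e n : ℕ) : ℕ := ∑ i ∈ Finset.range k, okFixSum p q k e (n - (i + 1))

lemma okFixWin_succ (p q k e n : ℕ) :
    okFixWin p q k e n + okFixSum p q k e n =
      okFixWin p q k e (n + 1) + okFixSum p q k e (n - k) := by
  unfold okFixWin
  have h := Finset.sum_range_succ' (fun i => okFixSum p q k e (n - i)) k
  rw [Finset.sum_range_succ] at h
  simp only [Nat.sub_zero] at h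
  simp only [Nat.reduceSubDiff]
  omega

lemma okFixSum_succ {n : ℕ} (hn : 1 ≤ n) (p q k e : ℕ) :
    okFixSum p q k e (n + 1) = okFixSum p q k e n +
      p * (okFixWin p q k e (n + 1) - k * okFixSum p q k e (n - k)) / (q * n) + e := by
  obtain ⟨t, rfl⟩ : ∃ t, n = t + 1 := ⟨n - 1, by omega⟩
  have h := sum_mul_add_mul_sum_range (okFix p q k e) k t
  have hw : okFixWin p q k e (t + 1 + 1) =
      ∑ i ∈ Finset.range k, ∑ j ∈ Finset.range (t + 1 - i), okFix p q k e j := by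
    simp only [okFixWin, okFixSum, Nat.reduceSubDiff]
  rw [hw, ← h, okFixSum, Finset.sum_range_succ, okFix]
  simp only [okFixSum, Nat.add_sub_cancel]
  ring

lemma okPass_eq (p q k e : ℕ) (f : ℕ → ℕ → ℕ → List ℕ → Bool) (j : ℕ) :
    ∀ (n : ℕ) (acc : List ℕ), 1 ≤ n →
      okPass p q k e ((List.range' n j).map fun i => okFixSum p q k e (i - k)) (q * n)
          (okFixSum p q k e n) (okFixWin p q k e n) acc f =
        f (q * (n + j)) (okFixSum p q k e (n + j)) (okFixWin p q k e (n + j))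
          (((List.range' n j).map (okFixSum p q k e)).reverse ++ acc) := by
  induction j with
  | zero => intro n acc _; rfl
  | succ j ih =>
    intro n acc hn
    rw [List.range'_succ, List.map_cons]
    change forceNat (okFixWin p q k e n + okFixSum p q k e n - okFixSum p q k e (n - k)) (fun V' =>
      forceNat (okFixSum p q k e n + p * (V' - k * okFixSum p q k e (n - k)) / (q * n) + e)
      fun C' => okPass p q k e ((List.range' (n + 1) j).map fun i => okFixSum p q k e (i - k))
        (q * n + q) C' V' (okFixSum p q k e n :: acc) f) = _
    rw [forceNat_eq, forceNat_eq, okFixWin_succ, Nat.add_sub_cancel, ← okFixSum_succ hn,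
      ← Nat.mul_succ, ih (n + 1) _ (by omega)]
    simp [add_assoc, add_comm 1 j]

lemma okRun_eq {k r : ℕ} (hr : r ≤ k) (p q e : ℕ) (f : ℕ → Bool) (b : ℕ) :
    ∀ n, 1 ≤ n →
      okRun p q k e r f b ((List.range' n k).map fun i => okFixSum p q k e (i - k)) (q * n)
          (okFixSum p q k e n) (okFixWin p q k e n) =
        f (okFixSum p q k e (n + b * k + r)) := by
  induction b with
  | zero =>
    intro n hn
    change okPass p q k e (((List.range' n k).map fun i => okFixSum p q k e (i - k)).take r)
      (q * n) (okFixSum p q k e n) (okFixWin p q k e n) [] _ = _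
    have : (List.range' n k).take r = List.range' n r := by
      obtain ⟨s, rfl⟩ := Nat.exists_eq_add_of_le hr
      rw [← List.range'_append_1, List.take_left' List.length_range']
    rw [← List.map_take, this, okPass_eq _ _ _ _ _ _ _ _ hn]
    simp
  | succ b ih =>
    intro n hn
    change okPass p q k e ((List.range' n k).map fun i => okFixSum p q k e (i - k))
      (q * n) (okFixSum p q k e n) (okFixWin p q k e n) [] (fun m C V acc =>
        forceNat m fun m => okRun p q k e r f b (revOnto acc []) m C V) = _
    rw [okPass_eq _ _ _ _ _ _ _ _ hn]
    simp only [forceNat_eq, revOnto_eq, List.append_nil, List.reverse_reverse]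
    have : (List.range' n k).map (okFixSum p q k e) =
        (List.range' (n + k) k).map fun i => okFixSum p q k e (i - k) := by
      rw [List.range'_eq_map_range, List.range'_eq_map_range, List.map_map, List.map_map]
      refine List.map_congr_left fun i _ => ?_
      simp only [Function.comp_apply]
      congr 1
      omega
    rw [this, ih (n + k) (by omega)]
    congr 2
    ring

lemma okSum_eq {k : ℕ} (hk : 0 < k) (p q e ν : ℕ) (f : ℕ → Bool) :
    okSum p q k e ν f = f (okFixSum p q k e (ν + 1)) := by
  have h := okRun_eq (Nat.mod_lt ν hk).le p q e f (ν / k) 1 le_rfl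
  have h0 : okFixSum p q k e 0 = 0 := by simp [okFixSum]
  have h1 : (List.range' 1 k).map (fun i => okFixSum p q k e (i - k)) = List.replicate k 0 := by
    rw [List.eq_replicate_iff]
    refine ⟨by simp, fun b hb => ?_⟩
    obtain ⟨i, hi, rfl⟩ := List.mem_map.mp hb
    rw [List.mem_range'_1] at hi
    rw [show i - k = 0 by omega, h0]
  have h2 : okFixSum p q k e 1 = okScale := by simp [okFixSum, okFix]
  have h3 : okFixWin p q k e 1 = 0 := by simp [okFixWin, h0]
  rw [h1, h2, h3, mul_one] at h
  rw [okSum, h, show 1 + ν / k * k + ν % k = ν + 1 by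
    rw [add_assoc, Nat.div_add_mod', add_comm]]

lemma orderKCoeff_succ (k : ℕ) (lam : ℝ) (n : ℕ) :
    ((n : ℝ) + 1) * orderKCoeff k lam (n + 1) = lam * ∑ i ∈ Finset.range k,
      if i ≤ n then ((i : ℝ) + 1) * orderKCoeff k lam (n - i) else 0 := by
  have h := orderKCoeff_rec k lam (n + 1)
  push_cast at h
  rw [h, ← Fin.sum_univ_eq_sum_range (fun i => if i ≤ n then
    ((i : ℝ) + 1) * orderKCoeff k lam (n - i) else 0)]

lemma okFix_zero_le {p q : ℕ} (hq : 0 < q) (k n : ℕ) :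
    (okFix p q k 0 n : ℝ) ≤ okScale * orderKCoeff k (p / q) n := by
  have hq' : (0 : ℝ) < q := by exact_mod_cast hq
  induction n using Nat.strong_induction_on with
  | _ n ih =>
    cases n with
    | zero => simp [okFix, orderKCoeff_zero]
    | succ n =>
      have h := orderKCoeff_succ k (p / q) n
      have hn : (0 : ℝ) < (n : ℝ) + 1 := by positivity
      have hle : ∑ i ∈ Finset.range k, (if i ≤ n then ((i : ℝ) + 1) * okFix p q k 0 (n - i) else 0)
          ≤ okScale * ∑ i ∈ Finset.range k,
            if i ≤ n then ((i : ℝ) + 1) * orderKCoeff k (p / q) (n - i) else 0 := by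
        rw [Finset.mul_sum]
        refine Finset.sum_le_sum fun i _ => ?_
        split_ifs
        · have := ih (n - i) (by omega)
          calc ((i : ℝ) + 1) * okFix p q k 0 (n - i)
              ≤ ((i : ℝ) + 1) * (okScale * orderKCoeff k (p / q) (n - i)) := by gcongr
            _ = _ := by ring
        · simp
      rw [okFix, add_zero]
      refine Nat.cast_div_le.trans ?_
      push_cast
      rw [div_le_iff₀ (by positivity)]
      calc _ ≤ p * (okScale * ∑ i ∈ Finset.range k,
            if i ≤ n then ((i : ℝ) + 1) * orderKCoeff k (p / q) (n - i) else 0) := by gcongr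
        _ = okScale * (((n : ℝ) + 1) * orderKCoeff k (p / q) (n + 1)) * q := by
          rw [h]
          field_simp
        _ = _ := by ring

lemma le_okFix_one {p q : ℕ} (hq : 0 < q) (k n : ℕ) :
    okScale * orderKCoeff k (p / q) n ≤ okFix p q k 1 n := by
  have hq' : (0 : ℝ) < q := by exact_mod_cast hq
  induction n using Nat.strong_induction_on with
  | _ n ih =>
    cases n with
    | zero => simp [okFix, orderKCoeff_zero]
    | succ n =>
      have h := orderKCoeff_succ k (p / q) n
      have hn : (0 : ℝ) < (n : ℝ) + 1 := by positivity
      have hle : okScale * ∑ i ∈ Finset.range k,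
            (if i ≤ n then ((i : ℝ) + 1) * orderKCoeff k (p / q) (n - i) else 0) ≤
          ∑ i ∈ Finset.range k, (if i ≤ n then ((i : ℝ) + 1) * okFix p q k 1 (n - i) else 0) := by
        rw [Finset.mul_sum]
        refine Finset.sum_le_sum fun i _ => ?_
        split_ifs
        · have := ih (n - i) (by omega)
          calc okScale * (((i : ℝ) + 1) * orderKCoeff k (p / q) (n - i))
              = ((i : ℝ) + 1) * (okScale * orderKCoeff k (p / q) (n - i)) := by ring
            _ ≤ _ := by gcongr
        · simp
      have hdiv := (Nat.lt_mul_div_succ (p * ∑ i ∈ Finset.range k,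
        if i ≤ n then (i + 1) * okFix p q k 1 (n - i) else 0) (b := q * (n + 1))
        (by positivity)).le
      rw [← okFix] at hdiv
      have hdiv' : (p : ℝ) * ∑ i ∈ Finset.range k,
          (if i ≤ n then ((i : ℝ) + 1) * okFix p q k 1 (n - i) else 0) ≤
          q * ((n : ℝ) + 1) * okFix p q k 1 (n + 1) := by exact_mod_cast hdiv
      have : q * ((n : ℝ) + 1) * (okScale * orderKCoeff k (p / q) (n + 1)) ≤
          q * ((n : ℝ) + 1) * okFix p q k 1 (n + 1) := by
        refine le_trans ?_ hdiv'
        calc _ = okScale * (((n : ℝ) + 1) * orderKCoeff k (p / q) (n + 1)) * q := by ring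
          _ = p * (okScale * ∑ i ∈ Finset.range k,
            (if i ≤ n then ((i : ℝ) + 1) * orderKCoeff k (p / q) (n - i) else 0)) := by
            rw [h]
            field_simp
          _ ≤ _ := by gcongr
      exact le_of_mul_le_mul_left this (by positivity)

lemma andThen_eq_true {a b : Bool} : andThen a b = true ↔ a = true ∧ b = true := by
  cases a <;> simp [andThen]

lemma checkRange_spec {f : ℕ → Bool} {n m : ℕ} (h : checkRange f n m = true) {j : ℕ}
    (hn : n ≤ j) (hm : j < n + m) : f j = true := by
  induction m with
  | zero => omega
  | succ m ih =>
    change andThen (forceNat (n + m) f) (checkRange f n m) = true at h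
    rw [andThen_eq_true, forceNat_eq] at h
    rcases Nat.lt_succ_iff_lt_or_eq.mp (show j < n + m + 1 by omega) with hlt | rfl
    · exact ih h.2 hlt
    · exact h.1

lemma expTaylor_spec {u v : ℕ} (hv : 0 < v) (f : ℕ → ℕ → ℕ → Bool) (m : ℕ) :
    ∀ j a b c : ℕ, 0 < b →
      (a : ℝ) = b * ∑ i ∈ Finset.range (j + 1), ((u : ℝ) / v) ^ i / i.factorial →
      (c : ℝ) = b * (((u : ℝ) / v) ^ j / j.factorial) →
      expTaylor u v f m (j + 1) a b c = true →
      ∃ a b c : ℕ, 0 < b ∧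
        (a : ℝ) = b * ∑ i ∈ Finset.range (j + m + 1), ((u : ℝ) / v) ^ i / i.factorial ∧
        (c : ℝ) = b * (((u : ℝ) / v) ^ (j + m) / (j + m).factorial) ∧ f a b c = true := by
  have hv' : (0 : ℝ) < v := by exact_mod_cast hv
  induction m with
  | zero => exact fun j a b c hb ha hc h => ⟨a, b, c, hb, ha, hc, h⟩
  | succ m ih =>
    intro j a b c hb ha hc h
    change forceNat (c * u) (fun c' => forceNat (a * (v * (j + 1)) + c') fun a' =>
      forceNat (b * (v * (j + 1))) fun b' => forceNat (j + 1 + 1) fun j' =>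
      expTaylor u v f m j' a' b' c') = true at h
    simp only [forceNat_eq] at h
    have hc' : ((c * u : ℕ) : ℝ) = ((b * (v * (j + 1)) : ℕ) : ℝ) *
        (((u : ℝ) / v) ^ (j + 1) / (j + 1).factorial) := by
      rw [Nat.factorial_succ]
      push_cast
      rw [hc, pow_succ]
      field_simp
    have ha' : ((a * (v * (j + 1)) + c * u : ℕ) : ℝ) = ((b * (v * (j + 1)) : ℕ) : ℝ) *
        ∑ i ∈ Finset.range (j + 1 + 1), ((u : ℝ) / v) ^ i / i.factorial := by
      rw [Finset.sum_range_succ, mul_add ((b * (v * (j + 1)) : ℕ) : ℝ), ← hc']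
      push_cast
      rw [ha]
      ring
    have := ih (j + 1) _ _ _ (by positivity) ha' hc' h
    rwa [show j + 1 + m = j + (m + 1) by ring] at this

lemma okCdf_eq_exp_mul (k ν : ℕ) (lam : ℝ) :
    okCdf k ν lam * Real.exp (k * lam) = ∑ j ∈ Finset.range (ν + 1), orderKCoeff k lam j := by
  unfold okCdf
  simp only [poissonOrderKPmf_eq, ← Finset.mul_sum]
  rw [mul_right_comm, ← Real.exp_add, neg_add_cancel, Real.exp_zero, one_mul]

lemma exp_eq_pow (k p q : ℕ) :
    Real.exp (k * ((p : ℝ) / q)) = Real.exp (((k * p : ℕ) : ℝ) / ((32 * q : ℕ) : ℝ)) ^ 32 := by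
  rw [← Real.exp_nat_mul]
  congr 1
  push_cast
  rcases eq_or_ne (q : ℝ) 0 with h | h
  · simp [h]
  · field_simp

lemma half_lt_okCdf_of_okLower {p q k ν : ℕ} (hk : 0 < k) (hq : 0 < q)
    (h : okLower p q k ν = true) : 1 / 2 < okCdf k ν (p / q) := by
  obtain ⟨hx, h⟩ := andThen_eq_true.mp h
  have hx := Nat.le_of_ble_eq_true hx
  obtain ⟨a, b, c, hb, ha, hc, h⟩ := expTaylor_spec (by positivity) _ 16 0 1 1 1 one_pos
    (by simp) (by simp) h
  rw [okSum_eq hk] at h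
  have h := Nat.le_of_ble_eq_true h
  change okScale * (16 * a + 17 * c) ^ 32 + 1 ≤ 2 * okFixSum p q k 0 (ν + 1) * (16 * b) ^ 32 at h
  set x : ℝ := ((k * p : ℕ) : ℝ) / ((32 * q : ℕ) : ℝ) with hxdef
  have hq' : (0 : ℝ) < ((32 * q : ℕ) : ℝ) := by positivity
  have hx0 : 0 ≤ x := by positivity
  have hx1 : x ≤ 1 := by
    rw [hxdef, div_le_one hq']
    exact_mod_cast hx
  have hb' : (0 : ℝ) < b := by exact_mod_cast hb
  have hexp : 16 * (b : ℝ) * Real.exp x ≤ 16 * a + 17 * c := by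
    have h1 := Real.exp_bound' hx0 hx1 (n := 16) (by norm_num)
    have h2 : 16 * (b : ℝ) * Real.exp x ≤ 16 * b * _ := mul_le_mul_of_nonneg_left h1 (by positivity)
    rw [ha, hc]
    simp only [zero_add]
    rw [Finset.sum_range_succ]
    have h3 : 0 ≤ b * (x ^ 16 / (Nat.factorial 16 : ℝ)) := by positivity
    refine h2.trans ?_
    push_cast
    rw [show x ^ 16 * ((16 : ℝ) + 1) / ((Nat.factorial 16 : ℝ) * 16) =
      17 / 16 * (x ^ 16 / (Nat.factorial 16 : ℝ)) by ring]
    nlinarith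
  have hsum : (okFixSum p q k 0 (ν + 1) : ℝ) ≤
      okScale * (okCdf k ν (p / q) * Real.exp x ^ 32) := by
    rw [hxdef, ← exp_eq_pow, okCdf_eq_exp_mul, Finset.mul_sum]
    unfold okFixSum
    push_cast
    exact Finset.sum_le_sum fun j _ => okFix_zero_le hq k j
  have hs : (0 : ℝ) < okScale := by norm_num [okScale]
  have h' : (okScale : ℝ) * (16 * a + 17 * c) ^ 32 <
      2 * okFixSum p q k 0 (ν + 1) * (16 * b) ^ 32 := by exact_mod_cast h
  have key : (okScale : ℝ) * (16 * b * Real.exp x) ^ 32 <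
      2 * (okScale * (okCdf k ν (p / q) * Real.exp x ^ 32)) * (16 * b) ^ 32 := by
    calc _ ≤ (okScale : ℝ) * (16 * a + 17 * c) ^ 32 := by gcongr
      _ < _ := h'
      _ ≤ _ := by gcongr
  have hpos : (0 : ℝ) < okScale * (16 * b * Real.exp x) ^ 32 := by positivity
  have : (okScale : ℝ) * (16 * b * Real.exp x) ^ 32 * 1 <
      okScale * (16 * b * Real.exp x) ^ 32 * (2 * okCdf k ν (p / q)) := by
    calc _ = (okScale : ℝ) * (16 * b * Real.exp x) ^ 32 := mul_one _
      _ < _ := key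
      _ = _ := by rw [mul_pow _ (Real.exp x)]; ring
  linarith [lt_of_mul_lt_mul_left this hpos.le]

lemma okCdf_lt_half_of_okUpper {p q k ν : ℕ} (hk : 0 < k) (hq : 0 < q)
    (h : okUpper p q k ν = true) : okCdf k ν (p / q) < 1 / 2 := by
  obtain ⟨a, b, c, hb, ha, -, h⟩ := expTaylor_spec (by positivity) _ 16 0 1 1 1 one_pos
    (by simp) (by simp) h
  rw [okSum_eq hk] at h
  have h := Nat.le_of_ble_eq_true h
  change 2 * okFixSum p q k 1 (ν + 1) * b ^ 32 + 1 ≤ okScale * a ^ 32 at h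
  set x : ℝ := ((k * p : ℕ) : ℝ) / ((32 * q : ℕ) : ℝ) with hxdef
  have hx0 : 0 ≤ x := by positivity
  have hb' : (0 : ℝ) < b := by exact_mod_cast hb
  have hexp : a ≤ b * Real.exp x := by
    rw [ha]
    gcongr
    exact Real.sum_le_exp_of_nonneg hx0 _
  have hsum : okScale * (okCdf k ν (p / q) * Real.exp x ^ 32) ≤
      (okFixSum p q k 1 (ν + 1) : ℝ) := by
    rw [hxdef, ← exp_eq_pow, okCdf_eq_exp_mul, Finset.mul_sum]
    unfold okFixSum
    push_cast
    exact Finset.sum_le_sum fun j _ => le_okFix_one hq k j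
  have hs : (0 : ℝ) < okScale := by norm_num [okScale]
  have h' : 2 * (okFixSum p q k 1 (ν + 1) : ℝ) * b ^ 32 < okScale * a ^ 32 := by
    exact_mod_cast h
  have key : 2 * (okScale * (okCdf k ν (p / q) * Real.exp x ^ 32)) * b ^ 32 <
      okScale * (b * Real.exp x) ^ 32 := by
    calc _ ≤ 2 * (okFixSum p q k 1 (ν + 1) : ℝ) * b ^ 32 := by gcongr
      _ < _ := h'
      _ ≤ _ := by gcongr
  have hpos : (0 : ℝ) < okScale * (b * Real.exp x) ^ 32 := by positivity
  have : (okScale : ℝ) * (b * Real.exp x) ^ 32 * (2 * okCdf k ν (p / q)) <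
      okScale * (b * Real.exp x) ^ 32 * 1 := by
    calc _ = 2 * (okScale * (okCdf k ν (p / q) * Real.exp x ^ 32)) * b ^ 32 := by
          rw [mul_pow]; ring
      _ < _ := key
      _ = _ := (mul_one _).symm
  linarith [lt_of_mul_lt_mul_left this hpos.le]


lemma okCheck_spec {A B C k s κ n : ℕ} (h : okCheck A B C k s κ n = true) :
    ∃ p, okLower p (okDen * κ) k (n - s) = true ∧
      okUpper (okDen + p) (okDen * κ) k (n - s + 1) = true := by
  unfold okCheck at h
  simp only [forceNat_eq, andThen_eq_true] at h
  exact ⟨_, h⟩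

lemma cast_okKappa (k : ℕ) : ((k * (k + 1) / 2 : ℕ) : ℝ) = okKappa k := by
  rw [Nat.cast_div (Nat.even_mul_succ_self k).two_dvd (by norm_num), okKappa]
  push_cast
  rfl

/-- The conclusion for one pair of consecutive medians, from a certificate. -/
lemma mean_sub_lt_one_of_okCheck {A B C k s n : ℕ} (hk : 0 < k)
    (h : okCheck A B C k s (k * (k + 1) / 2) n = true) {lam₁ lam₂ : ℝ} (h₁ : 0 < lam₁)
    (hF₁ : okCdf k (n - s) lam₁ = 1 / 2) (hF₂ : okCdf k (n - s + 1) lam₂ = 1 / 2) :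
    okKappa k * lam₂ - okKappa k * lam₁ < 1 := by
  have hκ : 0 < k * (k + 1) / 2 := Nat.div_pos (by nlinarith) (by norm_num)
  have hκ' := cast_okKappa k
  obtain ⟨p, hl, hu⟩ := okCheck_spec h
  have hD : 0 < okDen := by norm_num [okDen]
  generalize okDen = D at hl hu hD
  have hq0 : 0 < D * (k * (k + 1) / 2) := Nat.mul_pos hD hκ
  have hD' : (0 : ℝ) < D := by exact_mod_cast hD
  have hκ0 : 0 < okKappa k := by
    rw [← hκ']
    exact_mod_cast hκ
  have b1 := half_lt_okCdf_of_okLower hk hq0 hl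
  have b2 := okCdf_lt_half_of_okUpper hk hq0 hu
  rw [Nat.cast_mul, hκ'] at b1 b2
  have c1 : (p : ℝ) / (D * okKappa k) < lam₁ := by
    by_contra! hc
    have := okCdf_anti k (n - s) h₁.le hc
    linarith
  have c2 : lam₂ < ((D + p : ℕ) : ℝ) / (D * okKappa k) := by
    by_contra! hc
    have := okCdf_anti k (n - s + 1) (by positivity) hc
    linarith
  rw [div_lt_iff₀ (by positivity)] at c1
  rw [lt_div_iff₀ (by positivity)] at c2
  push_cast at c2
  have : D * (okKappa k * lam₂ - okKappa k * lam₁) < D * 1 := by linarith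
  exact lt_of_mul_lt_mul_left this hD'.le

lemma mean_sub_lt_one_of_okCheckRange {k : ℕ} (A B C n₀ m : ℕ) (hk : 0 < k)
    (h : okCheckRange A B C k n₀ m = true) {n : ℕ} (h₀ : n₀ ≤ n) (hm : n < n₀ + m)
    {lam₁ lam₂ : ℝ} (h₁ : 0 < lam₁)
    (hF₁ : okCdf k (n - (k + 4) / 8) lam₁ = 1 / 2)
    (hF₂ : okCdf k (n - (k + 4) / 8 + 1) lam₂ = 1 / 2) :
    okKappa k * lam₂ - okKappa k * lam₁ < 1 := by
  unfold okCheckRange at h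
  simp only [forceNat_eq] at h
  exact mean_sub_lt_one_of_okCheck hk (checkRange_spec h h₀ hm) h₁ hF₁ hF₂

/-- The conclusion whenever the scale parameter may be chosen large enough. -/
lemma mean_sub_lt_one_of_scale {k : ℕ} (hk : 2 ≤ k) {ν : ℕ} {N lam₁ lam₂ : ℝ} (hN : 30 ≤ N)
    (hMN : okM k ≤ 1.05 * N) (hν : N * okM k / 2 - okM k / 8 - 0.48 ≤ ν)
    (h₁ : 0 < lam₁) (hF₁ : okCdf k ν lam₁ = 1 / 2) (hF₂ : okCdf k (ν + 1) lam₂ = 1 / 2) :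
    okKappa k * lam₂ - okKappa k * lam₁ < 1 := by
  have hw := okW_pos (k := k) (by omega)
  have hM := okM_ge hk
  have hM0 := okM_pos k
  have hκw := okKappa_mul_okW (k := k) (by omega)
  have hNe : N * okW k / okW k = N := mul_div_cancel_right₀ _ hw.ne'
  have hr : okR k (N * okW k) = N * okM k / 2 - 1 / 2 - okM k / 8 + 1 / (32 * okM k) := by
    have : okKappa k * (N * okW k) = N * okM k / 2 := by
      rw [mul_left_comm, hκw]
      ring
    rw [okR, this, cb3, okX]
    field_simp
    ring
  have hi : 1 / (32 * okM k) ≤ 0.02 := by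
    rw [div_le_iff₀ (by positivity)]
    linarith
  have hi0 : 0 ≤ 1 / (32 * okM k) := by positivity
  refine mean_sub_lt_one_of_large hk (lam₀ := N * okW k) (by rw [hNe]; exact hN)
    (by rw [hNe]; exact hMN) ?_ ?_ (by positivity) h₁ hF₁ hF₂
  · rw [hr]
    nlinarith
  · rw [hr]
    linarith

lemma mean_sub_lt_one_of_le {k n : ℕ} (hk : 2 ≤ k) (hn : 15 * k + 8 ≤ n) (hκ : k * (k + 1) / 2 ≤ n)
    {lam₁ lam₂ : ℝ} (h₁ : 0 < lam₁) (hF₁ : okCdf k (n - (k + 4) / 8) lam₁ = 1 / 2)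
    (hF₂ : okCdf k (n - (k + 4) / 8 + 1) lam₂ = 1 / 2) :
    okKappa k * lam₂ - okKappa k * lam₁ < 1 := by
  have hν : (n : ℝ) - (k + 4) / 8 ≤ ((n - (k + 4) / 8 : ℕ) : ℝ) := by
    have h1 : (((k + 4) / 8 : ℕ) : ℝ) ≤ (k + 4) / 8 := by
      simpa using Nat.cast_div_le (α := ℝ) (m := k + 4) (n := 8)
    have h2 : (n : ℝ) ≤ ((n - (k + 4) / 8 : ℕ) : ℝ) + (((k + 4) / 8 : ℕ) : ℝ) := by
      exact_mod_cast le_tsub_add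
    linarith
  have hn' : 15 * (k : ℝ) + 8 ≤ n := by exact_mod_cast hn
  have hκ' : okKappa k ≤ n := by
    rw [← cast_okKappa]
    exact_mod_cast hκ
  rcases le_or_gt k 30 with h | h
  · have hk' : (k : ℝ) ≤ 30 := by exact_mod_cast h
    refine mean_sub_lt_one_of_scale hk le_rfl ?_ ?_ h₁ hF₁ hF₂ <;> unfold okM <;> linarith
  · have hk' : (31 : ℝ) ≤ k := by exact_mod_cast h
    refine mean_sub_lt_one_of_scale hk (N := okM k / 1.05) ?_ ?_ ?_ h₁ hF₁ hF₂
    · rw [le_div_iff₀ (by norm_num)]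
      unfold okM
      linarith
    · rw [mul_div_cancel₀ _ (by norm_num)]
    · refine le_trans ?_ hν
      refine le_trans ?_ (sub_le_sub_right hκ' _)
      have h1 : okM k / 1.05 = okM k * (20 / 21) := by norm_num [div_eq_mul_inv]
      rw [h1]
      unfold okM okKappa
      nlinarith

set_option maxHeartbeats 2000000 in
lemma mean_sub_lt_one_of_lt {k n : ℕ} (hk : 1 < k) (hn : n < 15 * k + 8)
    (hcond : (k = 2 ∧ 3 * (k * (k + 1) / 2) ≤ n) ∨
             (3 ≤ k ∧ k ≤ 6 ∧ 2 * (k * (k + 1) / 2) ≤ n) ∨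
             (7 ≤ k ∧ k * (k + 1) / 2 ≤ n))
    {lam₁ lam₂ : ℝ} (h₁ : 0 < lam₁) (hF₁ : okCdf k (n - (k + 4) / 8) lam₁ = 1 / 2)
    (hF₂ : okCdf k (n - (k + 4) / 8 + 1) lam₂ = 1 / 2) :
    okKappa k * lam₂ - okKappa k * lam₁ < 1 := by
  have hk29 : k ≤ 29 := by
    by_contra! h
    have : k * (k + 1) / 2 ≤ n := by omega
    have : k * (k + 1) < 2 * (15 * k + 8) := by omega
    nlinarith
  have key : ∀ A B C n₀ m : ℕ, n₀ ≤ n → n < n₀ + m → okCheckRange A B C k n₀ m = true →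
      okKappa k * lam₂ - okKappa k * lam₁ < 1 := fun A B C n₀ m h0 hm h =>
    mean_sub_lt_one_of_okCheckRange A B C n₀ m (by omega) h h0 hm h₁ hF₁ hF₂
  clear hF₁ hF₂
  interval_cases k
  · exact key 13421734 644584 756941 9 29 (by omega) (by omega) (by decide +kernel)
  · exact key 15578792 1085996 1441579 12 41 (by omega) (by omega) (by decide +kernel)
  · exact key 932079 1662474 768521 20 48 (by omega) (by omega) (by decide +kernel)
  · exact key 3050392 2387452 1412293 30 53 (by omega) (by omega) (by decide +kernel)
  · exact key 5162210 3253696 2242710 42 56 (by omega) (by omega) (by decide +kernel)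
  · exact key 7270003 4282075 4037281 28 85 (by omega) (by omega) (by decide +kernel)
  · exact key 9375528 5411847 4538793 36 92 (by omega) (by omega) (by decide +kernel)
  · exact key 11479094 6725677 7072805 45 98 (by omega) (by omega) (by decide +kernel)
  · exact key 13581548 8158514 8827287 55 103 (by omega) (by omega) (by decide +kernel)
  · exact key 15683025 9749524 11779473 66 107 (by omega) (by omega) (by decide +kernel)
  · exact key 1006604 11482980 3903397 78 110 (by omega) (by omega) (by decide +kernel)
  · exact key 3106861 13358845 5903779 91 112 (by omega) (by omega) (by decide +kernel)
  · exact key 5206692 15378542 8332256 105 113 (by omega) (by omega) (by decide +kernel)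
  · exact key 7306178 17541906 11207300 120 113 (by omega) (by omega) (by decide +kernel)
  · exact key 9405381 19849872 14652929 136 112 (by omega) (by omega) (by decide +kernel)
  · exact key 11504349 22301754 18647619 153 110 (by omega) (by omega) (by decide +kernel)
  · exact key 13603122 24897883 23265717 171 107 (by omega) (by omega) (by decide +kernel)
  · exact key 15701728 27638161 28539025 190 103 (by omega) (by omega) (by decide +kernel)
  · exact key 1022973 30524563 4468946 210 98 (by omega) (by omega) (by decide +kernel)
  · exact key 3121315 33553352 8237798 231 92 (by omega) (by omega) (by decide +kernel)
  · exact key 5219552 36726285 12647500 253 85 (by omega) (by omega) (by decide +kernel)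
  · exact key 7317696 40043377 17741640 276 77 (by omega) (by omega) (by decide +kernel)
  · exact key 9415759 43504625 23561425 300 68 (by omega) (by omega) (by decide +kernel)
  · exact key 11513751 47110033 30149149 325 58 (by omega) (by omega) (by decide +kernel)
  · exact key 13611679 50859603 37546823 351 47 (by omega) (by omega) (by decide +kernel)
  · exact key 15709551 54753336 45796310 378 35 (by omega) (by omega) (by decide +kernel)
  · exact key 1030156 58792269 0 406 22 (by omega) (by omega) (by decide +kernel)
  · exact key 3127932 62974492 2538611 435 8 (by omega) (by omega) (by decide +kernel)

/-- Conjecture: For k > 1 and n in the stated ranges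
((i) k = 2 and n ≥ 3κ, (ii) 3 ≤ k ≤ 6 and n ≥ 2κ, (iii) k ≥ 7 and n ≥ κ),
the quantity α_(k,n) − n is a strictly decreasing function of n; here α_(k,n) = κλ for
the λ > 0 at which Σ_{j=0}^{n−⌊(k+4)/8⌋} f_k(j;λ) = 1/2. -/
theorem poissonOrderK_alpha_decreasing (k : ℕ) (hk : 1 < k) (n : ℕ)
    (hcond : (k = 2 ∧ 3 * (k * (k + 1) / 2) ≤ n) ∨
             (3 ≤ k ∧ k ≤ 6 ∧ 2 * (k * (k + 1) / 2) ≤ n) ∨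
             (7 ≤ k ∧ k * (k + 1) / 2 ≤ n))
    (lam₁ lam₂ : ℝ) (h₁ : 0 < lam₁) (h₂ : 0 < lam₂)
    (hmed₁ : ∑ j ∈ Finset.range ((n - (k + 4) / 8) + 1), poissonOrderKPmf k lam₁ j = 1 / 2)
    (hmed₂ : ∑ j ∈ Finset.range ((n + 1 - (k + 4) / 8) + 1),
        poissonOrderKPmf k lam₂ j = 1 / 2) :
    ((k * (k + 1) / 2 : ℕ) : ℝ) * lam₂ - ((n : ℝ) + 1) <
      ((k * (k + 1) / 2 : ℕ) : ℝ) * lam₁ - (n : ℝ) := by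
  have hκn : k * (k + 1) / 2 ≤ n := by omega
  have hkn : (k + 4) / 8 ≤ n := by
    have : k * 2 ≤ k * (k + 1) := Nat.mul_le_mul_left k (by omega)
    omega
  rw [show n + 1 - (k + 4) / 8 = n - (k + 4) / 8 + 1 by omega] at hmed₂
  have h : okKappa k * lam₂ - okKappa k * lam₁ < 1 := by
    rcases lt_or_ge n (15 * k + 8) with hn | hn
    · exact mean_sub_lt_one_of_lt hk hn hcond h₁ hmed₁ hmed₂
    · exact mean_sub_lt_one_of_le hk hn hκn h₁ hmed₁ hmed₂
  rw [cast_okKappa]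
  linarith
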